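/- arXiv:0811.4309 — 2 statements merged into one kernel-verified Lean document; each statement's English description precedes it below -/
import Mathlib

section
/- Let k be a field, c ≥ 1 an odd integer, and let A = k⟨X_1, …, X_c⟩/(X_i^2 for all i; X_iX_j + X_jX_i for all i ≠ j) be the exterior algebra on a c-dimensional k-vector space. Then for all finitely generated left A-modules M and N, the following are equivalent: (i) Ext_A^i(M,N) = 0 for all sufficiently large i; (ii) Ext_A^i(M,N) = 0 for all i > 0; (iii) Ext_A^i(N,M) = 0 for all sufficiently large i; (iv) Ext_A^i(N,M) = 0 for all i > 0. -/
/-!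
Ext-symmetry for all finitely generated modules over the exterior algebra on an
odd-dimensional vector space (Example (i) after Theorem `symmetrysymmetric`).
-/

noncomputable section

open CategoryTheory

/-- The defining relations of the quantum complete intersection `A_q^a`:
`X_i ^ (a i) = 0` and `X_i * X_j = q i j • (X_j * X_i)`. -/
def qciRel (k : Type) [Field k] (c : ℕ) (q : Fin c → Fin c → k) (a : Fin c → ℕ) :
    FreeAlgebra k (Fin c) → FreeAlgebra k (Fin c) → Prop := fun x y =>
  (∃ i, x = FreeAlgebra.ι k i ^ a i ∧ y = 0) ∨
  (∃ i j, x = FreeAlgebra.ι k i * FreeAlgebra.ι k j ∧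
    y = q i j • (FreeAlgebra.ι k j * FreeAlgebra.ι k i))

/-- The quantum complete intersection `A_q^a = k⟨X_1,…,X_c⟩/(X_i^{a_i}, X_iX_j - q_{ij}X_jX_i)`. -/
abbrev QCI (k : Type) [Field k] (c : ℕ) (q : Fin c → Fin c → k) (a : Fin c → ℕ) : Type :=
  RingQuot (qciRel k c q a)

/-- The commutation matrix of the exterior algebra: `q_{ii} = 1` and `q_{ij} = -1`
for `i ≠ j`. -/
def extQ (k : Type) [Field k] (c : ℕ) : Fin c → Fin c → k :=
  fun i j => if i = j then 1 else -1

/-- The exterior algebra on a `c`-dimensional vector space, as the quantum complete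
intersection `k⟨X_1,…,X_c⟩/(X_i^2, X_iX_j + X_jX_i (i ≠ j))`. -/
abbrev ExtAlg (k : Type) [Field k] (c : ℕ) : Type :=
  QCI k c (extQ k c) (fun _ => 2)

/-- `Ext_A^i(M, N) = 0`. -/
def extVanish (A : Type) [Ring A] (M N : Type) [AddCommGroup M] [Module A M]
    [AddCommGroup N] [Module A N] (i : ℕ) : Prop :=
  Subsingleton
    (((Ext ℤ (ModuleCat A) i).obj (Opposite.op (ModuleCat.of A M))).obj (ModuleCat.of A N))

set_option linter.unusedSectionVars false
set_option linter.unusedSimpArgs false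
namespace ExtSym

section basics
variable {k ι W W' W'' : Type} [Field k] [DecidableEq ι]
  [AddCommGroup W] [Module k W] [AddCommGroup W'] [Module k W'] [AddCommGroup W''] [Module k W'']

/-- Formal polynomial-like functions: coefficients in `W` indexed by monomials. -/
abbrev Fn (ι W : Type) := (ι →₀ ℕ) → W

/-- multiplication by the variable `i` -/
def Y (i : ι) : Fn ι W →+ Fn ι W where
  toFun f m := if m i = 0 then 0 else f (m - Finsupp.single i 1)
  map_zero' := by ext m; simp
  map_add' f g := by ext m; by_cases h : m i = 0 <;> simp [h]

/-- division by the variable `i` -/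
def D (i : ι) : Fn ι W →+ Fn ι W where
  toFun f m := f (m + Finsupp.single i 1)
  map_zero' := by ext m; simp
  map_add' f g := by ext m; simp

/-- reduction modulo the variable `i` -/
def pr (i : ι) : Fn ι W →+ Fn ι W where
  toFun f m := if m i = 0 then f m else 0
  map_zero' := by ext m; simp
  map_add' f g := by ext m; by_cases h : m i = 0 <;> simp [h]

/-- apply a linear map to coefficients -/
def mp (φ : W →ₗ[k] W') : Fn ι W →+ Fn ι W' where
  toFun f m := φ (f m)
  map_zero' := by ext m; simp
  map_add' f g := by ext m; simp

/-- homogeneous of degree `n` -/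
def F (n : ℕ) : AddSubgroup (Fn ι W) where
  carrier := {f | ∀ m, m.degree ≠ n → f m = 0}
  zero_mem' := by intro m _; rfl
  add_mem' := by intro f g hf hg m hm; simp [hf m hm, hg m hm]
  neg_mem' := by intro f hf m hm; simp [hf m hm]

/-- involving only variables of `T` -/
def V (T : Finset ι) : AddSubgroup (Fn ι W) where
  carrier := {f | ∀ m, ¬ (m.support ⊆ T) → f m = 0}
  zero_mem' := by intro m _; rfl
  add_mem' := by intro f g hf hg m hm; simp [hf m hm, hg m hm]
  neg_mem' := by intro f hf m hm; simp [hf m hm]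

/-- the Koszul differential in the variables of `T` -/
def dT (T : Finset ι) (x : ι → W →ₗ[k] W) : Fn ι W →+ Fn ι W :=
  ∑ i ∈ T, (Y i).comp (mp (x i))

theorem Y_apply (i : ι) (f : Fn ι W) (m) :
    Y i f m = if m i = 0 then 0 else f (m - Finsupp.single i 1) := rfl
theorem D_apply (i : ι) (f : Fn ι W) (m) : D i f m = f (m + Finsupp.single i 1) := rfl
theorem pr_apply (i : ι) (f : Fn ι W) (m) : pr i f m = if m i = 0 then f m else 0 := rfl
theorem mp_apply (φ : W →ₗ[k] W') (f : Fn ι W) (m) : mp φ f m = φ (f m) := rfl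
theorem dT_apply (T : Finset ι) (x : ι → W →ₗ[k] W) (f : Fn ι W) :
    dT T x f = ∑ i ∈ T, Y i (mp (x i) f) := by simp [dT]

theorem mem_F {n : ℕ} {f : Fn ι W} : f ∈ F n ↔ ∀ m, m.degree ≠ n → f m = 0 := Iff.rfl
theorem mem_V {T : Finset ι} {f : Fn ι W} : f ∈ V T ↔ ∀ m, ¬ (m.support ⊆ T) → f m = 0 := Iff.rfl

theorem sub_single_add {i : ι} {m : ι →₀ ℕ} (h : m i ≠ 0) :
    m - Finsupp.single i 1 + Finsupp.single i 1 = m := by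
  ext j
  by_cases hj : i = j
  · subst hj; simp; omega
  · simp [hj]

theorem DY (i : ι) (f : Fn ι W) : D i (Y i f) = f := by
  ext m; simp [D_apply, Y_apply]

theorem YD (i : ι) (f : Fn ι W) : Y i (D i f) = f - pr i f := by
  ext m
  by_cases h : m i = 0
  · simp [D_apply, Y_apply, pr_apply, h]
  · simp [D_apply, Y_apply, pr_apply, h, sub_single_add h]

theorem Y_inj (i : ι) {f g : Fn ι W} (h : Y i f = Y i g) : f = g := by
  rw [← DY i f, h, DY]

theorem prY (i : ι) (f : Fn ι W) : pr i (Y i f) = 0 := by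
  ext m
  by_cases h : m i = 0 <;> simp [Y_apply, pr_apply, h]

theorem prY_ne {i j : ι} (hij : i ≠ j) (f : Fn ι W) : pr i (Y j f) = Y j (pr i f) := by
  ext m
  by_cases h : m i = 0 <;> by_cases h' : m j = 0 <;> simp [Y_apply, pr_apply, h, h', hij.symm]

theorem YY (i j : ι) (f : Fn ι W) : Y i (Y j f) = Y j (Y i f) := by
  by_cases hij : i = j
  · rw [hij]
  · ext m
    by_cases h : m i = 0 <;> by_cases h' : m j = 0 <;>
      simp [Y_apply, h, h', hij, Ne.symm hij, tsub_right_comm]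

theorem mpY (i : ι) (φ : W →ₗ[k] W') (f : Fn ι W) : mp φ (Y i f) = Y i (mp φ f) := by
  ext m
  by_cases h : m i = 0 <;> simp [Y_apply, mp_apply, h]

theorem mp_pr (i : ι) (φ : W →ₗ[k] W') (f : Fn ι W) : mp φ (pr i f) = pr i (mp φ f) := by
  ext m
  by_cases h : m i = 0 <;> simp [pr_apply, mp_apply, h]

theorem mp_mp (φ : W →ₗ[k] W') (ψ : W' →ₗ[k] W'') (f : Fn ι W) :
    mp ψ (mp φ f) = mp (ψ ∘ₗ φ) f := rfl

theorem Y_F {i : ι} {n : ℕ} {f : Fn ι W} (hf : f ∈ F n) : Y i f ∈ F (n + 1) := by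
  intro m hm
  by_cases h : m i = 0
  · simp [Y_apply, h]
  · simp only [Y_apply, h, if_false]
    apply hf
    intro h2
    apply hm
    rw [← sub_single_add h, map_add, h2]; simp

theorem D_F {i : ι} {n : ℕ} {f : Fn ι W} (hf : f ∈ F (n + 1)) : D i f ∈ F n := by
  intro m hm
  apply hf
  simpa using hm

theorem pr_F {i : ι} {n : ℕ} {f : Fn ι W} (hf : f ∈ F n) : pr i f ∈ F n := by
  intro m hm
  simp [pr_apply, hf m hm]

theorem mp_F {φ : W →ₗ[k] W'} {n : ℕ} {f : Fn ι W} (hf : f ∈ F n) : mp φ f ∈ F n := by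
  intro m hm
  simp [mp_apply, hf m hm]

theorem dT_F {T : Finset ι} {x : ι → W →ₗ[k] W} {n : ℕ} {f : Fn ι W} (hf : f ∈ F n) :
    dT T x f ∈ F (n + 1) := by
  rw [dT_apply]
  exact AddSubgroup.sum_mem _ fun i _ => Y_F (mp_F hf)

theorem Y_V {i : ι} {T : Finset ι} (hi : i ∈ T) {f : Fn ι W} (hf : f ∈ V T) : Y i f ∈ V T := by
  intro m hm
  by_cases h : m i = 0
  · simp [Y_apply, h]
  · simp only [Y_apply, h, if_false]
    apply hf
    intro h2
    apply hm
    intro j hj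
    by_cases hij : i = j
    · exact hij ▸ hi
    · apply h2; simpa [hij] using hj

theorem D_V {i : ι} {T : Finset ι} {f : Fn ι W} (hf : f ∈ V T) : D i f ∈ V T := by
  intro m hm
  apply hf
  intro h; apply hm
  intro j hj
  apply h
  simp at hj ⊢
  exact fun h0 => absurd h0 hj

theorem mp_V {φ : W →ₗ[k] W'} {T : Finset ι} {f : Fn ι W} (hf : f ∈ V T) : mp φ f ∈ V T := by
  intro m hm
  simp [mp_apply, hf m hm]

theorem pr_V {i : ι} {T : Finset ι} {f : Fn ι W} (hf : f ∈ V (insert i T)) : pr i f ∈ V T := by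
  intro m hm
  by_cases h : m i = 0
  · simp only [pr_apply, h, if_true]
    apply hf
    intro h2; apply hm
    intro j hj
    rcases Finset.mem_insert.1 (h2 hj) with rfl | h3
    · simp [h] at hj
    · exact h3
  · simp [pr_apply, h]

theorem V_mono {T T' : Finset ι} (h : T ⊆ T') {f : Fn ι W} (hf : f ∈ V T) : f ∈ V T' :=
  fun m hm => hf m fun h2 => hm (h2.trans h)

theorem pr_of_V {i : ι} {T : Finset ι} (hi : i ∉ T) {f : Fn ι W} (hf : f ∈ V T) : pr i f = f := by
  ext m
  by_cases h : m i = 0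
  · simp [pr_apply, h]
  · simp only [pr_apply, h, if_false]
    symm; apply hf
    intro h2; exact hi (h2 (by simpa using h))

theorem dT_V {T : Finset ι} {x : ι → W →ₗ[k] W} {f : Fn ι W} (hf : f ∈ V T) :
    dT T x f ∈ V T := by
  rw [dT_apply]
  exact AddSubgroup.sum_mem _ fun i hi => Y_V hi (mp_V hf)

theorem dT_Y (T : Finset ι) (x : ι → W →ₗ[k] W) (i : ι) (f : Fn ι W) :
    dT T x (Y i f) = Y i (dT T x f) := by
  simp only [dT_apply, map_sum, mpY]
  exact Finset.sum_congr rfl fun j _ => YY _ _ _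

theorem dT_insert {T : Finset ι} {i : ι} (hi : i ∉ T) (x : ι → W →ₗ[k] W) (f : Fn ι W) :
    dT (insert i T) x f = Y i (mp (x i) f) + dT T x f := by
  simp only [dT_apply, Finset.sum_insert hi]

theorem pr_dT {T : Finset ι} {i : ι} (hi : i ∉ T) (x : ι → W →ₗ[k] W) (f : Fn ι W) :
    pr i (dT T x f) = dT T x (pr i f) := by
  simp only [dT_apply, map_sum]
  refine Finset.sum_congr rfl fun j hj => ?_
  rw [prY_ne (by rintro rfl; exact hi hj), mp_pr]

theorem mp_dT {T : Finset ι} {x : ι → W →ₗ[k] W} {x' : ι → W' →ₗ[k] W'} {φ φ' : W →ₗ[k] W'}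
    (h : ∀ i w, φ (x i w) = x' i (φ' w)) (f : Fn ι W) :
    mp φ (dT T x f) = dT T x' (mp φ' f) := by
  simp only [dT_apply, map_sum, mpY]
  refine Finset.sum_congr rfl fun j _ => ?_
  congr 1
  ext m; exact h _ _

/-- anticommuting square-zero operators -/
structure Anti (x : ι → W →ₗ[k] W) : Prop where
  sq : ∀ i w, x i (x i w) = 0
  anti : ∀ i j w, x i (x j w) + x j (x i w) = 0

theorem mp_dT_anti {x : ι → W →ₗ[k] W} (hx : Anti x) (T : Finset ι) (i : ι) (f : Fn ι W) :
    dT T x (mp (x i) f) = - mp (x i) (dT T x f) := by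
  simp only [dT_apply, map_sum, mpY, ← Finset.sum_neg_distrib, ← map_neg]
  refine Finset.sum_congr rfl fun j _ => ?_
  congr 1
  ext m
  simp only [mp_apply, map_neg, Pi.neg_apply]
  exact eq_neg_of_add_eq_zero_left (hx.anti j i _)

theorem mp_sq {x : ι → W →ₗ[k] W} (hx : Anti x) (i : ι) (f : Fn ι W) :
    mp (x i) (mp (x i) f) = 0 := by
  ext m; exact hx.sq i _

theorem Yit_F {i : ι} {n : ℕ} {f : Fn ι W} (hf : f ∈ F n) (r : ℕ) : (Y i)^[r] f ∈ F (n + r) := by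
  induction r with
  | zero => simpa using hf
  | succ r ih => rw [Function.iterate_succ_apply']; exact Y_F ih

theorem Yit_V {i : ι} {T : Finset ι} (hi : i ∈ T) {f : Fn ι W} (hf : f ∈ V T) (r : ℕ) :
    (Y i)^[r] f ∈ V T := by
  induction r with
  | zero => simpa using hf
  | succ r ih => rw [Function.iterate_succ_apply']; exact Y_V hi ih

theorem dT_Yit (T : Finset ι) (x : ι → W →ₗ[k] W) (i : ι) (r : ℕ) (f : Fn ι W) :
    dT T x ((Y i)^[r] f) = (Y i)^[r] (dT T x f) := by
  induction r with
  | zero => rfl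
  | succ r ih => rw [Function.iterate_succ_apply', dT_Y, ih, Function.iterate_succ_apply']

theorem Yit_map {α : Type} [AddCommGroup α] (f : α →+ α) (r : ℕ) (a b : α) :
    f^[r] (a - b) = f^[r] a - f^[r] b := iterate_map_sub f r a b

theorem Yit_Y (i j : ι) (r : ℕ) (f : Fn ι W) : (Y i)^[r] (Y j f) = Y j ((Y i)^[r] f) := by
  induction r with
  | zero => rfl
  | succ r ih => rw [Function.iterate_succ_apply', ih, YY, Function.iterate_succ_apply']

/-- eventually nilpotent action of variables on cohomology -/
def Nilp (T : Finset ι) (x : ι → W →ₗ[k] W) : Prop :=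
  ∀ i ∈ T, ∃ r n₀ : ℕ, ∀ n ≥ n₀, ∀ f ∈ F (n + 1), f ∈ V T → dT T x f = 0 →
    ∃ g ∈ F (n + r), g ∈ V T ∧ (Y i)^[r] f = dT T x g

theorem main_vanish {x : ι → W →ₗ[k] W} (hx : Anti x) (T : Finset ι) (hN : Nilp T x) (n : ℕ)
    (f : Fn ι W) (hf : f ∈ F (n + 1)) (hV : f ∈ V T) (hd : dT T x f = 0) :
    ∃ g ∈ F n, g ∈ V T ∧ f = dT T x g := by
  induction T using Finset.induction_on generalizing n f with
  | empty =>
    refine ⟨0, zero_mem _, zero_mem _, ?_⟩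
    rw [map_zero]
    ext m
    by_cases hm : m = 0
    · apply hf; simp [hm]
    · apply hV; simpa using hm
  | insert c T hc ih =>
    have hNT : Nilp T x := by
      intro i hi
      obtain ⟨r, n₀, H⟩ := hN i (Finset.mem_insert_of_mem hi)
      refine ⟨r + r, n₀, fun n hn f hf hV hd => ?_⟩
      have hic : c ≠ i := by rintro rfl; exact hc hi
      have hV' := V_mono (Finset.subset_insert c T) hV
      obtain ⟨g, hg, hgV, hg'⟩ := H n hn (mp (x c) f) (mp_F hf) (mp_V hV') (by
        rw [dT_insert hc, mp_sq hx, mp_dT_anti hx, hd]; simp)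
      have hfin : (Y i)^[r] f - Y c g ∈ F (n + r + 1) := by
        refine sub_mem ?_ (Y_F hg)
        have := Yit_F (i := i) hf r
        rwa [show n + 1 + r = n + r + 1 by ring] at this
      obtain ⟨h, hh, hhV, hh'⟩ := H (n + r) (by omega) ((Y i)^[r] f - Y c g) hfin
        (sub_mem (Yit_V (Finset.mem_insert_of_mem hi) hV' r)
          (Y_V (Finset.mem_insert_self _ _) hgV)) (by
          rw [map_sub, dT_Yit, dT_Y, ← hg', dT_insert hc, hd, add_zero, Yit_Y, sub_self])
      refine ⟨pr c h, pr_F (by rwa [← add_assoc]), pr_V hhV, ?_⟩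
      rw [← pr_dT hc]
      have h1 := congrArg (pr c) hh'
      rw [iterate_map_sub, ← Function.iterate_add_apply, Yit_Y, map_sub, prY, sub_zero,
        dT_insert hc, map_add, prY, zero_add, pr_of_V hc (Yit_V hi hV _)] at h1
      exact h1
    have key : ∀ n, ∀ f ∈ F (n + 1), f ∈ V (insert c T) →
        (∃ g ∈ F (n + 1), g ∈ V (insert c T) ∧ Y c f = dT (insert c T) x g) →
        ∃ g ∈ F n, g ∈ V (insert c T) ∧ f = dT (insert c T) x g := by
      rintro n f hf hV ⟨g, hg, hgV, hg'⟩
      have h1 := congrArg (pr c) hg'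
      rw [prY, dT_insert hc, map_add, prY, zero_add, pr_dT hc] at h1
      obtain ⟨h, hh, hhV, hh'⟩ := ih hNT n (pr c g) (pr_F hg) (pr_V hgV) h1.symm
      have hhV' := V_mono (Finset.subset_insert c T) hhV
      refine ⟨D c g - mp (x c) h, sub_mem (D_F hg) (mp_F hh), sub_mem (D_V hgV) (mp_V hhV'), ?_⟩
      apply Y_inj c
      rw [← dT_Y, map_sub, YD, hh', hg', sub_sub, map_sub, add_comm (dT T x h),
        ← dT_insert hc, eq_comm, sub_eq_self, dT_insert hc, dT_insert hc, map_add, map_add, mpY,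
        mp_sq hx, map_zero, map_zero, zero_add, map_add, dT_Y, mp_dT_anti hx, map_neg, ← hh', ← h1,
        add_zero, add_neg_cancel]
    have key2 : ∀ r n, ∀ f ∈ F (n + 1), f ∈ V (insert c T) →
        (∃ g ∈ F (n + r), g ∈ V (insert c T) ∧ (Y c)^[r] f = dT (insert c T) x g) →
        ∃ g ∈ F n, g ∈ V (insert c T) ∧ f = dT (insert c T) x g := by
      intro r
      induction r with
      | zero => intro n f hf hV h; simpa using h
      | succ r ihr =>
        rintro n f hf hV ⟨g, hg, hgV, hg'⟩
        apply key n f hf hV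
        apply ihr (n + 1) (Y c f) (Y_F hf) (Y_V (Finset.mem_insert_self _ _) hV)
        refine ⟨g, by rwa [show n + 1 + r = n + (r + 1) by ring], hgV, ?_⟩
        rw [← hg', Function.iterate_succ_apply]
    obtain ⟨r, n₀, H⟩ := hN c (Finset.mem_insert_self _ _)
    apply key2 (n₀ + r) n f hf hV
    have hF := Yit_F (i := c) hf n₀
    rw [show n + 1 + n₀ = n + n₀ + 1 by ring] at hF
    obtain ⟨g, hg, hgV, hg'⟩ := H (n + n₀) (by omega) ((Y c)^[n₀] f) hF
      (Yit_V (Finset.mem_insert_self _ _) hV _) (by rw [dT_Yit, hd, iterate_map_zero])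
    refine ⟨g, by rwa [← add_assoc], hgV, ?_⟩
    rw [← hg', ← Function.iterate_add_apply, add_comm]

end basics
end ExtSym

namespace ExtSym

section double
variable {k ι W W' : Type} [Field k] [DecidableEq ι] [Fintype ι]
  [AddCommGroup W] [Module k W] [AddCommGroup W'] [Module k W']

/-- full Koszul differential -/
abbrev dd (x : ι → W →ₗ[k] W) : Fn ι W →+ Fn ι W := dT Finset.univ x

/-- exactness in degree `n+1` -/
def Ex (a b : ι → W →ₗ[k] W) (n : ℕ) : Prop :=
  ∀ f ∈ F (n + 1), dd a f = 0 → ∃ g ∈ F n, dd b g = f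

theorem V_univ (f : Fn ι W) : f ∈ V Finset.univ := fun m hm => absurd (Finset.subset_univ _) hm

theorem Ex_of_Nilp {x : ι → W →ₗ[k] W} (hx : Anti x) (hN : Nilp Finset.univ x) (n : ℕ) :
    Ex x x n := by
  intro f hf hd
  obtain ⟨g, hg, -, h⟩ := main_vanish hx Finset.univ hN n f hf (V_univ f) hd
  exact ⟨g, hg, h.symm⟩

/-- a contraction -/
def IsContr (x : ι → W →ₗ[k] W) (i : ι) (s : W →ₗ[k] W) : Prop :=
  ∀ j w, s (x j w) + x j (s w) = if i = j then w else 0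

theorem Ex_of_contr {x : ι → W →ₗ[k] W} (hx : Anti x) (h : ∀ i, ∃ s, IsContr x i s) (n : ℕ) :
    Ex x x n := by
  apply Ex_of_Nilp hx
  intro i _
  obtain ⟨s, hs⟩ := h i
  refine ⟨1, 0, fun n _ f hf _ hd => ⟨mp s f, mp_F hf, V_univ _, ?_⟩⟩
  have h1 : mp s (dT Finset.univ x f) + dT Finset.univ x (mp s f) = Y i f := by
    simp only [dT_apply, map_sum, mpY, ← Finset.sum_add_distrib, ← map_add]
    have : ∀ j, mp s (mp (x j) f) + mp (x j) (mp s f) = if i = j then f else 0 := by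
      intro j
      ext m
      simp only [Pi.add_apply, mp_apply, hs j]
      split_ifs <;> rfl
    simp only [this]
    rw [Finset.sum_eq_single i]
    · simp
    · intro b _ hb; simp [hb.symm]
    · simp
  rw [hd, map_zero, zero_add] at h1
  simp [h1]

structure Anti2 (a b : ι → W →ₗ[k] W) : Prop where
  ab : ∀ i w, a i (b i w) = 0
  ba : ∀ i w, b i (a i w) = 0
  abab : ∀ i j w, a i (b j w) + a j (b i w) = 0
  baba : ∀ i j w, b i (a j w) + b j (a i w) = 0

def dbl (a b : ι → W →ₗ[k] W) (i : ι) : W × W →ₗ[k] W × W :=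
  LinearMap.prod (b i ∘ₗ LinearMap.snd k W W) (a i ∘ₗ LinearMap.fst k W W)

theorem dbl_apply (a b : ι → W →ₗ[k] W) (i : ι) (w : W × W) :
    dbl a b i w = (b i w.2, a i w.1) := rfl

theorem Anti2.anti {a b : ι → W →ₗ[k] W} (h : Anti2 a b) : Anti (dbl a b) where
  sq i w := by simp [dbl_apply, h.ab, h.ba]
  anti i j w := by simp [dbl_apply, h.abab, h.baba]

theorem Anti2.dd_zero {a b : ι → W →ₗ[k] W} (h : Anti2 a b) (f : Fn ι W) :
    dd a (dd b f) = 0 := by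
  have h1 : ∀ m, dd a (dd b f) m = 0 := by
    have hsum : dd a (dd b f) = ∑ p : ι × ι, Y p.1 (Y p.2 (mp (a p.1) (mp (b p.2) f))) := by
      simp only [dT_apply, map_sum, mpY]
      rw [← Finset.univ_product_univ, Finset.sum_product, Finset.sum_comm]
    have : dd a (dd b f) = 0 := by
      rw [hsum]
      refine Finset.sum_involution (fun p _ => (p.2, p.1)) ?_ ?_ ?_ ?_
      · rintro ⟨i, j⟩ _
        simp only
        rw [YY j i, ← map_add, ← map_add]
        have : mp (a i) (mp (b j) f) + mp (a j) (mp (b i) f) = 0 := by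
          ext m; exact h.abab i j _
        rw [this]; simp
      · rintro ⟨i, j⟩ _ hne heq
        simp only [Prod.mk.injEq] at heq
        obtain rfl : j = i := heq.1
        apply hne
        have : mp (a j) (mp (b j) f) = 0 := by ext m; exact h.ab j _
        simp [this]
      · simp
      · simp
    intro m; rw [this]; rfl
  ext m; exact h1 m

theorem Ex_of_dbl_left {a b : ι → W →ₗ[k] W} {n : ℕ} (h : Ex (dbl a b) (dbl a b) n) :
    Ex a b n := by
  intro f hf hd
  obtain ⟨g, hg, hg'⟩ := h (mp (LinearMap.inl k W W) f) (mp_F hf) (by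
    have : mp (LinearMap.inr k W W) (dT Finset.univ a f)
      = dT Finset.univ (dbl a b) (mp (LinearMap.inl k W W) f) :=
      mp_dT (by intro i w; simp [dbl_apply]) f
    rw [← this, hd, map_zero])
  refine ⟨mp (LinearMap.snd k W W) g, mp_F hg, ?_⟩
  have : mp (LinearMap.fst k W W) (dT Finset.univ (dbl a b) g)
      = dT Finset.univ b (mp (LinearMap.snd k W W) g) :=
      mp_dT (by intro i w; simp [dbl_apply]) g
  rw [← this, hg']; rfl

theorem Ex_of_dbl_right {a b : ι → W →ₗ[k] W} {n : ℕ} (h : Ex (dbl a b) (dbl a b) n) :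
    Ex b a n := by
  intro f hf hd
  obtain ⟨g, hg, hg'⟩ := h (mp (LinearMap.inr k W W) f) (mp_F hf) (by
    have : mp (LinearMap.inl k W W) (dT Finset.univ b f)
      = dT Finset.univ (dbl a b) (mp (LinearMap.inr k W W) f) :=
      mp_dT (by intro i w; simp [dbl_apply]) f
    rw [← this, hd, map_zero])
  refine ⟨mp (LinearMap.fst k W W) g, mp_F hg, ?_⟩
  have : mp (LinearMap.snd k W W) (dT Finset.univ (dbl a b) g)
      = dT Finset.univ a (mp (LinearMap.fst k W W) g) :=
      mp_dT (by intro i w; simp [dbl_apply]) g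
  rw [← this, hg']; rfl

/-- vanishing of alternating cohomology in high degrees gives everything -/
theorem Ex_dbl_of_alt {a b : ι → W →ₗ[k] W} (hab : Anti2 a b) (n₀ : ℕ)
    (h : ∀ n ≥ n₀, if Even (n + 1) then Ex a b n else Ex b a n) (n : ℕ) :
    Ex (dbl a b) (dbl a b) n := by
  apply Ex_of_Nilp hab.anti
  intro i _
  refine ⟨1, n₀, fun n hn f hf _ hd => ?_⟩
  have e1 : ∀ f, mp (LinearMap.fst k W W) (dT Finset.univ (dbl a b) f)
      = dT Finset.univ b (mp (LinearMap.snd k W W) f) :=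
      fun f => mp_dT (by intro i w; simp [dbl_apply]) f
  have e2 : ∀ f, mp (LinearMap.snd k W W) (dT Finset.univ (dbl a b) f)
      = dT Finset.univ a (mp (LinearMap.fst k W W) f) :=
      fun f => mp_dT (by intro i w; simp [dbl_apply]) f
  have d1 : dT Finset.univ a (mp (LinearMap.fst k W W) f) = 0 := by rw [← e2, hd, map_zero]
  have d2 : dT Finset.univ b (mp (LinearMap.snd k W W) f) = 0 := by rw [← e1, hd, map_zero]
  have key : ∀ {u v : ι → W →ₗ[k] W} (_ : Ex u v n) (f : Fn ι W), f ∈ F (n + 1) →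
      dT Finset.univ u f = 0 → ∃ g ∈ F (n + 1), dT Finset.univ v g = Y i f := by
    intro u v huv f hf hd
    obtain ⟨g, hg, hg'⟩ := huv f hf hd
    exact ⟨Y i g, Y_F hg, by rw [dT_Y, hg']⟩
  have key' : ∀ {u v : ι → W →ₗ[k] W} (_ : Ex u v (n + 1)) (f : Fn ι W), f ∈ F (n + 1) →
      dT Finset.univ u f = 0 → ∃ g ∈ F (n + 1), dT Finset.univ v g = Y i f := by
    intro u v huv f hf hd
    exact huv (Y i f) (Y_F hf) (by rw [dT_Y, hd, map_zero])
  have h1 := h n hn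
  have h2 := h (n + 1) (by omega)
  have : (∃ g ∈ F (n + 1), dT Finset.univ b g = Y i (mp (LinearMap.fst k W W) f)) ∧
      (∃ g ∈ F (n + 1), dT Finset.univ a g = Y i (mp (LinearMap.snd k W W) f)) := by
    by_cases hE : Even (n + 1)
    · have hE' : ¬ Even (n + 1 + 1) := by rw [Nat.even_add_one]; simpa using hE
      rw [if_pos hE] at h1
      rw [if_neg hE'] at h2
      exact ⟨key h1 _ (mp_F hf) d1, key' h2 _ (mp_F hf) d2⟩
    · have hE' : Even (n + 1 + 1) := by rw [Nat.even_add_one]; exact hE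
      rw [if_neg hE] at h1
      rw [if_pos hE'] at h2
      exact ⟨key' h2 _ (mp_F hf) d1, key h1 _ (mp_F hf) d2⟩
  obtain ⟨⟨g, hg, hg'⟩, ⟨g₂, hg₂, hg₂'⟩⟩ := this
  refine ⟨mp (LinearMap.inr k W W) g + mp (LinearMap.inl k W W) g₂,
    add_mem (mp_F hg) (mp_F hg₂), V_univ _, ?_⟩
  have e3 : mp (LinearMap.inl k W W) (dT Finset.univ b g)
      = dT Finset.univ (dbl a b) (mp (LinearMap.inr k W W) g) :=
      mp_dT (by intro i w; simp [dbl_apply]) g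
  have e4 : mp (LinearMap.inr k W W) (dT Finset.univ a g₂)
      = dT Finset.univ (dbl a b) (mp (LinearMap.inl k W W) g₂) :=
      mp_dT (by intro i w; simp [dbl_apply]) g₂
  rw [map_add, ← e3, ← e4, hg', hg₂', mpY, mpY, ← map_add]
  simp only [Function.iterate_one]
  congr 1
  ext m <;> simp [mp_apply]

def IsContr2 (a b : ι → W →ₗ[k] W) (i : ι) (p q : W →ₗ[k] W) : Prop :=
  (∀ j w, p (a j w) + b j (q w) = if i = j then w else 0) ∧
  (∀ j w, q (b j w) + a j (p w) = if i = j then w else 0)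

theorem IsContr2.dbl {a b : ι → W →ₗ[k] W} {i : ι} {p q : W →ₗ[k] W} (h : IsContr2 a b i p q) :
    ∃ s, IsContr (dbl a b) i s := by
  refine ⟨LinearMap.prod (p ∘ₗ LinearMap.snd k W W) (q ∘ₗ LinearMap.fst k W W), fun j w => ?_⟩
  have h1 := h.1 j w.1
  have h2 := h.2 j w.2
  simp only [dbl_apply, LinearMap.prod_apply, Function.prod, LinearMap.comp_apply, LinearMap.fst_apply,
    LinearMap.snd_apply, Prod.mk_add_mk, h1, h2]
  split_ifs <;> rfl

theorem IsContr.split {a b : ι → W →ₗ[k] W} {i : ι} {s : W × W →ₗ[k] W × W}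
    (h : IsContr (dbl a b) i s) : ∃ p q, IsContr2 a b i p q := by
  refine ⟨LinearMap.fst k W W ∘ₗ s ∘ₗ LinearMap.inr k W W,
    LinearMap.snd k W W ∘ₗ s ∘ₗ LinearMap.inl k W W, fun j w => ?_, fun j w => ?_⟩
  · have := congrArg Prod.fst (h j (w, 0))
    simp only [dbl_apply, map_zero] at this
    simp only [LinearMap.comp_apply, LinearMap.inr_apply, LinearMap.inl_apply,
      LinearMap.fst_apply, LinearMap.snd_apply]
    refine Eq.trans this ?_
    split_ifs <;> rfl
  · have := congrArg Prod.snd (h j (0, w))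
    simp only [dbl_apply, map_zero] at this
    simp only [LinearMap.comp_apply, LinearMap.inr_apply, LinearMap.inl_apply,
      LinearMap.fst_apply, LinearMap.snd_apply]
    refine Eq.trans this ?_
    split_ifs <;> rfl

/-- constants -/
def C (w : W) : Fn ι W := fun m => if m = 0 then w else 0

theorem C_F (w : W) : (C w : Fn ι W) ∈ F 0 := by
  intro m hm
  have : m ≠ 0 := by rintro rfl; simp at hm
  simp [C, this]

theorem C_zero (w : W) : (C w : Fn ι W) 0 = w := by simp [C]

theorem eq_C {f : Fn ι W} (hf : f ∈ F 0) : f = C (f 0) := by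
  ext m
  by_cases hm : m = 0
  · simp [C, hm]
  · simp only [C, hm, if_false]
    apply hf; rwa [Ne, Finsupp.degree_eq_zero_iff]

theorem mp_C (φ : W →ₗ[k] W') (w : W) : mp φ (C w : Fn ι W) = C (φ w) := by
  ext m; by_cases hm : m = 0 <;> simp [C, mp_apply, hm]

theorem Y_single (i j : ι) (f : Fn ι W) :
    Y i f (Finsupp.single j 1) = if i = j then f 0 else 0 := by
  by_cases h : i = j
  · subst h; simp [Y_apply]
  · simp [Y_apply, h, Finsupp.single_apply, Ne.symm h]

theorem dd_single (x : ι → W →ₗ[k] W) (f : Fn ι W) (j : ι) :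
    dd x f (Finsupp.single j 1) = x j (f 0) := by
  simp only [dT_apply, Finset.sum_apply, Y_single]
  simp [mp_apply]

theorem dd_C_zero {x : ι → W →ₗ[k] W} {w : W} (h : ∀ i, x i w = 0) : dd x (C w) = 0 := by
  rw [dT_apply]
  apply Finset.sum_eq_zero
  intro i _
  rw [mp_C, h]
  have : (C 0 : Fn ι W) = 0 := by ext m; simp [C]
  rw [this, map_zero]

end double
end ExtSym

namespace ExtSym

section hom
variable {k ι M N P K : Type} [Field k] [DecidableEq ι] [Fintype ι]
  [AddCommGroup M] [Module k M] [AddCommGroup N] [Module k N]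
  [AddCommGroup P] [Module k P] [AddCommGroup K] [Module k K]

/-- `f ↦ x f - e f x` -/
def hop (e : k) (xM : ι → M →ₗ[k] M) (xN : ι → N →ₗ[k] N) (i : ι) :
    (M →ₗ[k] N) →ₗ[k] (M →ₗ[k] N) where
  toFun f := xN i ∘ₗ f - e • (f ∘ₗ xM i)
  map_add' f g := by ext; simp; abel
  map_smul' r f := by ext; simp [smul_sub, smul_comm e r]

theorem hop_apply (e : k) (xM : ι → M →ₗ[k] M) (xN : ι → N →ₗ[k] N) (i : ι) (f : M →ₗ[k] N) (m : M) :
    hop e xM xN i f m = xN i (f m) - e • f (xM i m) := rfl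

theorem hop_anti2 {xM : ι → M →ₗ[k] M} {xN : ι → N →ₗ[k] N} (hM : Anti xM) (hN : Anti xN)
    {e e' : k} (he : e + e' = 0) : Anti2 (hop e xM xN) (hop e' xM xN) := by
  obtain rfl : e' = -e := by linear_combination he
  constructor
  · intro i w; ext m; simp [hop_apply, hM.sq, hN.sq]
  · intro i w; ext m; simp [hop_apply, hM.sq, hN.sq]
  · intro i j w; ext m
    have h1 := hN.anti i j (w m)
    have h2 : w (xM i (xM j m)) = - w (xM j (xM i m)) := by
      rw [← map_neg]; congr 1; exact eq_neg_of_add_eq_zero_left (hM.anti i j m)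
    have h3 : xN i (xN j (w m)) = - xN j (xN i (w m)) := eq_neg_of_add_eq_zero_left h1
    simp [hop_apply, h2, h3, smul_sub, smul_add]; abel
  · intro i j w; ext m
    have h1 := hN.anti i j (w m)
    have h2 : w (xM i (xM j m)) = - w (xM j (xM i m)) := by
      rw [← map_neg]; congr 1; exact eq_neg_of_add_eq_zero_left (hM.anti i j m)
    have h3 : xN i (xN j (w m)) = - xN j (xN i (w m)) := eq_neg_of_add_eq_zero_left h1
    simp [hop_apply, h2, h3, smul_sub, smul_add]; abel

/-- precomposition -/
def pre (N : Type) [AddCommGroup N] [Module k N] (φ : P →ₗ[k] M) :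
    (M →ₗ[k] N) →ₗ[k] (P →ₗ[k] N) where
  toFun f := f ∘ₗ φ
  map_add' f g := by ext; simp
  map_smul' r f := by ext; simp

theorem pre_apply (φ : P →ₗ[k] M) (f : M →ₗ[k] N) (z : P) : pre N φ f z = f (φ z) := rfl

theorem mp_pre_dd {xM : ι → M →ₗ[k] M} {xN : ι → N →ₗ[k] N} {xP : ι → P →ₗ[k] P}
    {p : P →ₗ[k] M} (hp : ∀ i z, p (xP i z) = xM i (p z)) (e : k) (f : Fn ι (M →ₗ[k] N)) :
    mp (pre N p) (dd (hop e xM xN) f) = dd (hop e xP xN) (mp (pre N p) f) :=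
  mp_dT (by intro i w; ext z; simp [hop_apply, pre_apply, hp]) f

theorem mp_pre_inj {p : P →ₗ[k] M} (hs : Function.Surjective p) {f g : Fn ι (M →ₗ[k] N)}
    (h : mp (pre N p) f = mp (pre N p) g) : f = g := by
  ext m z
  obtain ⟨z, rfl⟩ := hs z
  exact LinearMap.congr_fun (congrFun h m) z

theorem descend {j : K →ₗ[k] P} {p : P →ₗ[k] M} (hs : Function.Surjective p)
    (hex : ∀ z, p z = 0 → ∃ y, j y = z) :
    ∃ t : M →ₗ[k] P, ∀ g : Fn ι (P →ₗ[k] N), mp (pre N j) g = 0 →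
      mp (pre N p) (mp (pre N t) g) = g := by
  obtain ⟨t, ht⟩ := p.exists_rightInverse_of_surjective (LinearMap.range_eq_top.2 hs)
  have ht' : ∀ z, p (t z) = z := fun z => LinearMap.congr_fun ht z
  refine ⟨t, fun g hg => ?_⟩
  ext m z
  obtain ⟨y, hy⟩ := hex (t (p z) - z) (by simp [ht'])
  have := LinearMap.congr_fun (congrFun hg m) y
  simp only [mp_apply, pre_apply, hy, map_sub] at this
  exact sub_eq_zero.1 this

theorem extend {j : K →ₗ[k] P} (hj : Function.Injective j) :
    ∃ r : P →ₗ[k] K, (∀ z, r (j z) = z) ∧ ∀ g : Fn ι (K →ₗ[k] N),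
      mp (pre N j) (mp (pre N r) g) = g := by
  obtain ⟨r, hr⟩ := j.exists_leftInverse_of_injective (LinearMap.ker_eq_bot.2 hj)
  have hr' : ∀ z, r (j z) = z := fun z => LinearMap.congr_fun hr z
  refine ⟨r, hr', fun g => ?_⟩
  ext m z
  simp [mp_apply, pre_apply, hr']

variable {xM : ι → M →ₗ[k] M} {xN : ι → N →ₗ[k] N} {xP : ι → P →ₗ[k] P} {xK : ι → K →ₗ[k] K}
  {j : K →ₗ[k] P} {p : P →ₗ[k] M}

theorem pre_pre_zero (hz : ∀ z, p (j z) = 0) (f : Fn ι (M →ₗ[k] N)) :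
    mp (pre N j) (mp (pre N p) f) = 0 := by
  ext m z; simp [mp_apply, pre_apply, hz]

theorem shift (aN : Anti xN) (aP : Anti xP) (hinj : Function.Injective j) (hs : Function.Surjective p)
    (hz : ∀ z, p (j z) = 0) (hex : ∀ z, p z = 0 → ∃ y, j y = z)
    (hj : ∀ i z, j (xK i z) = xP i (j z)) (hp : ∀ i z, p (xP i z) = xM i (p z))
    {e e' : k} (he : e + e' = 0)
    (hP : ∀ n, Ex (hop e xP xN) (hop e' xP xN) n) (hP' : ∀ n, Ex (hop e' xP xN) (hop e xP xN) n)
    (n : ℕ) :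
    Ex (hop e xM xN) (hop e' xM xN) (n + 1) ↔ Ex (hop e' xK xN) (hop e xK xN) n := by
  obtain ⟨t, ht⟩ := descend (ι := ι) (N := N) (j := j) hs hex
  obtain ⟨r, -, hr⟩ := extend (ι := ι) (N := N) hinj
  constructor
  · intro H f hf hd
    have h1 := ht (dd (hop e' xP xN) (mp (pre N r) f)) (by rw [mp_pre_dd hj, hr, hd])
    obtain ⟨u, hu, hu'⟩ := H (mp (pre N t) (dd (hop e' xP xN) (mp (pre N r) f)))
      (mp_F (dT_F (mp_F hf))) (by
        apply mp_pre_inj hs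
        rw [mp_pre_dd hp, h1, map_zero, (hop_anti2 aP aN he).dd_zero])
    have h2 := congrArg (mp (pre N p)) hu'
    rw [h1, mp_pre_dd hp] at h2
    obtain ⟨v, hv, hv'⟩ := hP' n (mp (pre N r) f - mp (pre N p) u)
      (sub_mem (mp_F hf) (mp_F hu)) (by rw [map_sub, h2, sub_self])
    refine ⟨mp (pre N j) v, mp_F hv, ?_⟩
    rw [← mp_pre_dd hj, hv', map_sub, hr, pre_pre_zero hz, sub_zero]
  · intro H f hf hd
    obtain ⟨g, hg, hg'⟩ := hP _ (mp (pre N p) f) (mp_F hf) (by rw [← mp_pre_dd hp, hd, map_zero])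
    obtain ⟨h, hh, hh'⟩ := H (mp (pre N j) g) (mp_F hg) (by
      rw [← mp_pre_dd hj, hg', pre_pre_zero hz])
    have h1 := ht (g - dd (hop e xP xN) (mp (pre N r) h)) (by
      rw [map_sub, mp_pre_dd hj, hr, hh', sub_self])
    refine ⟨mp (pre N t) (g - dd (hop e xP xN) (mp (pre N r) h)),
      mp_F (sub_mem hg (dT_F (mp_F hh))), ?_⟩
    apply mp_pre_inj hs
    rw [mp_pre_dd hp, h1, map_sub, hg', (hop_anti2 aP aN (e := e') (e' := e) (by rw [add_comm, he])).dd_zero, sub_zero]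

theorem base (aN : Anti xN) (aP : Anti xP) (hinj : Function.Injective j) (hs : Function.Surjective p)
    (hz : ∀ z, p (j z) = 0) (hex : ∀ z, p z = 0 → ∃ y, j y = z)
    (hj : ∀ i z, j (xK i z) = xP i (j z)) (hp : ∀ i z, p (xP i z) = xM i (p z))
    (hP : ∀ n, Ex (hop (-1) xP xN) (hop 1 xP xN) n) :
    Ex (hop (-1) xM xN) (hop 1 xM xN) 0 ↔
      ∀ φ : K →ₗ[k] N, (∀ i z, φ (xK i z) = xN i (φ z)) →
        ∃ ψ : P →ₗ[k] N, (∀ i z, ψ (xP i z) = xN i (ψ z)) ∧ ∀ z, ψ (j z) = φ z := by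
  obtain ⟨t, ht⟩ := descend (ι := ι) (N := N) (j := j) hs hex
  obtain ⟨r, hr0, hr⟩ := extend (ι := ι) (N := N) hinj
  constructor
  · intro H φ hφ
    have hd : dd (hop 1 xK xN) (C φ) = 0 := dd_C_zero (by
      intro i; ext z; simp [hop_apply, hφ])
    have h1 := ht (dd (hop 1 xP xN) (mp (pre N r) (C φ))) (by rw [mp_pre_dd hj, hr, hd])
    obtain ⟨u, hu, hu'⟩ := H (mp (pre N t) (dd (hop 1 xP xN) (mp (pre N r) (C φ))))
      (mp_F (dT_F (mp_F (C_F _)))) (by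
        apply mp_pre_inj hs
        rw [mp_pre_dd hp, h1, map_zero, (hop_anti2 aP aN (by ring)).dd_zero])
    have h2 := congrArg (mp (pre N p)) hu'
    rw [h1, mp_pre_dd hp] at h2
    refine ⟨φ ∘ₗ r - u 0 ∘ₗ p, fun i z => ?_, fun z => ?_⟩
    · have h3 : dd (hop 1 xP xN) (mp (pre N r) (C φ) - mp (pre N p) u) = 0 := by
        rw [map_sub, h2, sub_self]
      have h4 := congrFun h3 (Finsupp.single i 1)
      rw [dd_single] at h4
      have h5 := LinearMap.congr_fun h4 z
      simp only [hop_apply, Pi.sub_apply, mp_apply, C_zero, Pi.zero_apply, LinearMap.zero_apply,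
        one_smul, sub_eq_zero] at h5
      exact h5.symm
    · simp [hr0, hz]
  · intro H f hf hd
    obtain ⟨g, hg, hg'⟩ := hP _ (mp (pre N p) f) (mp_F hf) (by rw [← mp_pre_dd hp, hd, map_zero])
    have h0 : dd (hop 1 xK xN) (mp (pre N j) g) = 0 := by
      rw [← mp_pre_dd hj, hg', pre_pre_zero hz]
    obtain ⟨ψ, hψ, hψ'⟩ := H (g 0 ∘ₗ j) (fun i z => by
      have h4 := congrFun h0 (Finsupp.single i 1)
      rw [dd_single] at h4
      have h5 := LinearMap.congr_fun h4 z
      simp only [hop_apply, mp_apply, Pi.zero_apply, LinearMap.zero_apply,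
        one_smul, sub_eq_zero] at h5
      exact h5.symm)
    have h1 := ht (g - C ψ) (by
      rw [eq_C hg, map_sub, mp_C, mp_C, sub_eq_zero]
      congr 1
      ext z; simp [pre_apply, hψ'])
    refine ⟨mp (pre N t) (g - C ψ), mp_F (sub_mem hg (C_F _)), ?_⟩
    apply mp_pre_inj hs
    rw [mp_pre_dd hp, h1, map_sub, hg', dd_C_zero, sub_zero]
    intro i; ext z; simp [hop_apply, hψ]

theorem hop_contr {i : ι} {s : P →ₗ[k] P} (h : IsContr xP i s) :
    IsContr2 (hop 1 xP xN) (hop (-1) xP xN) i (- pre N s) (pre N s) := by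
  constructor
  · intro l w; ext z
    have := congrArg w (h l z)
    simp only [map_add] at this
    simp [hop_apply, pre_apply]
    have h2 : w (if i = l then z else 0) = (if i = l then w else 0) z := by split_ifs <;> simp
    rw [← h2, ← this]; abel
  · intro l w; ext z
    have := congrArg w (h l z)
    simp only [map_add] at this
    simp [hop_apply, pre_apply]
    have h2 : w (if i = l then z else 0) = (if i = l then w else 0) z := by split_ifs <;> simp
    rw [← h2, ← this]; abel

theorem Ex_hop_of_contr (aN : Anti xN) (aP : Anti xP) (h : ∀ i, ∃ s, IsContr xP i s) (n : ℕ) :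
    Ex (hop 1 xP xN) (hop (-1) xP xN) n ∧ Ex (hop (-1) xP xN) (hop 1 xP xN) n := by
  have := Ex_of_contr (hop_anti2 aP aN (e := 1) (e' := -1) (by ring)).anti (fun i => by
    obtain ⟨s, hs⟩ := h i
    exact (hop_contr hs).dbl) n
  exact ⟨Ex_of_dbl_left this, Ex_of_dbl_right this⟩

theorem exists_killed (aM : Anti xM) [Nontrivial M] (T : Finset ι) :
    ∃ v : M, v ≠ 0 ∧ ∀ i ∈ T, xM i v = 0 := by
  induction T using Finset.induction_on with
  | empty => obtain ⟨v, hv⟩ := exists_ne (0 : M); exact ⟨v, hv, by simp⟩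
  | insert c T hc ih =>
    obtain ⟨v, hv, h⟩ := ih
    by_cases h0 : xM c v = 0
    · refine ⟨v, hv, ?_⟩
      intro i hi
      rcases Finset.mem_insert.1 hi with rfl | hi
      · exact h0
      · exact h i hi
    · refine ⟨xM c v, h0, ?_⟩
      intro i hi
      rcases Finset.mem_insert.1 hi with rfl | hi
      · exact aM.sq _ _
      · have := aM.anti i c v
        rwa [h i hi, map_zero, add_zero] at this

end hom

section inj
variable {k ι N : Type} [Field k] [DecidableEq ι] [Fintype ι] [AddCommGroup N] [Module k N]

theorem Ex_hom_of_Ex {xN : ι → N →ₗ[k] N} (aN : Anti xN) (hN : ∀ n, Ex xN xN n) (d : ℕ) :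
    ∀ (X : Type) [AddCommGroup X] [Module k X] [Module.Finite k X] (xX : ι → X →ₗ[k] X),
      Anti xX → Module.finrank k X = d → ∀ (e e' : k), e + e' = 0 → ∀ n,
      Ex (hop e xX xN) (hop e' xX xN) n := by
  induction d with
  | zero =>
    intro X _ _ _ xX _ hd e e' _ n f hf _
    have : Subsingleton X := Module.finrank_zero_iff.1 hd
    refine ⟨0, zero_mem _, ?_⟩
    ext m z
    obtain rfl : z = 0 := Subsingleton.elim _ _
    simp
  | succ d ih =>
    intro X _ _ _ xX aX hd e e' he n f hf hdf
    have : Nontrivial X := Module.nontrivial_of_finrank_pos (R := k) (by omega)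
    obtain ⟨v, hv, hv'⟩ := exists_killed aX Finset.univ
    have hv' : ∀ i, xX i v = 0 := fun i => hv' i (Finset.mem_univ _)
    let U : Submodule k X := Submodule.span k {v}
    have hU : ∀ i, U ≤ U.comap (xX i) := by
      intro i
      rw [Submodule.span_le, Set.singleton_subset_iff]
      simp [hv']
    let xQ : ι → (X ⧸ U) →ₗ[k] (X ⧸ U) := fun i => U.mapQ U (xX i) (hU i)
    have hp : ∀ i z, U.mkQ (xX i z) = xQ i (U.mkQ z) := fun i z => rfl
    have hs : Function.Surjective U.mkQ := U.mkQ_surjective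
    have aQ : Anti xQ := by
      constructor
      · intro i w; obtain ⟨w, rfl⟩ := hs w; rw [← hp, ← hp, aX.sq, map_zero]
      · intro i l w; obtain ⟨w, rfl⟩ := hs w
        rw [← hp, ← hp, ← hp, ← hp, ← map_add, aX.anti, map_zero]
    have hfin : Module.finrank k (X ⧸ U) = d := by
      have h1 := Submodule.finrank_quotient_add_finrank U
      rw [finrank_span_singleton hv] at h1
      omega
    have H := ih (X ⧸ U) xQ aQ hfin e e' he n
    -- evaluation at `v`
    let ev : (X →ₗ[k] N) →ₗ[k] N := LinearMap.applyₗ v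
    have hev : ∀ (e : k) (g : Fn ι (X →ₗ[k] N)), mp ev (dd (hop e xX xN) g) = dd xN (mp ev g) :=
      fun e g => mp_dT (by intro i w; simp [ev, hop_apply, hv']) g
    obtain ⟨g, hg, hg'⟩ := hN n (mp ev f) (mp_F hf) (by rw [← hev e, hdf, map_zero])
    obtain ⟨l, hl⟩ : ∃ l : X →ₗ[k] k, l v = 1 := by
      obtain ⟨l, hl⟩ := Module.Projective.exists_dual_ne_zero k hv
      exact ⟨(l v)⁻¹ • l, by simp [hl]⟩
    let ex : N →ₗ[k] (X →ₗ[k] N) := LinearMap.smulRightₗ l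
    have hex : ∀ g : Fn ι N, mp ev (mp ex g) = g := by
      intro g; ext m; simp [mp_apply, ev, ex, hl]
    have hvan : mp ev (f - dd (hop e' xX xN) (mp ex g)) = 0 := by
      rw [map_sub, hev, hex, hg', sub_self]
    obtain ⟨t, ht⟩ := descend (ι := ι) (N := N) (j := U.subtype) hs (by
      intro z hz
      exact ⟨⟨z, by simpa using hz⟩, rfl⟩)
    have h1 := ht (f - dd (hop e' xX xN) (mp ex g)) (by
      ext m ⟨z, hz⟩
      obtain ⟨r, rfl⟩ := Submodule.mem_span_singleton.1 hz
      have := congrFun hvan m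
      simp only [mp_apply, ev, LinearMap.applyₗ_apply_apply, Pi.zero_apply] at this
      simp only [mp_apply, pre_apply, Submodule.subtype_apply, map_smul]
      rw [this]; simp)
    obtain ⟨g₂, hg₂, hg₂'⟩ := H (mp (pre N t) (f - dd (hop e' xX xN) (mp ex g)))
      (mp_F (sub_mem hf (dT_F (mp_F hg)))) (by
        apply mp_pre_inj hs
        rw [mp_pre_dd hp, h1, map_zero, map_sub, hdf, (hop_anti2 aX aN he).dd_zero, sub_zero])
    refine ⟨mp (pre N U.mkQ) g₂ + mp ex g, add_mem (mp_F hg₂) (mp_F hg), ?_⟩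
    rw [map_add, ← mp_pre_dd hp, hg₂', h1, sub_add_cancel]

theorem contr_of_Ex [Module.Finite k N] {xN : ι → N →ₗ[k] N} (aN : Anti xN)
    (hN : ∀ n, Ex xN xN n) (i : ι) : ∃ s, IsContr xN i s := by
  have H := Ex_hom_of_Ex aN hN _ N xN aN rfl 1 (-1) (by ring) 0
  obtain ⟨g, -, hg⟩ := H (Y i (C LinearMap.id)) (Y_F (C_F _)) (by
    rw [dT_Y, dd_C_zero, map_zero]
    intro l; ext z; simp [hop_apply])
  refine ⟨g 0, fun l w => ?_⟩
  have h1 := congrFun hg (Finsupp.single l 1)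
  rw [dd_single, Y_single, C_zero] at h1
  have h2 := LinearMap.congr_fun h1 w
  simp only [hop_apply, neg_smul, one_smul, sub_neg_eq_add] at h2
  rw [add_comm, h2]
  split_ifs <;> rfl

end inj

section dual
variable {k ι M N : Type} [Field k] [DecidableEq ι] [Fintype ι]
  [AddCommGroup M] [Module k M] [Module.Finite k M] [AddCommGroup N] [Module k N] [Module.Finite k N]

/-- trace pairing -/
def tp (k M N : Type) [Field k] [AddCommGroup M] [Module k M] [AddCommGroup N] [Module k N] :
    (N →ₗ[k] M) →ₗ[k] Module.Dual k (M →ₗ[k] N) :=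
  LinearMap.mk₂ k (fun g f => LinearMap.trace k M (g ∘ₗ f))
    (by intros; simp [LinearMap.add_comp]) (by intros; simp [LinearMap.smul_comp])
    (by intros; simp [LinearMap.comp_add]) (by intros; simp [LinearMap.comp_smul])

theorem tp_apply (g : N →ₗ[k] M) (f : M →ₗ[k] N) :
    tp k M N g f = LinearMap.trace k M (g ∘ₗ f) := rfl

theorem tp_inj : Function.Injective (tp k M N) := by
  rw [injective_iff_map_eq_zero]
  intro g hg
  ext n
  by_contra hne
  obtain ⟨l, hl⟩ := Module.Projective.exists_dual_ne_zero k hne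
  have := LinearMap.congr_fun hg (l.smulRight n)
  rw [tp_apply] at this
  have h2 : g ∘ₗ l.smulRight n = l.smulRight (g n) := by ext z; simp
  rw [h2, LinearMap.trace_smulRight] at this
  exact hl this

theorem tp_bij : Function.Bijective (tp k M N) := by
  have h : Module.finrank k (N →ₗ[k] M) = Module.finrank k (Module.Dual k (M →ₗ[k] N)) := by
    rw [Subspace.dual_finrank_eq, Module.finrank_linearMap, Module.finrank_linearMap, mul_comm]
  exact ⟨tp_inj, (LinearMap.injective_iff_surjective_of_finrank_eq_finrank h).1 tp_inj⟩

theorem exists_adj (s : (M →ₗ[k] N) →ₗ[k] (M →ₗ[k] N)) :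
    ∃ s' : (N →ₗ[k] M) →ₗ[k] (N →ₗ[k] M), ∀ g f, tp k M N (s' g) f = tp k M N g (s f) := by
  let E := LinearEquiv.ofBijective (tp k M N) tp_bij
  refine ⟨E.symm.toLinearMap ∘ₗ s.dualMap ∘ₗ E.toLinearMap, fun g f => ?_⟩
  have : tp k M N (E.symm (s.dualMap (E g))) = s.dualMap (E g) := E.apply_symm_apply _
  simp only [LinearMap.comp_apply, LinearEquiv.coe_coe, this]
  rfl

theorem tp_hop {e : k} (he : e * e = 1) (xM : ι → M →ₗ[k] M) (xN : ι → N →ₗ[k] N) (i : ι)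
    (g : N →ₗ[k] M) (f : M →ₗ[k] N) :
    tp k M N g (hop e xM xN i f) = - e * tp k M N (hop e xN xM i g) f := by
  have h1 : tp k M N g (hop e xM xN i f) =
      LinearMap.trace k M (g ∘ₗ xN i ∘ₗ f) - e * LinearMap.trace k M (g ∘ₗ f ∘ₗ xM i) := by
    simp [tp_apply, hop, LinearMap.comp_sub, LinearMap.comp_smul]
  have h2 : tp k M N (hop e xN xM i g) f =
      LinearMap.trace k M (xM i ∘ₗ g ∘ₗ f) - e * LinearMap.trace k M (g ∘ₗ xN i ∘ₗ f) := by
    simp [tp_apply, hop, LinearMap.sub_comp, LinearMap.smul_comp, LinearMap.comp_assoc]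
  have h3 : LinearMap.trace k M (g ∘ₗ f ∘ₗ xM i) = LinearMap.trace k M (xM i ∘ₗ g ∘ₗ f) := by
    rw [← LinearMap.comp_assoc, LinearMap.trace_comp_comm']
  rw [h1, h2, h3]
  linear_combination (- LinearMap.trace k M (g ∘ₗ xN i ∘ₗ f)) * he

theorem contr2_dual {xM : ι → M →ₗ[k] M} {xN : ι → N →ₗ[k] N} {i : ι}
    {p q : (M →ₗ[k] N) →ₗ[k] (M →ₗ[k] N)}
    (h : IsContr2 (hop 1 xM xN) (hop (-1) xM xN) i p q) :
    ∃ p' q', IsContr2 (hop 1 xN xM) (hop (-1) xN xM) i p' q' := by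
  obtain ⟨p', hp'⟩ := exists_adj p
  obtain ⟨q', hq'⟩ := exists_adj q
  have ha := tp_hop (e := (1 : k)) (by ring) xM xN
  have hb := tp_hop (e := (-1 : k)) (by ring) xM xN
  simp only [neg_mul, one_mul, neg_neg] at ha hb
  have ite_tp : ∀ (l : ι) (g : N →ₗ[k] M) (f : M →ₗ[k] N),
      tp k M N (if i = l then g else 0) f = tp k M N g (if i = l then f else 0) := by
    intro l g f; split_ifs <;> simp
  refine ⟨-p', q', fun l g => ?_, fun l g => ?_⟩
  · apply tp_inj; ext f
    have h2 := h.2 l f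
    rw [ite_tp, ← h2]
    simp only [map_add, LinearMap.add_apply, map_neg, LinearMap.neg_apply, hp', ha, hq', ← hb]
    ring
  · apply tp_inj; ext f
    have h2 := h.1 l f
    rw [ite_tp, ← h2]
    simp only [map_add, LinearMap.add_apply, map_neg, LinearMap.neg_apply]
    rw [hq', hb, ← ha, hp']
    ring

/-- The key symmetry on the level of Koszul complexes. -/
theorem symmetry {xM : ι → M →ₗ[k] M} {xN : ι → N →ₗ[k] N} (aM : Anti xM) (aN : Anti xN)
    (n₀ : ℕ) (h : ∀ n ≥ n₀, if Even (n + 1) then Ex (hop 1 xM xN) (hop (-1) xM xN) n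
      else Ex (hop (-1) xM xN) (hop 1 xM xN) n) (n : ℕ) :
    (Ex (hop 1 xM xN) (hop (-1) xM xN) n ∧ Ex (hop (-1) xM xN) (hop 1 xM xN) n) ∧
    (Ex (hop 1 xN xM) (hop (-1) xN xM) n ∧ Ex (hop (-1) xN xM) (hop 1 xN xM) n) := by
  have A1 := hop_anti2 aM aN (e := 1) (e' := -1) (by ring)
  have A2 := hop_anti2 aN aM (e := 1) (e' := -1) (by ring)
  have H := Ex_dbl_of_alt A1 n₀ h
  refine ⟨⟨Ex_of_dbl_left (H n), Ex_of_dbl_right (H n)⟩, ?_⟩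
  have H2 := Ex_of_contr A2.anti (fun i => by
    obtain ⟨s, hs⟩ := contr_of_Ex A1.anti H i
    obtain ⟨p, q, hpq⟩ := hs.split
    obtain ⟨p', q', hpq'⟩ := contr2_dual hpq
    exact hpq'.dbl) n
  exact ⟨Ex_of_dbl_left H2, Ex_of_dbl_right H2⟩

end dual
end ExtSym

namespace ExtSym

section alg
variable (k : Type) [Field k] (c : ℕ)

/-- The generators of the exterior algebra. -/
def gx (i : Fin c) : ExtAlg k c := RingQuot.mkAlgHom k _ (FreeAlgebra.ι k i)

theorem gx_sq (i : Fin c) : gx k c i * gx k c i = 0 := by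
  have h := RingQuot.mkAlgHom_rel k (s := qciRel k c (extQ k c) (fun _ => 2))
    (x := FreeAlgebra.ι k i ^ 2) (y := 0) (Or.inl ⟨i, rfl, rfl⟩)
  rw [pow_two, map_mul, map_zero] at h
  exact h

theorem gx_anti (i j : Fin c) : gx k c i * gx k c j + gx k c j * gx k c i = 0 := by
  by_cases hij : i = j
  · subst hij; rw [gx_sq, add_zero]
  have h := RingQuot.mkAlgHom_rel k (s := qciRel k c (extQ k c) (fun _ => 2))
    (x := FreeAlgebra.ι k i * FreeAlgebra.ι k j)
    (y := extQ k c i j • (FreeAlgebra.ι k j * FreeAlgebra.ι k i)) (Or.inr ⟨i, j, rfl, rfl⟩)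
  rw [map_smul, map_mul, map_mul] at h
  simp only [extQ, if_neg hij, neg_smul, one_smul] at h
  change gx k c i * gx k c j = -(gx k c j * gx k c i) at h
  rw [h]; abel

theorem gx_induction {p : ExtAlg k c → Prop} (h0 : ∀ r : k, p (algebraMap k _ r))
    (hx : ∀ i, p (gx k c i)) (hm : ∀ a b, p a → p b → p (a * b)) (ha : ∀ a b, p a → p b → p (a + b))
    (a : ExtAlg k c) : p a := by
  obtain ⟨b, rfl⟩ := RingQuot.mkAlgHom_surjective k (qciRel k c (extQ k c) (fun _ => 2)) a
  induction b using FreeAlgebra.induction with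
  | grade0 r => rw [AlgHom.commutes]; exact h0 r
  | grade1 i => exact hx i
  | mul a b h1 h2 => rw [map_mul]; exact hm _ _ h1 h2
  | add a b h1 h2 => rw [map_add]; exact ha _ _ h1 h2

/-- universal property -/
def glift {B : Type} [Ring B] [Algebra k B] (y : Fin c → B) (hs : ∀ i, y i * y i = 0)
    (ha : ∀ i j, y i * y j + y j * y i = 0) : ExtAlg k c →ₐ[k] B :=
  RingQuot.liftAlgHom k ⟨FreeAlgebra.lift k y, by
    rintro _ _ (⟨i, rfl, rfl⟩ | ⟨i, j, rfl, rfl⟩)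
    · simp [pow_two, hs]
    · by_cases hij : i = j
      · subst hij; simp [extQ, hs]
      · simp [extQ, hij, eq_neg_of_add_eq_zero_left (ha i j)]⟩

theorem glift_gx {B : Type} [Ring B] [Algebra k B] (y : Fin c → B) (hs : ∀ i, y i * y i = 0)
    (ha : ∀ i j, y i * y j + y j * y i = 0) (i : Fin c) : glift k c y hs ha (gx k c i) = y i := by
  simp [glift, gx]

/-- matrices giving the contraction -/
def cmB {B : Type} [Ring B] (x : B) (d : B) : Matrix (Fin 2) (Fin 2) B :=
  !![-x, d; 0, x]

theorem cmB_anti {B : Type} [Ring B] (x y d e : B) (h : x * y + y * x = 0)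
    (hd : d * y = y * d) (he : e * x = x * e) : cmB x d * cmB y e + cmB y e * cmB x d = 0 := by
  ext a b
  fin_cases a <;> fin_cases b <;> simp [cmB, Matrix.mul_apply, Fin.sum_univ_two, h, hd, he]

theorem cmB_sq {B : Type} [Ring B] (x d : B) (h : x * x = 0)
    (hd : d * x = x * d) : cmB x d * cmB x d = 0 := by
  ext a b
  fin_cases a <;> fin_cases b <;> simp [cmB, Matrix.mul_apply, Fin.sum_univ_two, h, hd]

theorem cmB_fin {B : Type} [Ring B] (x d : B) (m : Matrix (Fin 2) (Fin 2) B) :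
    (cmB x d * m) 0 1 + x * m 0 1 = d * m 1 1 := by
  simp [cmB, Matrix.mul_apply, Fin.sum_univ_two]

/-- matrices giving the contraction -/
def cm (i j : Fin c) : Matrix (Fin 2) (Fin 2) (ExtAlg k c) :=
  cmB (gx k c j) (if i = j then 1 else 0)

theorem cm_anti (i j l : Fin c) : cm k c i j * cm k c i l + cm k c i l * cm k c i j = 0 := by
  apply cmB_anti _ _ _ _ (gx_anti k c j l)
  · split_ifs <;> simp
  · split_ifs <;> simp

theorem cm_sq (i j : Fin c) : cm k c i j * cm k c i j = 0 := by
  apply cmB_sq _ _ (gx_sq k c j)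
  split_ifs <;> simp

def cmh (i : Fin c) : ExtAlg k c →ₐ[k] Matrix (Fin 2) (Fin 2) (ExtAlg k c) :=
  glift k c (cm k c i) (cm_sq k c i) (cm_anti k c i)

theorem cmh_low (i : Fin c) (a : ExtAlg k c) : cmh k c i a 1 0 = 0 ∧ cmh k c i a 1 1 = a := by
  induction a using gx_induction with
  | h0 r => simp [Matrix.algebraMap_matrix_apply]
  | hx i => simp [cmh, glift_gx, cm, cmB]
  | hm a b h1 h2 => simp [Matrix.mul_apply, Fin.sum_univ_two, h1, h2]
  | ha a b h1 h2 => simp [h1, h2]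

/-- contraction on the algebra -/
def ctr (i : Fin c) : ExtAlg k c →ₗ[k] ExtAlg k c where
  toFun a := cmh k c i a 0 1
  map_add' a b := by simp
  map_smul' r a := by simp

theorem ctr_mul (i j : Fin c) (a : ExtAlg k c) :
    ctr k c i (gx k c j * a) + gx k c j * ctr k c i a = if i = j then a else 0 := by
  have h := cmh_low k c i a
  have h1 : cmh k c i (gx k c j) = cm k c i j := by simp [cmh, glift_gx]
  have h2 := cmB_fin (gx k c j) (if i = j then 1 else 0) (cmh k c i a)
  change (cm k c i j * cmh k c i a) 0 1 + _ = _ at h2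
  rw [← h1, ← map_mul, h.2] at h2
  change cmh k c i _ 0 1 + _ * cmh k c i _ 0 1 = _
  rw [h2]; split_ifs <;> simp


/-- The linear map on the generating space. -/
def gl : (Fin c → k) →ₗ[k] ExtAlg k c := Fintype.linearCombination k (gx k c)

theorem gl_sq (v : Fin c → k) : gl k c v * gl k c v = 0 := by
  simp only [gl, Fintype.linearCombination_apply]
  rw [Finset.sum_mul_sum, ← Finset.sum_product']
  refine Finset.sum_involution (fun p _ => (p.2, p.1)) ?_ ?_ ?_ ?_
  · rintro ⟨i, j⟩ _
    have h := gx_anti k c i j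
    simp only [Algebra.smul_mul_assoc, Algebra.mul_smul_comm]
    rw [smul_comm (v j) (v i), ← smul_add, ← smul_add, h, smul_zero, smul_zero]
  · rintro ⟨i, j⟩ _ h1 h2
    simp only [Prod.mk.injEq] at h2
    obtain ⟨rfl, -⟩ := h2
    apply h1
    simp only [Algebra.smul_mul_assoc, Algebra.mul_smul_comm, gx_sq, smul_zero]
  · simp
  · simp

theorem gfin : Module.Finite k (ExtAlg k c) := by
  let φ := ExteriorAlgebra.lift k ⟨gl k c, gl_sq k c⟩
  have hx : ∀ i, gx k c i ∈ φ.range := fun i => ⟨ExteriorAlgebra.ι k (Pi.single i 1), by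
    simp [φ, gl, Fintype.linearCombination_apply_single]⟩
  have hs : Function.Surjective φ := by
    intro a
    change a ∈ φ.range
    induction a using gx_induction with
    | h0 r => exact Subalgebra.algebraMap_mem _ r
    | hx i => exact hx i
    | hm a b h1 h2 => exact mul_mem h1 h2
    | ha a b h1 h2 => exact add_mem h1 h2
  have : Module.Finite k (ExteriorAlgebra k (Fin c → k)) :=
    Module.Finite.of_basis (Pi.basisFun k (Fin c)).ExteriorAlgebra
  exact Module.Finite.of_surjective φ.toLinearMap hs

end alg
end ExtSym

namespace ExtSym

section cat
variable {A : Type} [Ring A]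

theorem extVanish_iff (M N : Type) [AddCommGroup M] [Module A M]
    [AddCommGroup N] [Module A N] (P : ProjectiveResolution (ModuleCat.of A M)) (n : ℕ) :
    extVanish A M N (n + 1) ↔ ∀ φ : P.complex.X (n + 1) →ₗ[A] N,
      φ ∘ₗ (P.complex.d (n + 2) (n + 1)).hom = 0 →
      ∃ ψ : P.complex.X n →ₗ[A] N, ψ ∘ₗ (P.complex.d (n + 1) n).hom = φ := by
  unfold extVanish
  rw [← ModuleCat.isZero_iff_subsingleton,
    (P.isoExt (R := ℤ) (n + 1) (ModuleCat.of A N)).isZero_iff]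
  rw [← HomologicalComplex.exactAt_iff_isZero_homology,
    HomologicalComplex.exactAt_iff' _ n (n + 1) (n + 2) (by simp) (by simp),
    ShortComplex.moduleCat_exact_iff]
  constructor
  · intro h φ hφ
    obtain ⟨ψ, hψ⟩ := h (ModuleCat.ofHom φ) (by
      change P.complex.d (n + 2) (n + 1) ≫ ModuleCat.ofHom φ = 0
      ext1; exact hφ)
    change P.complex.d (n + 1) n ≫ ψ = ModuleCat.ofHom φ at hψ
    exact ⟨ModuleCat.Hom.hom ψ, congrArg ModuleCat.Hom.hom hψ⟩
  · intro h φ hφ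
    change P.complex.d (n + 2) (n + 1) ≫ φ = 0 at hφ
    obtain ⟨ψ, hψ⟩ := h (ModuleCat.Hom.hom φ) (congrArg ModuleCat.Hom.hom hφ)
    refine ⟨ModuleCat.ofHom ψ, ?_⟩
    change P.complex.d (n + 1) n ≫ ModuleCat.ofHom ψ = φ
    ext1; exact hψ

end cat

section mods
variable (k : Type) [Field k] (c : ℕ) 

/-- action of generators -/
def xs (M : Type) [AddCommGroup M] [Module k M] [Module (ExtAlg k c) M]
    [IsScalarTower k (ExtAlg k c) M] (i : Fin c) : M →ₗ[k] M where
  toFun m := gx k c i • m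
  map_add' := smul_add _
  map_smul' r m := by
    rw [RingHom.id_apply, ← algebraMap_smul (ExtAlg k c) r m, ← algebraMap_smul (ExtAlg k c) r,
      ← mul_smul, ← mul_smul, Algebra.commutes]

variable {k c}
variable {M N P : Type} [AddCommGroup M] [Module k M] [Module (ExtAlg k c) M]
    [IsScalarTower k (ExtAlg k c) M] [AddCommGroup N] [Module k N] [Module (ExtAlg k c) N]
    [IsScalarTower k (ExtAlg k c) N] [AddCommGroup P] [Module k P] [Module (ExtAlg k c) P]
    [IsScalarTower k (ExtAlg k c) P]

theorem xs_apply (i : Fin c) (m : M) : xs k c M i m = gx k c i • m := rfl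

theorem xs_anti : Anti (xs k c M) where
  sq i m := by simp only [xs_apply]; rw [← mul_smul, gx_sq, zero_smul]
  anti i j m := by
    have := gx_anti k c i j
    have h2 := congrArg (· • m) this
    simp only [add_smul, mul_smul, zero_smul] at h2
    simp only [xs_apply]
    exact h2

/-- k-linear maps commuting with the generators are A-linear -/
def mkA (f : M →ₗ[k] N) (h : ∀ i z, f (xs k c M i z) = xs k c N i (f z)) : M →ₗ[ExtAlg k c] N where
  toFun := f
  map_add' := f.map_add
  map_smul' a m := by
    simp only [RingHom.id_apply]
    induction a using gx_induction generalizing m with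
    | h0 r => rw [algebraMap_smul, algebraMap_smul, map_smul]
    | hx i => exact h i m
    | hm a b h1 h2 => rw [mul_smul, h1, h2, mul_smul]
    | ha a b h1 h2 => rw [add_smul, map_add, h1, h2, add_smul]

theorem contr_proj [Module.Projective (ExtAlg k c) P] (i : Fin c) :
    ∃ s, IsContr (xs k c P) i s := by
  obtain ⟨e, he⟩ := Module.projective_def'.mp (‹Module.Projective (ExtAlg k c) P›)
  let π : (P →₀ ExtAlg k c) →ₗ[ExtAlg k c] P := Finsupp.linearCombination _ id
  let δ : (P →₀ ExtAlg k c) →ₗ[k] (P →₀ ExtAlg k c) := Finsupp.mapRange.linearMap (ctr k c i)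
  have hδ : ∀ j w, δ (gx k c j • w) + gx k c j • δ w = if i = j then w else 0 := by
    intro j w
    ext p
    have := ctr_mul k c i j (w p)
    simp only [δ, Finsupp.add_apply, Finsupp.mapRange.linearMap_apply, Finsupp.mapRange_apply,
      Finsupp.smul_apply, smul_eq_mul, this]
    split_ifs <;> rfl
  refine ⟨(π.restrictScalars k) ∘ₗ δ ∘ₗ (e.restrictScalars k), fun j w => ?_⟩
  have h1 := congrArg π (hδ j (e w))
  have h2 : π (e w) = w := LinearMap.congr_fun he w
  simp only [LinearMap.comp_apply, LinearMap.restrictScalars_apply, xs_apply, map_smul, map_add] at h1 ⊢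
  rw [h1]; split_ifs
  · exact h2
  · exact map_zero _

theorem exists_factor {A P K N : Type} [Ring A] [AddCommGroup P] [Module A P] [AddCommGroup K]
    [Module A K] [AddCommGroup N] [Module A N] (q : P →ₗ[A] K) (hq : Function.Surjective q)
    (φ : P →ₗ[A] N) (h : ∀ z, q z = 0 → φ z = 0) : ∃ φ' : K →ₗ[A] N, ∀ z, φ' (q z) = φ z := by
  have hker : LinearMap.ker q ≤ LinearMap.ker φ := fun z hz => h z hz
  refine ⟨((LinearMap.ker q).liftQ φ hker) ∘ₗ (q.quotKerEquivOfSurjective hq).symm.toLinearMap, ?_⟩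
  intro z
  have : (q.quotKerEquivOfSurjective hq).symm (q z) = Submodule.Quotient.mk z := by
    rw [LinearEquiv.symm_apply_eq]; rfl
  simp only [LinearMap.comp_apply, LinearEquiv.coe_coe, this]
  rfl

section step
variable {K : Type} [AddCommGroup K] [Module k K] [Module (ExtAlg k c) K]
    [IsScalarTower k (ExtAlg k c) K] [Module.Projective (ExtAlg k c) P]
    {j : K →ₗ[ExtAlg k c] P} {p : P →ₗ[ExtAlg k c] M}

theorem baseA (hinj : Function.Injective j) (hs : Function.Surjective p)
    (hz : ∀ z, p (j z) = 0) (hex : ∀ z, p z = 0 → ∃ y, j y = z) :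
    Ex (hop (-1) (xs k c M) (xs k c N)) (hop 1 (xs k c M) (xs k c N)) 0 ↔
      ∀ φ : K →ₗ[ExtAlg k c] N, ∃ ψ : P →ₗ[ExtAlg k c] N, ∀ z, ψ (j z) = φ z := by
  have aN := xs_anti (k := k) (c := c) (M := N)
  have aP := xs_anti (k := k) (c := c) (M := P)
  have hP := Ex_hop_of_contr aN aP contr_proj
  have hb := base (K := K) (P := P) (M := M) (N := N) (j := j.restrictScalars k)
    (p := p.restrictScalars k)
    (xK := xs k c K) (xM := xs k c M) aN aP hinj hs hz hex
    (fun i z => map_smul j _ z) (fun i z => map_smul p _ z) (fun n => (hP n).2)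
  rw [hb]
  constructor
  · intro h φ
    obtain ⟨ψ, h1, h2⟩ := h (φ.restrictScalars k) (fun i z => map_smul φ _ z)
    exact ⟨mkA ψ h1, h2⟩
  · intro h φ hφ
    obtain ⟨ψ, hψ⟩ := h (mkA φ hφ)
    exact ⟨ψ.restrictScalars k, fun i z => map_smul ψ _ z, hψ⟩

theorem shiftA (hinj : Function.Injective j) (hs : Function.Surjective p)
    (hz : ∀ z, p (j z) = 0) (hex : ∀ z, p z = 0 → ∃ y, j y = z) {e e' : k} (n : ℕ)
    (he : e = (-1) ^ (n + 2)) (he' : e' = (-1) ^ (n + 1)) :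
    Ex (hop e (xs k c M) (xs k c N)) (hop e' (xs k c M) (xs k c N)) (n + 1) ↔
    Ex (hop e' (xs k c K) (xs k c N)) (hop e (xs k c K) (xs k c N)) n := by
  have aN := xs_anti (k := k) (c := c) (M := N)
  have aP := xs_anti (k := k) (c := c) (M := P)
  have hP := Ex_hop_of_contr aN aP contr_proj
  have hee : e + e' = 0 := by rw [he, he']; ring
  have hcase : (e = 1 ∧ e' = -1) ∨ (e = -1 ∧ e' = 1) := by
    rcases neg_one_pow_eq_or k (n + 1) with h | h
    · right; rw [he, he', pow_succ, h]; simp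
    · left; rw [he, he', pow_succ, h]; simp
  have hP1 : ∀ n, Ex (hop e (xs k c P) (xs k c N)) (hop e' (xs k c P) (xs k c N)) n := by
    rcases hcase with ⟨rfl, rfl⟩ | ⟨rfl, rfl⟩
    · exact fun n => (hP n).1
    · exact fun n => (hP n).2
  have hP2 : ∀ n, Ex (hop e' (xs k c P) (xs k c N)) (hop e (xs k c P) (xs k c N)) n := by
    rcases hcase with ⟨rfl, rfl⟩ | ⟨rfl, rfl⟩
    · exact fun n => (hP n).2
    · exact fun n => (hP n).1
  exact shift (K := K) (P := P) (M := M) (N := N) (j := j.restrictScalars k)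
    (p := p.restrictScalars k)
    (xK := xs k c K) (xM := xs k c M) aN aP hinj hs hz hex
    (fun i z => map_smul j _ z) (fun i z => map_smul p _ z) hee hP1 hP2 n

end step

theorem exists_q {A P Q M : Type} [Ring A] [AddCommGroup P] [Module A P] [AddCommGroup Q]
    [Module A Q] [AddCommGroup M] [Module A M] (d : Q →ₗ[A] P) (p : P →ₗ[A] M)
    (h : Function.Exact d p) : ∃ q : Q →ₗ[A] LinearMap.ker p, Function.Surjective q ∧
      (∀ z, (LinearMap.ker p).subtype (q z) = d z) ∧ (∀ z, q z = 0 ↔ d z = 0) := by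
  refine ⟨d.codRestrict _ (fun z => (h (d z)).2 ⟨z, rfl⟩), ?_, fun z => rfl, fun z => ?_⟩
  · rintro ⟨z, hz⟩
    obtain ⟨y, hy⟩ := (h z).1 hz
    exact ⟨y, Subtype.ext hy⟩
  · rw [Subtype.ext_iff]; rfl

theorem Ex_iff (n : ℕ) : ∀ (M : Type) [AddCommGroup M] [Module k M] [Module (ExtAlg k c) M]
    [IsScalarTower k (ExtAlg k c) M] (P : ℕ → Type) [∀ n, AddCommGroup (P n)] [∀ n, Module k (P n)]
    [∀ n, Module (ExtAlg k c) (P n)] [∀ n, IsScalarTower k (ExtAlg k c) (P n)]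
    [∀ n, Module.Projective (ExtAlg k c) (P n)] (d : ∀ n, P (n + 1) →ₗ[ExtAlg k c] P n)
    (p : P 0 →ₗ[ExtAlg k c] M) (_ : Function.Surjective p) (_ : Function.Exact (d 0) p)
    (_ : ∀ n, Function.Exact (d (n + 1)) (d n)) (e e' : k) (_ : e = (-1) ^ (n + 1))
    (_ : e' = (-1) ^ n),
    (Ex (hop e (xs k c M) (xs k c N)) (hop e' (xs k c M) (xs k c N)) n ↔
      ∀ φ : P (n + 1) →ₗ[ExtAlg k c] N, φ ∘ₗ d (n + 1) = 0 →
        ∃ ψ : P n →ₗ[ExtAlg k c] N, ψ ∘ₗ d n = φ) := by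
  induction n with
  | zero =>
    intro M _ _ _ _ P _ _ _ _ _ d p hs h0 hd e e' he he'
    obtain ⟨q, hq, hqd, hqk⟩ := exists_q (d 0) p h0
    have hz : ∀ z, p ((LinearMap.ker p).subtype z) = 0 := fun z => z.2
    have hex : ∀ z, p z = 0 → ∃ y, (LinearMap.ker p).subtype y = z := fun z hz => ⟨⟨z, hz⟩, rfl⟩
    simp only [zero_add, pow_one, pow_zero] at he he'
    subst he he'
    rw [baseA (K := LinearMap.ker p) (j := (LinearMap.ker p).subtype) (p := p) (LinearMap.ker p).subtype_injective hs
      hz hex]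
    constructor
    · intro h φ hφ
      obtain ⟨φ', hφ'⟩ := exists_factor (A := ExtAlg k c) (P := P 1) (K := LinearMap.ker p) q hq φ (fun z hz => by
        obtain ⟨y, rfl⟩ := (hd 0 z).1 ((hqk z).1 hz)
        exact LinearMap.congr_fun hφ y)
      obtain ⟨ψ, h2⟩ := h φ'
      refine ⟨ψ, LinearMap.ext fun z => ?_⟩
      have h3 := h2 (q z)
      rw [hqd, hφ'] at h3
      exact h3
    · intro h φ
      obtain ⟨ψ, hψ⟩ := h (φ ∘ₗ q) (LinearMap.ext fun z => by
        have : q (d 1 z) = 0 := (hqk _).2 ((hd 0 _).2 ⟨z, rfl⟩)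
        change φ (q (d 1 z)) = 0
        rw [this, map_zero])
      refine ⟨ψ, fun z => ?_⟩
      obtain ⟨y, rfl⟩ := hq z
      rw [hqd]
      exact LinearMap.congr_fun hψ y
  | succ n ih =>
    intro M _ _ _ _ P _ _ _ _ _ d p hs h0 hd e e' he he'
    obtain ⟨q, hq, hqd, hqk⟩ := exists_q (d 0) p h0
    have hz : ∀ z, p ((LinearMap.ker p).subtype z) = 0 := fun z => z.2
    have hex : ∀ z, p z = 0 → ∃ y, (LinearMap.ker p).subtype y = z := fun z hz => ⟨⟨z, hz⟩, rfl⟩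
    rw [shiftA (K := LinearMap.ker p) (j := (LinearMap.ker p).subtype) (p := p) (LinearMap.ker p).subtype_injective hs
      hz hex n he he']
    exact ih (LinearMap.ker p) (fun n => P (n + 1)) (fun n => d (n + 1)) q hq
      (fun z => (hqk z).trans (hd 0 z)) (fun n => hd (n + 1)) e' e he'
      (by rw [he]; ring)

theorem extVanish_iff_Ex (n : ℕ) :
    extVanish (ExtAlg k c) M N (n + 1) ↔
      Ex (hop ((-1) ^ (n + 1)) (xs k c M) (xs k c N)) (hop ((-1) ^ n) (xs k c M) (xs k c N)) n := by
  let R := projectiveResolution (ModuleCat.of (ExtAlg k c) M)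
  rw [extVanish_iff M N R n]
  let _ : ∀ n, Module k (R.complex.X n) := fun n => Module.compHom _ (algebraMap k (ExtAlg k c))
  have : ∀ n, IsScalarTower k (ExtAlg k c) (R.complex.X n) := fun n =>
    ⟨fun r a z => by
      rw [Algebra.smul_def, mul_smul]; rfl⟩
  have : ∀ n, Module.Projective (ExtAlg k c) (R.complex.X n) := fun n =>
    (IsProjective.iff_projective _).2 (R.projective n)
  symm
  let p : R.complex.X 0 →ₗ[ExtAlg k c] M := (R.π.f 0).hom
  refine Ex_iff (N := N) n M (fun n => R.complex.X n) (fun n => (R.complex.d (n + 1) n).hom)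
    p ?_ ?_ ?_ _ _ rfl rfl
  · exact (ModuleCat.epi_iff_surjective (R.π.f 0)).1 inferInstance
  · exact (ShortComplex.ShortExact.moduleCat_exact_iff_function_exact _).1 R.exact₀
  · intro n
    exact (ShortComplex.ShortExact.moduleCat_exact_iff_function_exact _).1 (R.exact_succ n)

end mods

section final
variable {k : Type} [Field k] {c : ℕ} {M N : Type}
    [AddCommGroup M] [Module (ExtAlg k c) M] [Module.Finite (ExtAlg k c) M]
    [AddCommGroup N] [Module (ExtAlg k c) N] [Module.Finite (ExtAlg k c) N]

theorem final (h : ∃ n₀ : ℕ, ∀ i ≥ n₀, extVanish (ExtAlg k c) M N i) :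
    (∀ i > 0, extVanish (ExtAlg k c) M N i) ∧ (∀ i > 0, extVanish (ExtAlg k c) N M i) := by
  obtain ⟨n₀, h⟩ := h
  let _ : Module k M := Module.compHom _ (algebraMap k (ExtAlg k c))
  let _ : Module k N := Module.compHom _ (algebraMap k (ExtAlg k c))
  have : IsScalarTower k (ExtAlg k c) M :=
    ⟨fun r a z => by rw [Algebra.smul_def, mul_smul]; rfl⟩
  have : IsScalarTower k (ExtAlg k c) N :=
    ⟨fun r a z => by rw [Algebra.smul_def, mul_smul]; rfl⟩
  have := gfin k c
  have : Module.Finite k M := Module.Finite.trans (ExtAlg k c) M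
  have : Module.Finite k N := Module.Finite.trans (ExtAlg k c) N
  have hS := symmetry (xs_anti (k := k) (c := c) (M := M)) (xs_anti (k := k) (c := c) (M := N)) n₀
    (fun n hn => by
      have h1 := (extVanish_iff_Ex n).1 (h (n + 1) (by omega))
      split_ifs with he
      · rw [he.neg_one_pow, Odd.neg_one_pow (by grind)] at h1
        exact h1
      · rw [Odd.neg_one_pow (n := n + 1) (by grind), Even.neg_one_pow (n := n) (by grind)] at h1
        exact h1)
  constructor
  · rintro (_ | n) hi
    · omega
    rw [extVanish_iff_Ex n]
    rcases Nat.even_or_odd n with hn | hn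
    · rw [hn.neg_one_pow, Odd.neg_one_pow (n := n + 1) (by grind)]
      exact (hS n).1.2
    · rw [hn.neg_one_pow, Even.neg_one_pow (n := n + 1) (by grind)]
      exact (hS n).1.1
  · rintro (_ | n) hi
    · omega
    rw [extVanish_iff_Ex n]
    rcases Nat.even_or_odd n with hn | hn
    · rw [hn.neg_one_pow, Odd.neg_one_pow (n := n + 1) (by grind)]
      exact (hS n).2.2
    · rw [hn.neg_one_pow, Even.neg_one_pow (n := n + 1) (by grind)]
      exact (hS n).2.1

end final

end ExtSym

theorem ext_symmetry_exterior_algebra_odd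
    (k : Type) [Field k] (c : ℕ) (hc : 1 ≤ c) (hodd : Odd c)
    (M N : Type)
    [AddCommGroup M] [Module (ExtAlg k c) M] [Module.Finite (ExtAlg k c) M]
    [AddCommGroup N] [Module (ExtAlg k c) N] [Module.Finite (ExtAlg k c) N] :
    List.TFAE
      [∃ n₀ : ℕ, ∀ i ≥ n₀, extVanish (ExtAlg k c) M N i,
       ∀ i > 0, extVanish (ExtAlg k c) M N i,
       ∃ n₀ : ℕ, ∀ i ≥ n₀, extVanish (ExtAlg k c) N M i,
       ∀ i > 0, extVanish (ExtAlg k c) N M i] := by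
  tfae_have 1 → 2 := fun h => (ExtSym.final h).1
  tfae_have 2 → 3 := fun h => ⟨1, fun i hi => (ExtSym.final ⟨1, fun i hi => h i (by omega)⟩).2 i (by omega)⟩
  tfae_have 3 → 4 := fun h => (ExtSym.final h).1
  tfae_have 4 → 1 := fun h => ⟨1, fun i hi => (ExtSym.final ⟨1, fun i hi => h i (by omega)⟩).2 i (by omega)⟩
  tfae_finish
end
end

section
/- Let k be a field, let c ≥ 2 and a ≥ 2 be integers, let q ∈ k satisfy q^{a−1} = 1, and let A = k⟨X_1, …, X_c⟩/(X_i^a for all i; X_iX_j − qX_jX_i for all i < j). Then for all finitely generated left A-modules M and N, the following are equivalent: (i) Ext_A^i(M,N) = 0 for all sufficiently large i; (ii) Ext_A^i(M,N) = 0 for all i > 0; (iii) Ext_A^i(N,M) = 0 for all sufficiently large i; (iv) Ext_A^i(N,M) = 0 for all i > 0. -/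
/-!
Ext-symmetry for all finitely generated modules over the symmetric quantum complete
intersection `k⟨X_1,…,X_c⟩/(X_i^a, X_iX_j - qX_jX_i (i < j))`, where `q^{a-1} = 1`
(Example (ii) after Theorem `symmetrysymmetric`).
-/

noncomputable section

open CategoryTheory

/-- The commutation matrix with `q` above the diagonal, `1` on it and `q⁻¹` below it. -/
def unifQ (k : Type) [Field k] (c : ℕ) (q : k) : Fin c → Fin c → k :=
  fun i j => if i < j then q else if i = j then 1 else q⁻¹

namespace ExtSym

section ExtAPI
variable {A : Type} [Ring A]

/-- Vanishing of the (derived-category) Ext group. -/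
def EZ (A : Type) [Ring A] (M N : Type) [AddCommGroup M] [Module A M]
    [AddCommGroup N] [Module A N] (i : ℕ) : Prop :=
  Subsingleton (CategoryTheory.Abelian.Ext.{0} (ModuleCat.of A M) (ModuleCat.of A N) i)

theorem extVanish_iff_s14 (M N : Type) [AddCommGroup M] [Module A M]
    [AddCommGroup N] [Module A N] (i : ℕ) :
    extVanish A M N (i + 1) ↔ EZ A M N (i + 1) := by
  let R : ProjectiveResolution (ModuleCat.of A M) := projectiveResolution (ModuleCat.of A M)
  have key : EZ A M N (i + 1) ↔ ∀ (f : R.complex.X (i + 1) ⟶ ModuleCat.of A N),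
      R.complex.d (i + 2) (i + 1) ≫ f = 0 →
      ∃ g : R.complex.X i ⟶ ModuleCat.of A N, R.complex.d (i + 1) i ≫ g = f := by
    constructor
    · intro h f hf
      have : Subsingleton _ := h
      rw [← R.extMk_eq_zero_iff f (i + 2) rfl hf i rfl]
      exact Subsingleton.elim _ _
    · intro h
      have : ∀ x : CategoryTheory.Abelian.Ext.{0} (ModuleCat.of A M) (ModuleCat.of A N) (i + 1),
          x = 0 := by
        intro x
        obtain ⟨f, hf, rfl⟩ := R.extMk_surjective x (i + 2) rfl
        rw [R.extMk_eq_zero_iff f (i + 2) rfl hf i rfl]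
        exact h f hf
      exact ⟨fun x y => by rw [this x, this y]⟩
  rw [key]
  unfold extVanish
  rw [← ModuleCat.isZero_iff_subsingleton, (R.isoExt (R := ℤ) (i + 1) (ModuleCat.of A N)).isZero_iff,
    ← HomologicalComplex.exactAt_iff_isZero_homology,
    HomologicalComplex.exactAt_iff' _ i (i + 1) (i + 2) (by simp) (by simp),
    ShortComplex.moduleCat_exact_iff]
  rfl

variable {M K L : Type} [AddCommGroup M] [Module A M] [AddCommGroup K] [Module A K]
  [AddCommGroup L] [Module A L]

/-- A short exact sequence of modules. -/
structure SES (f : M →ₗ[A] K) (g : K →ₗ[A] L) : Prop where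
  inj : Function.Injective f
  exact : Function.Exact f g
  surj : Function.Surjective g

/-- The associated short complex. -/
abbrev SES.sc {f : M →ₗ[A] K} {g : K →ₗ[A] L} (h : SES f g) : ShortComplex (ModuleCat.{0} A) :=
  ShortComplex.mk (ModuleCat.ofHom f) (ModuleCat.ofHom g) (by
    ext x
    exact h.exact.apply_apply_eq_zero x)

theorem SES.se {f : M →ₗ[A] K} {g : K →ₗ[A] L} (h : SES f g) : h.sc.ShortExact :=
  ModuleCat.shortComplex_shortExact _ h.exact h.inj h.surj

theorem ez_iff (M N : Type) [AddCommGroup M] [Module A M]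
    [AddCommGroup N] [Module A N] (i : ℕ) : EZ A M N i ↔
    ∀ x : CategoryTheory.Abelian.Ext.{0} (ModuleCat.of A M) (ModuleCat.of A N) i, x = 0 :=
  ⟨fun h x => by have : Subsingleton _ := h; exact Subsingleton.elim _ _,
   fun h => ⟨fun x y => by rw [h x, h y]⟩⟩

variable {f : M →ₗ[A] K} {g : K →ₗ[A] L} {N : Type} [AddCommGroup N] [Module A N]

theorem SES.mid (h : SES f g) {i : ℕ} (h1 : EZ A M N i) (h3 : EZ A L N i) : EZ A K N i := by
  rw [ez_iff] at *
  intro x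
  obtain ⟨y, hy⟩ := Abelian.Ext.contravariant_sequence_exact₂ h.se _ x (h1 _)
  rw [← hy, h3 y]; simp

theorem SES.left (h : SES f g) {i : ℕ} (h1 : EZ A K N i) (h3 : EZ A L N (i + 1)) :
    EZ A M N i := by
  rw [ez_iff] at *
  intro x
  obtain ⟨y, hy⟩ := Abelian.Ext.contravariant_sequence_exact₁ h.se _ x (add_comm 1 i) (h3 _)
  rw [← hy, h1 y]; simp

theorem SES.right (h : SES f g) {i : ℕ} (h1 : EZ A M N i) (h3 : EZ A K N (i + 1)) :
    EZ A L N (i + 1) := by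
  rw [ez_iff] at *
  intro x
  obtain ⟨y, hy⟩ := Abelian.Ext.contravariant_sequence_exact₃ h.se _ x (h3 _) (add_comm 1 i)
  rw [← hy, h1 y]; simp

theorem SES.cov_left (h : SES f g) {i : ℕ} (h1 : EZ A N L i) (h3 : EZ A N K (i + 1)) :
    EZ A N M (i + 1) := by
  rw [ez_iff] at *
  intro x
  obtain ⟨y, hy⟩ := Abelian.Ext.covariant_sequence_exact₁ _ h.se x (h3 _) rfl
  rw [← hy, h1 y]; simp

theorem SES.cov_left_one (h : SES f g) (h1 : ∀ φ : N →ₗ[A] L, ∃ ψ : N →ₗ[A] K, g ∘ₗ ψ = φ)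
    (h3 : EZ A N K 1) : EZ A N M 1 := by
  rw [ez_iff] at *
  intro x
  obtain ⟨y, hy⟩ := Abelian.Ext.covariant_sequence_exact₁ _ h.se x (h3 _) rfl
  obtain ⟨φ, rfl⟩ := (Abelian.Ext.mk₀_bijective _ _).2 y
  obtain ⟨ψ, hψ⟩ := h1 φ.hom
  have : φ = ModuleCat.ofHom ψ ≫ h.sc.g := by
    ext x
    exact (LinearMap.congr_fun hψ x).symm
  rw [← hy, this, ← Abelian.Ext.mk₀_comp_mk₀, Abelian.Ext.comp_assoc _ _ _ (add_zero 0) (zero_add 1) (by simp),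
    h.se.comp_extClass, Abelian.Ext.comp_zero]

theorem SES.extend (h : SES f g) (h1 : EZ A L N 1) (φ : M →ₗ[A] N) :
    ∃ ψ : K →ₗ[A] N, ψ ∘ₗ f = φ := by
  rw [ez_iff] at *
  obtain ⟨y, hy⟩ := Abelian.Ext.contravariant_sequence_exact₁ h.se _
    (Abelian.Ext.mk₀ (ModuleCat.ofHom φ)) (add_zero 1) (h1 _)
  obtain ⟨ψ, rfl⟩ := (Abelian.Ext.mk₀_bijective _ _).2 y
  rw [Abelian.Ext.mk₀_comp_mk₀] at hy
  have := (Abelian.Ext.mk₀_bijective _ _).1 hy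
  refine ⟨ψ.hom, ?_⟩
  ext x
  exact congrArg (fun t => t.hom x) this

theorem ez_projective [Module.Projective A M] (i : ℕ) : EZ A M N (i + 1) := by
  rw [ez_iff]
  intro x
  exact Abelian.Ext.eq_zero_of_projective x

theorem ez_injective (hM : CategoryTheory.Injective (ModuleCat.of A M)) (i : ℕ) :
    EZ A N M (i + 1) := by
  rw [ez_iff]
  intro x
  exact Abelian.Ext.eq_zero_of_injective x

end ExtAPI
end ExtSym


namespace ExtSym

section Basic
variable (k : Type) [Field k] (c b : ℕ) (Q : Fin c → Fin c → k)

/-- The algebra, with all exponents equal to `b + 1`. -/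
abbrev Al : Type := QCI k c Q (fun _ => b + 1)

/-- The generators. -/
def X (i : Fin c) : Al k c b Q := RingQuot.mkAlgHom k (qciRel k c Q (fun _ => b + 1)) (FreeAlgebra.ι k i)

theorem X_pow (i : Fin c) : X k c b Q i ^ (b + 1) = 0 := by
  have : qciRel k c Q (fun _ => b + 1) (FreeAlgebra.ι k i ^ (b + 1)) 0 := Or.inl ⟨i, rfl, rfl⟩
  have h := RingQuot.mkAlgHom_rel k this
  simpa [X] using h

theorem X_comm (i j : Fin c) : X k c b Q i * X k c b Q j = Q i j • (X k c b Q j * X k c b Q i) := by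
  have : qciRel k c Q (fun _ => b + 1) (FreeAlgebra.ι k i * FreeAlgebra.ι k j)
    (Q i j • (FreeAlgebra.ι k j * FreeAlgebra.ι k i)) := Or.inr ⟨i, j, rfl, rfl⟩
  have h := RingQuot.mkAlgHom_rel k this
  simpa [X] using h

theorem X_comm_pow (s i : Fin c) (n : ℕ) :
    X k c b Q s * X k c b Q i ^ n = Q s i ^ n • (X k c b Q i ^ n * X k c b Q s) := by
  induction n with
  | zero => simp
  | succ n ih =>
    rw [pow_succ, ← mul_assoc, ih, smul_mul_assoc, mul_assoc, X_comm k c b Q s i, mul_smul_comm, smul_smul,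
      mul_assoc, pow_succ]

theorem adjoin_X : Algebra.adjoin k (Set.range (X k c b Q)) = ⊤ := by
  have h1 : Set.range (X k c b Q) =
      RingQuot.mkAlgHom k (qciRel k c Q (fun _ => b + 1)) '' Set.range (FreeAlgebra.ι k) := by
    rw [← Set.range_comp]; rfl
  rw [h1, ← AlgHom.map_adjoin, FreeAlgebra.adjoin_range_ι, Algebra.map_top,
    AlgHom.range_eq_top]
  exact RingQuot.mkAlgHom_surjective _ _

variable {k c b Q}

theorem Al_induction {P : Al k c b Q → Prop} (h1 : ∀ r : k, P (algebraMap k _ r))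
    (hX : ∀ i, P (X k c b Q i)) (hadd : ∀ x y, P x → P y → P (x + y))
    (hmul : ∀ x y, P x → P y → P (x * y)) (y : Al k c b Q) : P y := by
  have hy : y ∈ Algebra.adjoin k (Set.range (X k c b Q)) := by rw [adjoin_X]; trivial
  induction hy using Algebra.adjoin_induction with
  | mem x hx => obtain ⟨i, rfl⟩ := hx; exact hX i
  | algebraMap r => exact h1 r
  | add x y _ _ hx hy => exact hadd x y hx hy
  | mul x y _ _ hx hy => exact hmul x y hx hy

/-- Commuting with generators implies linearity. -/
def mkLin {M N : Type} [AddCommGroup M] [Module k M] [Module (Al k c b Q) M]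
    [IsScalarTower k (Al k c b Q) M]
    [AddCommGroup N] [Module k N] [Module (Al k c b Q) N] [IsScalarTower k (Al k c b Q) N]
    (f : M →ₗ[k] N) (h : ∀ i m, f (X k c b Q i • m) = X k c b Q i • f m) :
    M →ₗ[Al k c b Q] N where
  toFun := f
  map_add' := f.map_add
  map_smul' := by
    intro y
    refine Al_induction (P := fun y => ∀ m, f (y • m) = y • f m) ?_ h ?_ ?_ y
    · intro r m; simp
    · intro x y hx hy m; simp [add_smul, hx, hy]
    · intro x y hx hy m; simp [mul_smul, hx, hy]

@[simp] theorem mkLin_apply {M N : Type} [AddCommGroup M] [Module k M] [Module (Al k c b Q) M]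
    [IsScalarTower k (Al k c b Q) M]
    [AddCommGroup N] [Module k N] [Module (Al k c b Q) N] [IsScalarTower k (Al k c b Q) N]
    (f : M →ₗ[k] N) (h : ∀ i m, f (X k c b Q i • m) = X k c b Q i • f m) (m : M) :
    mkLin f h m = f m := rfl

/-- Operators satisfying the defining relations. -/
structure OpRel {V : Type} [AddCommGroup V] [Module k V] (b : ℕ) (Q : Fin c → Fin c → k)
    (x : Fin c → Module.End k V) : Prop where
  pow : ∀ i, x i ^ (b + 1) = 0
  comm : ∀ i j, x i * x j = Q i j • (x j * x i)

/-- The module defined by operators. -/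
def OpMod {V : Type} [AddCommGroup V] [Module k V] (x : Fin c → Module.End k V)
    (_ : OpRel b Q x) : Type := V

variable {V : Type} [AddCommGroup V] [Module k V] {x : Fin c → Module.End k V}

instance (h : OpRel b Q x) : AddCommGroup (OpMod x h) := inferInstanceAs (AddCommGroup V)
instance (h : OpRel b Q x) : Module k (OpMod x h) := inferInstanceAs (Module k V)
instance (h : OpRel b Q x) [Module.Finite k V] : Module.Finite k (OpMod x h) :=
  inferInstanceAs (Module.Finite k V)

/-- The representation. -/
def opHom (h : OpRel b Q x) : Al k c b Q →ₐ[k] Module.End k V :=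
  RingQuot.liftAlgHom k ⟨FreeAlgebra.lift k x, by
    rintro y z (⟨i, rfl, rfl⟩ | ⟨i, j, rfl, rfl⟩)
    · simpa using h.pow i
    · simpa using h.comm i j⟩

theorem opHom_X (h : OpRel b Q x) (i : Fin c) : opHom h (X k c b Q i) = x i := by
  simp [opHom, X]

instance (h : OpRel b Q x) : Module (Al k c b Q) (OpMod x h) :=
  Module.compHom V (opHom h).toRingHom

theorem op_smul (h : OpRel b Q x) (y : Al k c b Q) (v : OpMod x h) :
    y • v = (show OpMod x h from opHom h y (show V from v)) := rfl

theorem op_X (h : OpRel b Q x) (i : Fin c) (v : OpMod x h) :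
    X k c b Q i • v = (show OpMod x h from x i (show V from v)) := by
  rw [op_smul, opHom_X]

instance (h : OpRel b Q x) : IsScalarTower k (Al k c b Q) (OpMod x h) where
  smul_assoc r y v := by
    rw [op_smul, op_smul, map_smul]; rfl

/-- The identity map. -/
def opE (h : OpRel b Q x) : V ≃ₗ[k] OpMod x h := LinearEquiv.refl k V

theorem X_opE (h : OpRel b Q x) (i : Fin c) (v : V) :
    X k c b Q i • opE h v = opE h (x i v) := op_X h i v

end Basic
end ExtSym


namespace ExtSym

set_option linter.unusedSectionVars false

section Ind
variable {k : Type} [Field k] {c b : ℕ} {Q : Fin c → Fin c → k}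

variable {M : Type} [AddCommGroup M] [Module k M] [Module (Al k c b Q) M]
    [IsScalarTower k (Al k c b Q) M]

/-- Action of a generator as a `k`-linear map. -/
def act (M : Type) [AddCommGroup M] [Module k M] [Module (Al k c b Q) M]
    [IsScalarTower k (Al k c b Q) M] (i : Fin c) : Module.End k M :=
  Algebra.lsmul k k M (X k c b Q i)

theorem act_apply (i : Fin c) (m : M) : act (Q := Q) (b := b) M i m = X k c b Q i • m := rfl

theorem X_smul_comm (i j : Fin c) (m : M) : X k c b Q i • X k c b Q j • m =
    Q i j • X k c b Q j • X k c b Q i • m := by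
  rw [smul_smul, X_comm, smul_assoc, mul_smul]

theorem X_smul_pow_comm (i j : Fin c) (n : ℕ) (m : M) : X k c b Q i • X k c b Q j ^ n • m =
    Q i j ^ n • X k c b Q j ^ n • X k c b Q i • m := by
  rw [smul_smul, X_comm_pow, smul_assoc, mul_smul]

theorem act_rel : OpRel b Q (act (Q := Q) (b := b) M) where
  pow i := by
    rw [act, ← map_pow, X_pow, map_zero]
  comm i j := by
    ext m
    exact X_smul_comm i j m

theorem twist_rel (w : Fin c → k) : OpRel b Q (fun i => w i • act (Q := Q) (b := b) M i) where
  pow i := by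
    rw [smul_pow, act_rel.pow, smul_zero]
  comm i j := by
    simp only [smul_mul_smul_comm, act_rel.comm i j, smul_smul]
    congr 1; ring

/-- The twisted module. -/
abbrev Tw (b : ℕ) (Q : Fin c → Fin c → k) (M : Type) [AddCommGroup M] [Module k M]
    [Module (Al k c b Q) M]
    [IsScalarTower k (Al k c b Q) M] (w : Fin c → k) : Type :=
  OpMod (b := b) (Q := Q) (fun i => w i • act (Q := Q) (b := b) M i) (twist_rel w)

/-- identity -/
def twE (w : Fin c → k) : M ≃ₗ[k] Tw b Q M w := opE _

theorem X_twE (w : Fin c → k) (i : Fin c) (m : M) :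
    X k c b Q i • twE (b := b) (Q := Q) w m = twE (b := b) (Q := Q) w (w i • X k c b Q i • m) :=
  X_opE _ i m

/-- The shift operator. -/
def shift_s14 (k : Type) [Field k] (b : ℕ) (M : Type) [AddCommGroup M] [Module k M] :
    Module.End k (Fin (b + 1) → M) where
  toFun f := Fin.cons 0 (fun l => f l.castSucc)
  map_add' f g := by
    funext l; refine Fin.cases ?_ (fun l => ?_) l <;> simp
  map_smul' r g := by
    funext l; refine Fin.cases ?_ (fun l => ?_) l <;> simp

@[simp] theorem shift_zero (f : Fin (b + 1) → M) : shift_s14 k b M f 0 = 0 := rfl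
@[simp] theorem shift_succ (f : Fin (b + 1) → M) (l : Fin b) :
    shift_s14 k b M f l.succ = f l.castSucc := rfl

theorem shift_pow (n : ℕ) : ∀ (f : Fin (b + 1) → M) (l : Fin (b + 1)), l.1 < n →
    (shift_s14 k b M ^ n) f l = 0 := by
  induction n with
  | zero => intro f l h; omega
  | succ n ih =>
    intro f l h
    rw [pow_succ', Module.End.mul_apply]
    induction l using Fin.cases with
    | zero => rfl
    | succ l => rw [shift_succ]; exact ih f _ (by simpa using h)

/-- The diagonal operator. -/
def diag (Q : Fin c → Fin c → k) (M : Type) [AddCommGroup M] [Module k M]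
    [Module (Al k c b Q) M] [IsScalarTower k (Al k c b Q) M] (i s : Fin c) :
    Module.End k (Fin (b + 1) → M) where
  toFun f := fun l => Q s i ^ (l : ℕ) • X k c b Q s • f l
  map_add' f g := by funext l; simp
  map_smul' r g := by funext l; simp [smul_comm r]

theorem diag_apply (i s : Fin c) (f : Fin (b + 1) → M) (l : Fin (b + 1)) :
    diag Q M i s f l = Q s i ^ (l : ℕ) • X k c b Q s • f l := rfl

theorem diag_pow (i s : Fin c) (n : ℕ) (f : Fin (b + 1) → M) (l : Fin (b + 1)) :
    (diag Q M i s ^ n) f l = (Q s i ^ (l : ℕ)) ^ n • X k c b Q s ^ n • f l := by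
  induction n with
  | zero => simp
  | succ n ih =>
    rw [pow_succ', Module.End.mul_apply, diag_apply, ih, smul_comm (X k c b Q s), smul_smul, smul_smul,
      ← pow_succ', ← pow_succ']

/-- operators of the induced module -/
def indOp (Q : Fin c → Fin c → k) (M : Type) [AddCommGroup M] [Module k M]
    [Module (Al k c b Q) M] [IsScalarTower k (Al k c b Q) M] (i s : Fin c) :
    Module.End k (Fin (b + 1) → M) :=
  if s = i then shift_s14 k b M else diag Q M i s

/-- Conditions on the commutation matrix. -/
structure QM (Q : Fin c → Fin c → k) : Prop where
  one : ∀ i, Q i i = 1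
  inv : ∀ i j, Q i j * Q j i = 1

theorem diag_shift (i s : Fin c) :
    diag Q M i s * shift_s14 k b M = Q s i • (shift_s14 k b M * diag Q M i s) := by
  refine LinearMap.ext fun f => funext fun l => ?_
  change diag Q M i s (shift_s14 k b M f) l = Q s i • (shift_s14 k b M (diag Q M i s f) l)
  induction l using Fin.cases with
  | zero => simp [diag_apply]
  | succ l => simp [diag_apply, pow_succ', smul_smul]

theorem ind_rel (hQ : QM Q) (i : Fin c) : OpRel b Q (indOp (b := b) Q M i) where
  pow s := by
    unfold indOp
    split_ifs
    · refine LinearMap.ext fun f => funext fun l => ?_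
      exact shift_pow _ f l l.2
    · refine LinearMap.ext fun f => funext fun l => ?_
      rw [diag_pow, X_pow, zero_smul, smul_zero]; rfl
  comm s t := by
    unfold indOp
    split_ifs with h1 h2 h2
    · subst h1 h2; rw [hQ.one, one_smul]
    · subst h1; rw [diag_shift, smul_smul, hQ.inv, one_smul]
    · subst h2; rw [diag_shift]
    · refine LinearMap.ext fun f => funext fun l => ?_
      change diag Q M i s (diag Q M i t f) l = Q s t • (diag Q M i t (diag Q M i s f) l)
      simp only [diag_apply]
      rw [smul_comm (X k c b Q s), smul_comm (X k c b Q t), X_smul_comm s t]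
      simp only [smul_smul]
      congr 1; ring

/-- The induced module. -/
abbrev Ind (hQ : QM Q) (b : ℕ) (M : Type) [AddCommGroup M] [Module k M]
    [Module (Al k c b Q) M] [IsScalarTower k (Al k c b Q) M] (i : Fin c) : Type :=
  OpMod (indOp (b := b) Q M i) (ind_rel hQ i)

variable (hQ : QM Q)

/-- identity -/
def indE (i : Fin c) : (Fin (b + 1) → M) ≃ₗ[k] Ind hQ b M i := opE _

theorem Xi_indE (i : Fin c) (f : Fin (b + 1) → M) :
    X k c b Q i • indE hQ i f = indE hQ i (shift_s14 k b M f) := by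
  have := X_opE (ind_rel (b := b) (M := M) hQ i) i f
  rw [indOp, if_pos rfl] at this
  exact this

theorem Xs_indE {i s : Fin c} (h : s ≠ i) (f : Fin (b + 1) → M) :
    X k c b Q s • indE hQ i f = indE hQ i (diag Q M i s f) := by
  have := X_opE (ind_rel (b := b) (M := M) hQ i) s f
  rw [indOp, if_neg h] at this
  exact this

/-- Semilinear maps. -/
def Semi (b : ℕ) (Q : Fin c → Fin c → k) (S : Finset (Fin c)) (w : Fin c → k)
    {M Y : Type} [AddCommGroup M] [Module k M]
    [Module (Al k c b Q) M] [AddCommGroup Y] [Module k Y] [Module (Al k c b Q) Y]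
    (φ : M →ₗ[k] Y) : Prop :=
  ∀ s ∈ S, ∀ m, φ (X k c b Q s • m) = w s • X k c b Q s • φ m

/-- Relative projectivity over the subalgebra generated by `X s`, `s ∈ S`. -/
def Good (b : ℕ) (Q : Fin c → Fin c → k) (S : Finset (Fin c)) (M : Type) [AddCommGroup M]
    [Module k M] [Module (Al k c b Q) M] : Prop :=
  ∀ (Y Z : Type) [AddCommGroup Y] [Module k Y] [Module (Al k c b Q) Y]
    [IsScalarTower k (Al k c b Q) Y] [AddCommGroup Z] [Module k Z] [Module (Al k c b Q) Z]
    [IsScalarTower k (Al k c b Q) Z] (p : Y →ₗ[Al k c b Q] Z), Function.Surjective p →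
    ∀ (w : Fin c → k) (φ : M →ₗ[k] Z), Semi b Q S w φ →
    ∃ ψ : M →ₗ[k] Y, Semi b Q S w ψ ∧ ∀ m, p (ψ m) = φ m

variable {Y : Type} [AddCommGroup Y] [Module k Y] [Module (Al k c b Q) Y]
    [IsScalarTower k (Al k c b Q) Y]

/-- Extension of a semilinear map to the induced module. -/
def extMap (i : Fin c) (w : k) (ψ : M →ₗ[k] Y) : Ind hQ b M i →ₗ[k] Y :=
  (∑ l : Fin (b + 1), (w ^ (l : ℕ)) • (Algebra.lsmul k k Y (X k c b Q i ^ (l : ℕ)) ∘ₗ ψ ∘ₗ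
    LinearMap.proj l)) ∘ₗ (indE hQ i).symm.toLinearMap

theorem extMap_apply (i : Fin c) (w : k) (ψ : M →ₗ[k] Y) (f : Fin (b + 1) → M) :
    extMap hQ i w ψ (indE hQ i f) = ∑ l : Fin (b + 1), w ^ (l : ℕ) • X k c b Q i ^ (l : ℕ) • ψ (f l) := by
  rw [extMap, LinearMap.comp_apply, LinearEquiv.coe_coe, LinearEquiv.symm_apply_apply,
    LinearMap.sum_apply]
  rfl

theorem extMap_semi {S : Finset (Fin c)} {i : Fin c} (hi : i ∉ S) {w : Fin c → k} {ψ : M →ₗ[k] Y}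
    (hψ : Semi b Q S w ψ) : Semi b Q (insert i S) w (extMap (b := b) hQ i (w i) ψ) := by
  intro s hs m
  obtain ⟨f, rfl⟩ := (indE hQ i).surjective m
  rw [Finset.mem_insert] at hs
  by_cases h : s = i
  · subst h
    rw [Xi_indE, extMap_apply, extMap_apply, Fin.sum_univ_succ, Fin.sum_univ_castSucc]
    simp only [shift_zero, map_zero, smul_zero, zero_add, shift_succ, Fin.val_succ, Fin.val_castSucc,
      Fin.val_last, smul_add, Finset.smul_sum]
    rw [smul_comm (X k c b Q s) (w s ^ b), smul_smul (X k c b Q s), ← pow_succ', X_pow]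
    simp only [zero_smul, smul_zero, add_zero]
    refine Finset.sum_congr rfl fun l _ => ?_
    rw [smul_comm (X k c b Q s), smul_smul, smul_smul, pow_succ', pow_succ']
  · have hs' : s ∈ S := hs.resolve_left h
    rw [Xs_indE hQ h, extMap_apply, extMap_apply, Finset.smul_sum, Finset.smul_sum]
    refine Finset.sum_congr rfl fun l _ => ?_
    rw [diag_apply, map_smul, hψ s hs', smul_comm (X k c b Q s) (w i ^ _), X_smul_pow_comm]
    rw [smul_comm (X k c b Q i ^ _) (Q s i ^ _), smul_comm (X k c b Q i ^ _) (w s)]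
    simp only [smul_smul]
    congr 1; ring

/-- Inclusion in degree zero. -/
def inc (i : Fin c) : M →ₗ[k] Ind hQ b M i :=
  (indE hQ i).toLinearMap ∘ₗ LinearMap.single k (fun _ => M) 0

theorem inc_apply (i : Fin c) (m : M) : inc hQ i m = indE (b := b) hQ i (Pi.single 0 m) := rfl

theorem inc_semi {i s : Fin c} (h : s ≠ i) (m : M) :
    inc (b := b) hQ i (X k c b Q s • m) = X k c b Q s • inc hQ i m := by
  rw [inc_apply, inc_apply, Xs_indE hQ h]
  congr 1
  funext l
  rw [diag_apply]
  by_cases hl : l = 0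
  · subst hl; simp
  · simp [hl]

theorem X_pow_inc (i : Fin c) (m : M) (n : ℕ) (hn : n < b + 1) :
    X k c b Q i ^ n • inc hQ i m = indE (b := b) hQ i (Pi.single ⟨n, hn⟩ m) := by
  induction n with
  | zero => rw [pow_zero, one_smul]; rfl
  | succ n ih =>
    rw [pow_succ', mul_smul, ih (by omega), Xi_indE]
    congr 1
    funext l
    induction l using Fin.cases with
    | zero => rw [shift_zero, Pi.single_eq_of_ne]; simp [Fin.ext_iff]
    | succ l =>
      rw [shift_succ]
      simp [Pi.single_apply, Fin.ext_iff]

theorem indE_eq (i : Fin c) (f : Fin (b + 1) → M) :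
    indE hQ i f = ∑ l : Fin (b + 1), X k c b Q i ^ (l : ℕ) • inc hQ i (f l) := by
  have : f = ∑ l, Pi.single l (f l) := (Finset.univ_sum_single f).symm
  conv_lhs => rw [this, map_sum]
  refine Finset.sum_congr rfl fun l _ => ?_
  rw [X_pow_inc hQ i (f l) l l.2]

theorem semi_pow {S : Finset (Fin c)} {w : Fin c → k} {φ : M →ₗ[k] Y} (h : Semi b Q S w φ)
    {i : Fin c} (hi : i ∈ S) (n : ℕ) (m : M) :
    φ (X k c b Q i ^ n • m) = w i ^ n • X k c b Q i ^ n • φ m := by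
  induction n with
  | zero => simp
  | succ n ih =>
    rw [pow_succ', mul_smul, h i hi, ih, smul_comm (X k c b Q i), smul_smul, smul_smul, pow_succ']

theorem good_ind {S : Finset (Fin c)} {i : Fin c} (hi : i ∉ S) (h : Good b Q S M) :
    Good b Q (insert i S) (Ind hQ b M i) := by
  intro Y Z _ _ _ _ _ _ _ _ p hp w φ hφ
  obtain ⟨ψ, hψ, hpψ⟩ := h Y Z p hp w (φ ∘ₗ inc hQ i) (by
    intro s hs m
    have : s ≠ i := fun e => hi (e ▸ hs)
    simp only [LinearMap.comp_apply]
    rw [inc_semi hQ this, hφ s (Finset.mem_insert_of_mem hs)])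
  refine ⟨extMap hQ i (w i) ψ, extMap_semi hQ hi hψ, ?_⟩
  intro m
  obtain ⟨f, rfl⟩ := (indE hQ i).surjective m
  have key : ∀ (r : k) (y : Y), p (r • y) = r • p y := fun r y => LinearMap.map_smul_of_tower p r y
  rw [extMap_apply, map_sum, indE_eq, map_sum]
  refine Finset.sum_congr rfl fun l _ => ?_
  rw [semi_pow hφ (Finset.mem_insert_self _ _), key, map_smul, hpψ]; rfl

theorem good_twist {S : Finset (Fin c)} (h : Good b Q S M) (v : Fin c → k) (hv : ∀ i, v i ≠ 0) :
    Good b Q S (Tw b Q M v) := by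
  intro Y Z _ _ _ _ _ _ _ _ p hp w φ hφ
  obtain ⟨ψ, hψ, hpψ⟩ := h Y Z p hp (fun i => w i / v i) (φ ∘ₗ (twE v).toLinearMap) (by
    intro s hs m
    have := hφ s hs (twE v m)
    rw [X_twE, map_smul, map_smul] at this
    simp only [LinearMap.comp_apply, LinearEquiv.coe_coe]
    rw [div_eq_inv_mul, mul_smul, ← this, smul_smul, inv_mul_cancel₀ (hv s), one_smul])
  refine ⟨ψ ∘ₗ (twE v).symm.toLinearMap, ?_, ?_⟩
  · intro s hs m
    obtain ⟨m, rfl⟩ := (twE v).surjective m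
    rw [X_twE]
    simp only [LinearMap.comp_apply, LinearEquiv.coe_coe, LinearEquiv.symm_apply_apply, map_smul]
    rw [hψ s hs, smul_smul, mul_div_cancel₀ _ (hv s)]
  · intro m
    obtain ⟨m, rfl⟩ := (twE v).surjective m
    simpa using hpψ m

theorem good_empty : Good b Q ∅ M := by
  intro Y Z _ _ _ _ _ _ _ _ p hp w φ _
  obtain ⟨ψ, hψ⟩ := Module.projective_lifting_property (p.restrictScalars k) φ hp
  exact ⟨ψ, fun s hs => by simp at hs, fun m => LinearMap.congr_fun hψ m⟩

theorem good_univ (h : Good b Q Finset.univ M) : Module.Projective (Al k c b Q) M := by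
  refine Module.Projective.of_lifting_property'' fun f hf => ?_
  obtain ⟨ψ, hψ, hp⟩ := h (M →₀ Al k c b Q) M f hf 1 LinearMap.id (by
    intro s _ m; simp)
  refine ⟨mkLin (k := k) (c := c) (b := b) (Q := Q) (N := M →₀ Al k c b Q) ψ (fun i m => by
    have := hψ i (Finset.mem_univ i) m
    rwa [Pi.one_apply, one_smul] at this), ?_⟩
  ext m
  exact hp m

theorem good_prod {S : Finset (Fin c)} {M' : Type} [AddCommGroup M'] [Module k M']
    [Module (Al k c b Q) M']
    [IsScalarTower k (Al k c b Q) M'] (h : Good b Q S M) (h' : Good b Q S M') :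
    Good b Q S (M × M') := by
  intro Y Z _ _ _ _ _ _ _ _ p hp w φ hφ
  obtain ⟨ψ, hψ, hpψ⟩ := h Y Z p hp w (φ ∘ₗ LinearMap.inl k M M') (by
    intro s hs m
    have := hφ s hs (m, 0)
    simpa using this)
  obtain ⟨ψ', hψ', hpψ'⟩ := h' Y Z p hp w (φ ∘ₗ LinearMap.inr k M M') (by
    intro s hs m
    have := hφ s hs (0, m)
    simpa using this)
  refine ⟨LinearMap.coprod ψ ψ', ?_, ?_⟩
  · rintro s hs ⟨m, m'⟩
    simp [hψ s hs, hψ' s hs]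
  · rintro ⟨m, m'⟩
    rw [LinearMap.coprod_apply, map_add, hpψ, hpψ']
    simp only [LinearMap.comp_apply]
    rw [← map_add]
    simp

theorem good_ker {S : Finset (Fin c)} {M' : Type} [AddCommGroup M'] [Module k M']
    [Module (Al k c b Q) M']
    [IsScalarTower k (Al k c b Q) M'] (h : Good b Q S M) (h' : Good b Q S M')
    (π : M →ₗ[Al k c b Q] M') (hπ : Function.Surjective π) :
    Good b Q S (LinearMap.ker π) := by
  intro Y Z _ _ _ _ _ _ _ _ p hp w φ hφ
  obtain ⟨σ, hσ, hπσ⟩ := h' M M' π hπ 1 LinearMap.id (by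
    intro s _ m; simp)
  let r : M →ₗ[k] LinearMap.ker π :=
    { toFun := fun m => ⟨m - σ (π m), by simp [hπσ]⟩
      map_add' := fun x y => by ext; simp; abel
      map_smul' := fun t y => by
        ext
        have : π (t • y) = t • π y := LinearMap.map_smul_of_tower π t y
        simp [this, smul_sub] }
  have hr : ∀ s ∈ S, ∀ m, r (X k c b Q s • m) = X k c b Q s • r m := by
    intro s hs m
    ext
    have := hσ s hs (π m)
    simp only [Pi.one_apply, one_smul] at this
    simp [r, this, smul_sub]
  have hr2 : ∀ z : LinearMap.ker π, r z = z := by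
    intro z; ext; simp [r]
  obtain ⟨ψ, hψ, hpψ⟩ := h Y Z p hp w (φ ∘ₗ r) (by
    intro s hs m
    simp only [LinearMap.comp_apply]
    rw [hr s hs, hφ s hs])
  refine ⟨ψ ∘ₗ (LinearMap.ker π).subtype.restrictScalars k, ?_, ?_⟩
  · intro s hs m
    exact hψ s hs m
  · intro m
    have := hpψ m
    simp only [LinearMap.comp_apply] at this
    rw [hr2] at this
    exact this

end Ind
end ExtSym


namespace ExtSym

set_option linter.unusedSectionVars false

section Seq
variable {k : Type} [Field k] {c b : ℕ} {Q : Fin c → Fin c → k} (hQ : QM Q)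

variable {M : Type} [AddCommGroup M] [Module k M] [Module (Al k c b Q) M]
    [IsScalarTower k (Al k c b Q) M]

/-- A map semilinear for all generators with trivial twist is linear. -/
theorem semi_one_lin {Y : Type} [AddCommGroup Y] [Module k Y] [Module (Al k c b Q) Y]
    {φ : M →ₗ[k] Y} (h : Semi b Q Finset.univ 1 φ) (i : Fin c) (m : M) :
    φ (X k c b Q i • m) = X k c b Q i • φ m := by
  have := h i (Finset.mem_univ i) m
  rwa [Pi.one_apply, one_smul] at this

theorem eps_semi (i : Fin c) :
    Semi b Q Finset.univ 1 (extMap (b := b) hQ i 1 (LinearMap.id (R := k) (M := M))) := by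
  have := extMap_semi (b := b) hQ (Finset.notMem_erase i Finset.univ) (w := 1)
    (ψ := LinearMap.id (R := k) (M := M)) (by intro s _ m; simp)
  rwa [Finset.insert_erase (Finset.mem_univ i)] at this

/-- The counit. -/
def eps (b : ℕ) (M : Type) [AddCommGroup M] [Module k M] [Module (Al k c b Q) M]
    [IsScalarTower k (Al k c b Q) M] (i : Fin c) : Ind hQ b M i →ₗ[Al k c b Q] M :=
  mkLin (k := k) (c := c) (b := b) (Q := Q) (extMap hQ i 1 LinearMap.id) (semi_one_lin (eps_semi hQ i))

theorem eps_apply (i : Fin c) (f : Fin (b + 1) → M) :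
    eps hQ b M i (indE hQ i f) = ∑ l : Fin (b + 1), X k c b Q i ^ (l : ℕ) • f l := by
  rw [eps, mkLin_apply, extMap_apply]
  simp

theorem eps_surj (i : Fin c) : Function.Surjective (eps hQ b M i) := by
  intro m
  refine ⟨indE hQ i (Pi.single 0 m), ?_⟩
  rw [eps_apply, Fin.sum_univ_succ]
  simp

/-- First twist. -/
def tw1 (Q : Fin c → Fin c → k) (i : Fin c) : Fin c → k := fun s => Q s i
/-- Second twist. -/
def tw2 (b : ℕ) (Q : Fin c → Fin c → k) (i : Fin c) : Fin c → k := fun s => Q s i ^ (b + 1)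

/-- The underlying linear map of `delta`. -/
def deltaK (i : Fin c) : Ind hQ b (Tw b Q M (tw1 Q i)) i →ₗ[k] Ind hQ b M i :=
  (indE hQ i).toLinearMap ∘ₗ (shift_s14 k b M - LinearMap.compLeft (act (Q := Q) (b := b) M i) (Fin (b + 1))) ∘ₗ
    (LinearMap.compLeft (twE (b := b) (Q := Q) (M := M) (tw1 Q i)).symm.toLinearMap (Fin (b + 1))) ∘ₗ
    (indE hQ i).symm.toLinearMap

/-- The functions underlying. -/
def twF (w : Fin c → k) (f : Fin (b + 1) → M) : Fin (b + 1) → Tw b Q M w := fun l => twE w (f l)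

theorem exists_twF (i : Fin c) (m : Ind hQ b (Tw b Q M (tw1 Q i)) i) :
    ∃ f : Fin (b + 1) → M, m = indE hQ i (twF (tw1 Q i) f) := by
  obtain ⟨g, rfl⟩ := (indE hQ i).surjective m
  refine ⟨fun l => (twE (tw1 Q i)).symm (g l), ?_⟩
  congr 1

theorem deltaK_apply (i : Fin c) (f : Fin (b + 1) → M) :
    deltaK hQ i (indE hQ i (twF (b := b) (tw1 Q i) f)) =
      indE hQ i (shift_s14 k b M f - fun l => X k c b Q i • f l) := by
  rfl

theorem shift_twF (w : Fin c → k) (f : Fin (b + 1) → M) :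
    shift_s14 k b (Tw b Q M w) (twF w f) = twF w (shift_s14 k b M f) := by
  funext l
  induction l using Fin.cases with
  | zero => simp [twF]
  | succ l => rfl

theorem diag_twF (w : Fin c → k) (i s : Fin c) (f : Fin (b + 1) → M) :
    diag Q (Tw b Q M w) i s (twF w f) = twF w (w s • diag Q M i s f) := by
  funext l
  rw [diag_apply, twF, X_twE, twF, ← map_smul, Pi.smul_apply, diag_apply, smul_comm]

theorem delta_lin (i s : Fin c) (m : Ind hQ b (Tw b Q M (tw1 Q i)) i) :
    deltaK hQ i (X k c b Q s • m) = X k c b Q s • deltaK hQ i m := by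
  obtain ⟨f, rfl⟩ := exists_twF hQ i m
  by_cases h : s = i
  · subst h
    rw [Xi_indE, shift_twF, deltaK_apply, deltaK_apply, Xi_indE]
    congr 1
    funext l
    rw [map_sub]
    simp only [Pi.sub_apply]
    congr 1
    induction l using Fin.cases with
    | zero => simp
    | succ l => rfl
  · rw [Xs_indE hQ h, diag_twF, deltaK_apply, deltaK_apply, Xs_indE hQ h]
    congr 1
    rw [map_sub, map_smul]
    have h1 : Q s i • shift_s14 k b M (diag Q M i s f) = diag Q M i s (shift_s14 k b M f) :=
      (LinearMap.congr_fun (diag_shift (Q := Q) (M := M) (b := b) i s) f).symm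
    rw [tw1, h1]
    congr 1
    funext l
    rw [diag_apply, Pi.smul_apply, diag_apply, X_smul_comm s i, smul_comm (X k c b Q i), smul_comm (X k c b Q i),
      smul_comm (Q s i)]

/-- The map between induced modules. -/
def delta (b : ℕ) (M : Type) [AddCommGroup M] [Module k M] [Module (Al k c b Q) M]
    [IsScalarTower k (Al k c b Q) M] (i : Fin c) :
    Ind hQ b (Tw b Q M (tw1 Q i)) i →ₗ[Al k c b Q] Ind hQ b M i :=
  mkLin (k := k) (c := c) (b := b) (Q := Q) (deltaK hQ i) (delta_lin hQ i)

theorem delta_apply (i : Fin c) (f : Fin (b + 1) → M) :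
    delta hQ b M i (indE hQ i (twF (b := b) (tw1 Q i) f)) =
      indE hQ i (shift_s14 k b M f - fun l => X k c b Q i • f l) := deltaK_apply hQ i f

/-- Underlying linear map of `eta`. -/
def etaK (i : Fin c) : Tw b Q M (tw2 b Q i) →ₗ[k] Ind hQ b (Tw b Q M (tw1 Q i)) i :=
  (indE hQ i).toLinearMap ∘ₗ
    (LinearMap.compLeft (twE (b := b) (Q := Q) (M := M) (tw1 Q i)).toLinearMap (Fin (b + 1))) ∘ₗ
    (LinearMap.pi fun l : Fin (b + 1) => Algebra.lsmul k k M (X k c b Q i ^ (b - (l : ℕ)))) ∘ₗ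
    (twE (b := b) (Q := Q) (M := M) (tw2 b Q i)).symm.toLinearMap

theorem etaK_apply (i : Fin c) (m : M) :
    etaK hQ i (twE (b := b) (tw2 b Q i) m) =
      indE hQ i (twF (tw1 Q i) fun l : Fin (b + 1) => X k c b Q i ^ (b - (l : ℕ)) • m) := rfl

theorem eta_lin (i s : Fin c) (m : Tw b Q M (tw2 b Q i)) :
    etaK hQ i (X k c b Q s • m) = X k c b Q s • etaK hQ i m := by
  obtain ⟨m, rfl⟩ := (twE (tw2 b Q i)).surjective m
  rw [X_twE, etaK_apply, etaK_apply]
  by_cases h : s = i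
  · subst h
    rw [Xi_indE, shift_twF]
    congr 2
    funext l
    rw [tw2, hQ.one, one_pow, one_smul, smul_smul, ← pow_succ]
    induction l using Fin.cases with
    | zero => simp [X_pow]
    | succ l =>
      rw [shift_succ]
      congr 2
      simp
      omega
  · rw [Xs_indE hQ h, diag_twF]
    congr 2
    funext l
    rw [Pi.smul_apply, diag_apply, X_smul_pow_comm, smul_comm (X k c b Q i ^ _) (tw2 b Q i s)]
    simp only [smul_smul, tw1, tw2]
    congr 1
    rw [← pow_add, ← pow_succ']
    congr 1
    have := l.2
    omega

/-- The unit. -/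
def eta (b : ℕ) (M : Type) [AddCommGroup M] [Module k M] [Module (Al k c b Q) M]
    [IsScalarTower k (Al k c b Q) M] (i : Fin c) :
    Tw b Q M (tw2 b Q i) →ₗ[Al k c b Q] Ind hQ b (Tw b Q M (tw1 Q i)) i :=
  mkLin (k := k) (c := c) (b := b) (Q := Q) (etaK hQ i) (eta_lin hQ i)

theorem eta_apply (i : Fin c) (m : M) :
    eta hQ b M i (twE (b := b) (tw2 b Q i) m) =
      indE hQ i (twF (tw1 Q i) fun l : Fin (b + 1) => X k c b Q i ^ (b - (l : ℕ)) • m) := rfl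

theorem eta_inj (i : Fin c) : Function.Injective (eta hQ b M i) := by
  rw [injective_iff_map_eq_zero]
  intro m hm
  obtain ⟨m, rfl⟩ := (twE (tw2 b Q i)).surjective m
  rw [eta_apply, LinearEquiv.map_eq_zero_iff] at hm
  have := congrFun hm (Fin.last b)
  simp [twF] at this
  rw [this, map_zero]

theorem eps_delta (i : Fin c) (m) : eps hQ b M i (delta hQ b M i m) = 0 := by
  obtain ⟨f, rfl⟩ := exists_twF hQ i m
  rw [delta_apply, eps_apply]
  simp only [Pi.sub_apply, smul_sub, Finset.sum_sub_distrib]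
  rw [sub_eq_zero, Fin.sum_univ_succ, Fin.sum_univ_castSucc]
  simp [smul_smul, ← pow_succ, X_pow]

theorem delta_exact (i : Fin c) (m) (hm : eps hQ b M i m = 0) : ∃ n, delta hQ b M i n = m := by
  obtain ⟨f, rfl⟩ := (indE hQ i).surjective m
  rw [eps_apply] at hm
  -- extend `f` by zero to all natural numbers
  let F : ℕ → M := fun l => if h : l < b + 1 then f ⟨l, h⟩ else 0
  let g : ℕ → M := fun l => ∑ m ∈ Finset.Ico (l + 1) (b + 1), X k c b Q i ^ (m - (l + 1)) • F m
  have hg : ∀ l < b, g l = F (l + 1) + X k c b Q i • g (l + 1) := by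
    intro l hl
    simp only [g]
    rw [Finset.sum_eq_sum_Ico_succ_bot (by omega), Finset.smul_sum]
    simp only [Nat.sub_self, pow_zero, one_smul]
    congr 1
    refine Finset.sum_congr rfl fun m hm => ?_
    rw [Finset.mem_Ico] at hm
    rw [smul_smul, ← pow_succ']
    congr 2; omega
  have hm' : F 0 + X k c b Q i • g 0 = 0 := by
    rw [← hm, Finset.sum_fin_eq_sum_range, Finset.range_eq_Ico, Finset.sum_eq_sum_Ico_succ_bot (by omega)]
    simp only [g]
    rw [Finset.smul_sum]
    simp only [F]
    congr 1
    · simp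
    · refine Finset.sum_congr rfl fun m hm => ?_
      rw [Finset.mem_Ico] at hm
      rw [smul_smul, ← pow_succ', dif_pos hm.2, dif_pos hm.2]
      congr 2; omega
  refine ⟨indE hQ i (twF (tw1 Q i) fun l => g l), ?_⟩
  rw [delta_apply]
  congr 1
  funext l
  rw [Pi.sub_apply]
  have hF : f l = F l := by simp only [F]; rw [dif_pos l.2]
  induction l using Fin.cases with
  | zero =>
    rw [hF, shift_zero]
    simp only [Fin.val_zero]
    rw [zero_sub, neg_eq_iff_eq_neg, eq_neg_iff_add_eq_zero, add_comm, hm']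
  | succ l =>
    rw [shift_succ, hF, Fin.val_castSucc, hg l l.2, Fin.val_succ, add_sub_cancel_right]

theorem eta_exact (i : Fin c) : Function.Exact (eta hQ b M i) (delta hQ b M i) := by
  intro m
  constructor
  · intro hm
    obtain ⟨f, rfl⟩ := exists_twF hQ i m
    rw [delta_apply, LinearEquiv.map_eq_zero_iff] at hm
    refine ⟨twE (tw2 b Q i) (f (Fin.last b)), ?_⟩
    rw [eta_apply]
    congr 2
    funext l
    have : ∀ n (hn : n ≤ b), f ⟨b - n, by omega⟩ = X k c b Q i ^ n • f (Fin.last b) := by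
      intro n
      induction n with
      | zero => intro _; rw [pow_zero, one_smul]; rfl
      | succ n ih =>
        intro hn
        rw [pow_succ', mul_smul, ← ih (by omega)]
        have := congrFun hm (Fin.succ ⟨b - (n + 1), by omega⟩)
        rw [Pi.sub_apply, shift_succ, Pi.zero_apply, sub_eq_zero] at this
        refine this.trans ?_
        congr 2
        refine Fin.ext ?_
        rw [Fin.val_succ]
        change b - (n + 1) + 1 = b - n
        omega
    rw [← this _ (by omega)]
    congr 1
    ext
    have := l.2
    simp
    omega
  · rintro ⟨m, rfl⟩
    obtain ⟨m, rfl⟩ := (twE (tw2 b Q i)).surjective m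
    rw [eta_apply, delta_apply, LinearEquiv.map_eq_zero_iff]
    funext l
    rw [Pi.sub_apply, Pi.zero_apply, sub_eq_zero, smul_smul, ← pow_succ']
    induction l using Fin.cases with
    | zero => simp [X_pow]
    | succ l =>
      rw [shift_succ]
      congr 2
      simp
      omega

theorem ses_one (i : Fin c) : SES (A := Al k c b Q) (M := LinearMap.ker (eps hQ b M i)) (LinearMap.ker (eps hQ b M i)).subtype (eps hQ b M i) where
  inj := Subtype.val_injective
  exact := LinearMap.exact_subtype_ker_map _
  surj := eps_surj hQ i

theorem ses_two (i : Fin c) : SES (A := Al k c b Q) (L := LinearMap.ker (eps hQ b M i)) (eta hQ b M i)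
    ((delta hQ b M i).codRestrict (LinearMap.ker (eps hQ b M i)) (fun m => eps_delta hQ i m)) where
  inj := eta_inj hQ i
  exact := by
    intro m
    rw [← eta_exact hQ i m, Subtype.ext_iff]; rfl
  surj := by
    rintro ⟨m, hm⟩
    obtain ⟨n, hn⟩ := delta_exact hQ i m hm
    exact ⟨n, Subtype.ext hn⟩

end Seq
end ExtSym


namespace ExtSym

set_option linter.unusedSectionVars false

section Cover
variable {k : Type} [Field k] {c b : ℕ} {Q : Fin c → Fin c → k}

theorem cover (hQ : QM Q) (T : Finset (Fin c)) : ∀ (L : Type) [AddCommGroup L] [Module k L] [Module (Al k c b Q) L]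
    [IsScalarTower k (Al k c b Q) L],
    ∃ (F : Type) (_ : AddCommGroup F) (_ : Module k F) (_ : Module (Al k c b Q) F)
      (_ : IsScalarTower k (Al k c b Q) F) (π : F →ₗ[Al k c b Q] L),
      Function.Surjective π ∧ (∀ U, Disjoint U T → Good b Q U L → Good b Q (U ∪ T) F) ∧
      (Module.Finite k L → Module.Finite k F ∧
        Module.finrank k F = (b + 1) ^ T.card * Module.finrank k L) ∧
      (∀ (Y : Type) [AddCommGroup Y] [Module k Y] [Module (Al k c b Q) Y]
        [IsScalarTower k (Al k c b Q) Y] (ψ : L →ₗ[k] Y), ∃ Ψ : F →ₗ[k] Y, Semi b Q T 1 Ψ ∧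
          LinearMap.range ψ ≤ LinearMap.range Ψ) := by
  induction T using Finset.induction_on with
  | empty =>
    intro L _ _ _ _
    refine ⟨L, inferInstance, inferInstance, inferInstance, inferInstance, LinearMap.id,
      fun x => ⟨x, rfl⟩, ?_, ?_, ?_⟩
    · intro U _ h; simpa using h
    · intro h; simp [h]
    · intro Y _ _ _ _ ψ
      exact ⟨ψ, fun s hs => by simp at hs, le_rfl⟩
  | insert i T hi ih =>
    intro L _ _ _ _
    obtain ⟨F, _, _, _, _, π, hπ, h1, h2, h3⟩ := ih L
    refine ⟨Ind hQ b F i, inferInstance, inferInstance, inferInstance, inferInstance,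
      π ∘ₗ eps hQ b F i, hπ.comp (eps_surj hQ i), ?_, ?_, ?_⟩
    · intro U hU h
      rw [Finset.disjoint_insert_right] at hU
      have := good_ind hQ (i := i) (by simp [hU.1, hi]) (h1 U hU.2 h)
      rwa [Finset.union_insert]
    · intro h
      obtain ⟨hf, hr⟩ := h2 h
      refine ⟨inferInstance, ?_⟩
      rw [← (indE hQ i).finrank_eq, Module.finrank_pi_fintype, Finset.card_insert_of_notMem hi]
      simp [hr, pow_succ']
      ring
    · intro Y _ _ _ _ ψ
      obtain ⟨Ψ, hs, hr⟩ := h3 Y ψ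
      refine ⟨extMap (b := b) hQ i ((1 : Fin c → k) i) Ψ, extMap_semi hQ hi hs, hr.trans ?_⟩
      rintro _ ⟨m, rfl⟩
      refine ⟨indE hQ i (Pi.single 0 m), ?_⟩
      rw [extMap_apply, Fin.sum_univ_succ]
      simp

theorem cover_proj (hQ : QM Q) (S : Finset (Fin c)) (L : Type) [AddCommGroup L] [Module k L] [Module (Al k c b Q) L]
    [IsScalarTower k (Al k c b Q) L] :
    ∃ (F : Type) (_ : AddCommGroup F) (_ : Module k F) (_ : Module (Al k c b Q) F)
      (_ : IsScalarTower k (Al k c b Q) F) (π : F →ₗ[Al k c b Q] L),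
      Function.Surjective π ∧ Good b Q S F ∧ Module.Projective (Al k c b Q) F := by
  obtain ⟨F, _, _, _, _, π, hπ, h1, -, -⟩ := cover (b := b) hQ Sᶜ L
  obtain ⟨F', _, _, _, _, π', hπ', h1', -, -⟩ := cover (b := b) hQ S F
  refine ⟨F', inferInstance, inferInstance, inferInstance, inferInstance, π ∘ₗ π', hπ.comp hπ', ?_, ?_⟩
  · have := h1' ∅ (by simp) good_empty
    simpa using this
  · have := h1' Sᶜ disjoint_compl_left (by simpa using h1 ∅ (by simp) good_empty)
    apply good_univ
    rwa [Finset.union_comm, Finset.union_compl] at this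

variable (M N : Type) [AddCommGroup M] [Module k M] [Module (Al k c b Q) M]
    [IsScalarTower k (Al k c b Q) M] [AddCommGroup N] [Module (Al k c b Q) N]

/-- Z embeds in a good module with cokernel linked to M. -/
def Link (b : ℕ) (Q : Fin c → Fin c → k) (M N : Type) [AddCommGroup M] [Module (Al k c b Q) M]
    [AddCommGroup N] [Module (Al k c b Q) N] (S : Finset (Fin c)) (m : ℕ) (Z : Type)
    [AddCommGroup Z] [Module (Al k c b Q) Z] : Prop :=
  ∃ (K : Type) (_ : AddCommGroup K) (_ : Module k K) (_ : Module (Al k c b Q) K)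
    (_ : IsScalarTower k (Al k c b Q) K) (L : Type) (_ : AddCommGroup L) (_ : Module k L)
    (_ : Module (Al k c b Q) L) (_ : IsScalarTower k (Al k c b Q) L) (f : Z →ₗ[Al k c b Q] K)
    (g : K →ₗ[Al k c b Q] L), SES f g ∧ Good b Q S K ∧
      ∀ j, EZ (Al k c b Q) M N (j + 1 + m) → EZ (Al k c b Q) L N (j + 1)

variable {M N}

theorem link_congr {S : Finset (Fin c)} {m : ℕ} {Z Z' : Type} [AddCommGroup Z]
    [Module (Al k c b Q) Z] [AddCommGroup Z'] [Module (Al k c b Q) Z'] (e : Z' ≃ₗ[Al k c b Q] Z)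
    (h : Link b Q M N S m Z) : Link b Q M N S m Z' := by
  obtain ⟨K, _, _, _, _, L, _, _, _, _, f, g, hs, hK, hE⟩ := h
  refine ⟨K, inferInstance, inferInstance, inferInstance, inferInstance, L, inferInstance,
    inferInstance, inferInstance, inferInstance, f ∘ₗ e.toLinearMap, g, ⟨?_, ?_, hs.surj⟩, hK, hE⟩
  · exact hs.inj.comp e.injective
  · intro x
    rw [hs.exact x]
    constructor
    · rintro ⟨z, rfl⟩; exact ⟨e.symm z, by simp⟩
    · rintro ⟨z, rfl⟩; exact ⟨e z, rfl⟩

theorem link_step {S : Finset (Fin c)} {m : ℕ} {Z₁ Z₂ P : Type} [AddCommGroup Z₁]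
    [Module (Al k c b Q) Z₁] [AddCommGroup Z₂] [Module (Al k c b Q) Z₂]
    [AddCommGroup P] [Module k P] [Module (Al k c b Q) P] [IsScalarTower k (Al k c b Q) P]
    (hQ : QM Q)
    (hP : Good b Q S P) {ι : Z₂ →ₗ[Al k c b Q] P} {p : P →ₗ[Al k c b Q] Z₁} (hs' : SES ι p)
    (h : Link b Q M N S m Z₁) : Link b Q M N S (m + 1) Z₂ := by
  obtain ⟨K, _, _, _, _, L, _, _, _, _, f, g, hs, hK, hE⟩ := h
  obtain ⟨F, _, _, _, _, π, hπ, hF, hproj⟩ := cover_proj (b := b) hQ S L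
  obtain ⟨h, hh⟩ := Module.projective_lifting_property g π hs.surj
  have hh' : ∀ y, g (h y) = π y := fun y => LinearMap.congr_fun hh y
  let ρ : (P × F) →ₗ[Al k c b Q] K := LinearMap.coprod (f ∘ₗ p) h
  have hρa : ∀ x y, ρ (x, y) = f (p x) + h y := fun x y => rfl
  have hgf : ∀ z, g (f z) = 0 := hs.exact.apply_apply_eq_zero
  have hpi : ∀ z, p (ι z) = 0 := hs'.exact.apply_apply_eq_zero
  have hρ : Function.Surjective ρ := by
    intro x
    obtain ⟨y, hy⟩ := hπ (g x)
    obtain ⟨z, hz⟩ := (hs.exact (x - h y)).1 (by rw [map_sub, hh', hy, sub_self])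
    obtain ⟨u, hu⟩ := hs'.surj z
    exact ⟨(u, y), by rw [hρa, hu, hz, sub_add_cancel]⟩
  have hgy : ∀ x y, ρ (x, y) = 0 → π y = 0 := by
    intro x y hxy
    have := congrArg g hxy
    rw [hρa, map_add, hgf, hh', map_zero, zero_add] at this
    exact this
  let α : Z₂ →ₗ[Al k c b Q] LinearMap.ker ρ :=
    (LinearMap.inl (Al k c b Q) P F ∘ₗ ι).codRestrict (LinearMap.ker ρ) (fun z => by
      change ρ (ι z, 0) = 0
      rw [hρa, hpi, map_zero, map_zero, add_zero])
  let β : LinearMap.ker ρ →ₗ[Al k c b Q] LinearMap.ker π :=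
    (LinearMap.snd (Al k c b Q) P F ∘ₗ (LinearMap.ker ρ).subtype).codRestrict (LinearMap.ker π)
      (fun z => hgy z.1.1 z.1.2 z.2)
  refine ⟨LinearMap.ker ρ, inferInstance, inferInstance, inferInstance, inferInstance,
    LinearMap.ker π, inferInstance, inferInstance, inferInstance, inferInstance, α, β, ⟨?_, ?_, ?_⟩,
    good_ker (good_prod hP hF) hK ρ hρ, ?_⟩
  · intro x y hxy
    apply hs'.inj
    exact congrArg (fun z => z.1.1) hxy
  · rintro ⟨⟨x, y⟩, hxy⟩
    constructor
    · intro h0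
      have hy : y = 0 := congrArg Subtype.val h0
      subst hy
      have hx : p x = 0 := by
        apply hs.inj
        have : ρ (x, 0) = 0 := hxy
        rw [hρa, map_zero, add_zero] at this
        rw [this, map_zero]
      obtain ⟨z, hz⟩ := (hs'.exact x).1 hx
      refine ⟨z, Subtype.ext ?_⟩
      change (ι z, (0 : F)) = (x, 0)
      rw [hz]
    · rintro ⟨z, hz⟩
      rw [← hz]
      rfl
  · rintro ⟨y, hy⟩
    obtain ⟨z, hz⟩ := (hs.exact (h y)).1 (by rw [hh']; exact hy)
    obtain ⟨u, hu⟩ := hs'.surj z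
    refine ⟨⟨(-u, y), ?_⟩, rfl⟩
    change ρ (-u, y) = 0
    rw [hρa, map_neg, map_neg, hu, hz, neg_add_cancel]
  · intro j hj
    have h1 := hE (j + 1) (by convert hj using 1; ring)
    have hS : SES (A := Al k c b Q) (M := LinearMap.ker π) (LinearMap.ker π).subtype π :=
      ⟨Subtype.val_injective, LinearMap.exact_subtype_ker_map _, hπ⟩
    exact hS.left (ez_projective j) h1

/-- Composition of twists. -/
def twtw (u v : Fin c → k) : Tw b Q M (u * v) ≃ₗ[Al k c b Q] Tw b Q (Tw b Q M u) v :=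
  LinearEquiv.ofBijective (mkLin (k := k) (c := c) (b := b) (Q := Q)
    (((twE (b := b) (Q := Q) (M := M) (u * v)).symm.trans (twE u)).trans
      (twE (b := b) (Q := Q) (M := Tw b Q M u) v)).toLinearMap (by
    intro i m
    obtain ⟨m, rfl⟩ := (twE (u * v)).surjective m
    rw [X_twE]
    simp only [LinearEquiv.coe_coe, LinearEquiv.trans_apply, LinearEquiv.symm_apply_apply]
    rw [X_twE, X_twE, ← map_smul, smul_smul, mul_comm (v i)]; rfl))
    (((twE (b := b) (Q := Q) (M := M) (u * v)).symm.trans (twE u)).trans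
      (twE (b := b) (Q := Q) (M := Tw b Q M u) v)).bijective

/-- Trivial twist. -/
def twone (u : Fin c → k) (hu : u = 1) : M ≃ₗ[Al k c b Q] Tw b Q M u :=
  LinearEquiv.ofBijective (mkLin (k := k) (c := c) (b := b) (Q := Q)
    (twE (b := b) (Q := Q) (M := M) u).toLinearMap (by
    intro i m
    simp only [LinearEquiv.coe_coe]
    rw [X_twE, hu, Pi.one_apply, one_smul]))
    (twE (b := b) (Q := Q) (M := M) u).bijective

theorem QM.ne (hQ : QM Q) (i j : Fin c) : Q i j ≠ 0 := left_ne_zero_of_mul_eq_one (hQ.inv i j)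

theorem link_iter (hQ : QM Q) {S : Finset (Fin c)} {i : Fin c} (hi : i ∉ S) (hM : Good b Q S M) (t : ℕ) :
    ∃ m, Link b Q M N (insert i S) m (Tw b Q M (tw2 b Q i ^ (t + 1))) := by
  have key : ∀ w : Fin c → k, (∀ s, w s ≠ 0) → Good b Q (insert i S) (Ind hQ b (Tw b Q M w) i) :=
    fun w hw => good_ind hQ hi (good_twist hM w hw)
  have h1 : ∀ s, tw1 Q i s ≠ 0 := fun s => hQ.ne s i
  have h2 : ∀ n s, (tw2 b Q i ^ n) s ≠ 0 := fun n s => pow_ne_zero n (pow_ne_zero (b + 1) (hQ.ne s i))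
  induction t with
  | zero =>
    have base : Link b Q M N (insert i S) 0 (LinearMap.ker (eps hQ b M i)) :=
      ⟨Ind hQ b M i, inferInstance, inferInstance, inferInstance, inferInstance, M, inferInstance,
        inferInstance, inferInstance, inferInstance, _, _, ses_one hQ i, good_ind hQ hi hM, fun j h => h⟩
    refine ⟨1, ?_⟩
    have := link_step hQ (key _ h1) (ses_two hQ i) base
    rw [zero_add, pow_one]
    exact this
  | succ t ih =>
    obtain ⟨m, hm⟩ := ih
    set M' := Tw b Q M (tw2 b Q i ^ (t + 1)) with hM'
    have hG' : Good b Q S M' := good_twist hM _ (h2 _)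
    have s1 : Link b Q M N (insert i S) (m + 1) (LinearMap.ker (eps hQ b M' i)) :=
      link_step hQ (good_ind hQ hi hG') (ses_one hQ i) hm
    have s2 : Link b Q M N (insert i S) (m + 1 + 1) (Tw b Q M' (tw2 b Q i)) :=
      link_step hQ (good_ind hQ hi (good_twist hG' _ h1)) (ses_two hQ i) s1
    refine ⟨m + 1 + 1, ?_⟩
    rw [pow_succ]
    exact link_congr (twtw _ _) s2

theorem main_vanish_s14 (hQ : QM Q) (hr : ∃ r > 0, ∀ i j, Q i j ^ r = 1) (S : Finset (Fin c)) :
    ∀ (M : Type) [AddCommGroup M] [Module k M] [Module (Al k c b Q) M]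
    [IsScalarTower k (Al k c b Q) M], Good b Q S M → (∃ n, ∀ i ≥ n, EZ (Al k c b Q) M N i) →
    ∀ i, EZ (Al k c b Q) M N (i + 1) := by
  induction' hn : (Sᶜ).card with n ih generalizing S
  · intro M _ _ _ _ hM _ i
    have hS : S = Finset.univ := by simpa using hn
    subst hS
    have := good_univ hM
    exact ez_projective i
  · intro M _ _ _ _ hM hEV
    obtain ⟨i, hi⟩ : (Sᶜ).Nonempty := Finset.card_pos.1 (by omega)
    have hi' : i ∉ S := by simpa using hi
    obtain ⟨r, hr0, hr⟩ := hr
    obtain ⟨t, rfl⟩ : ∃ t, r = t + 1 := ⟨r - 1, by omega⟩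
    obtain ⟨m, hL⟩ := link_iter (N := N) hQ hi' hM t
    have hone : tw2 b Q i ^ (t + 1) = 1 := by
      funext s
      simp only [Pi.pow_apply, tw2, Pi.one_apply]
      rw [pow_right_comm, hr, one_pow]
    have hL' : Link b Q M N (insert i S) m M := link_congr (twone _ hone) hL
    obtain ⟨K, _, _, _, _, L, _, _, _, _, f, g, hs, hK, hE⟩ := hL'
    obtain ⟨n₀, hn₀⟩ := hEV
    have hcard : (insert i S)ᶜ.card = n := by
      rw [Finset.compl_insert, Finset.card_erase_of_mem hi]; omega
    have hKV := ih (insert i S) hcard K hK ⟨n₀ + 1, fun j hj => by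
      obtain ⟨j, rfl⟩ : ∃ t, j = t + 1 := ⟨j - 1, by omega⟩
      exact hs.mid (hn₀ _ (by omega)) (hE j (hn₀ _ (by omega)))⟩
    have hper : ∀ j, EZ (Al k c b Q) M N (j + 1 + 1 + m) → EZ (Al k c b Q) M N (j + 1) := by
      intro j hj
      exact hs.left (hKV j) (hE (j + 1) hj)
    have : ∀ d j, n₀ ≤ j + 1 + d → EZ (Al k c b Q) M N (j + 1) := by
      intro d
      induction d with
      | zero => intro j hj; exact hn₀ _ hj
      | succ d ihd =>
        intro j hj
        apply hper
        have := ihd (j + 1 + m) (by omega)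
        convert this using 1; ring
    intro j
    exact this n₀ j (by omega)

end Cover
end ExtSym


namespace ExtSym

set_option linter.unusedSectionVars false

section Box
variable {k : Type} [Field k] {c b : ℕ}

/-- Exponent vectors. -/
abbrev Box (c b : ℕ) := Fin c → Fin (b + 1)

/-- Decrease the `i`-th exponent. -/
def down (i : Fin c) (u : Box c b) : Box c b := Function.update u i (u i - 1)

theorem down_same (i : Fin c) (u : Box c b) (h : u i ≠ 0) : (down i u i : ℕ) + 1 = u i := by
  have h' : (u i : ℕ) ≠ 0 := fun e => h (Fin.ext e)
  rw [down, Function.update_self, Fin.val_sub_one_of_ne_zero h]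
  omega

theorem down_ne {i j : Fin c} (h : j ≠ i) (u : Box c b) : down i u j = u j := by
  rw [down, Function.update_of_ne h]

theorem down_comm (i j : Fin c) (u : Box c b) : down i (down j u) = down j (down i u) := by
  by_cases h : i = j
  · rw [h]
  · rw [down, down_ne h, down, down, down_ne (Ne.symm h), down, Function.update_comm h]

/-- exponent of the weight -/
def ee (α : Fin c → Fin c → ℕ) (i : Fin c) (u : Box c b) : ℕ := ∑ l, α i l * u l

theorem ee_down (α : Fin c → Fin c → ℕ) (i j : Fin c) (u : Box c b) (h : u i ≠ 0) :
    ee α j u = ee α j (down i u) + α j i := by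
  rw [ee, ee, ← Finset.add_sum_erase _ _ (Finset.mem_univ i),
    ← Finset.add_sum_erase (a := i) _ (fun l => α j l * (down i u l : ℕ)) (Finset.mem_univ i), ← down_same i u h]
  have : ∑ x ∈ Finset.univ.erase i, α j x * (u x : ℕ) =
      ∑ x ∈ Finset.univ.erase i, α j x * (down i u x : ℕ) := by
    refine Finset.sum_congr rfl fun l hl => ?_
    rw [down_ne (Finset.ne_of_mem_erase hl)]
  rw [this]; ring

/-- weighted shift -/
def Op (b : ℕ) (p : k) (α : Fin c → Fin c → ℕ) (i : Fin c) : Module.End k (Box c b → k) where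
  toFun f := fun u => if u i = 0 then 0 else p ^ ee α i u * f (down i u)
  map_add' f g := by
    funext u; by_cases h : u i = 0 <;> simp [h, mul_add]
  map_smul' r g := by
    funext u; by_cases h : u i = 0 <;> simp [h, mul_left_comm]

theorem Op_apply (p : k) (α : Fin c → Fin c → ℕ) (i : Fin c) (f : Box c b → k) (u : Box c b) :
    Op b p α i f u = if u i = 0 then 0 else p ^ ee α i u * f (down i u) := rfl

theorem Op_comm (p : k) (α β : Fin c → Fin c → ℕ) (hα : ∀ i, α i i = 0) (hβ : ∀ i, β i i = 0)
    (i j : Fin c) (f : Box c b → k) :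
    p ^ β j i • Op b p α i (Op b p β j f) = p ^ α i j • Op b p β j (Op b p α i f) := by
  funext u
  simp only [Pi.smul_apply, Op_apply, smul_eq_mul]
  by_cases hij : i = j
  · subst hij
    by_cases hi : u i = 0
    · simp [hi]
    · have h1 := ee_down α i i u hi
      have h2 := ee_down β i i u hi
      rw [hα] at h1
      rw [hβ] at h2
      simp only [hi, if_false, hα, hβ, h1, h2, add_zero]
      split_ifs
      · simp
      · ring
  · rw [down_ne hij, down_ne (Ne.symm hij)]
    by_cases hi : u i = 0
    · simp [hi]
    · by_cases hj : u j = 0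
      · simp [hj]
      · simp only [hi, hj, if_false, down_comm i j]
        have h1 := ee_down β i j u hi
        have h2 := ee_down α j i u hj
        calc p ^ β j i * (p ^ ee α i u * (p ^ ee β j (down i u) * f (down j (down i u))))
            = p ^ ee α i u * p ^ ee β j u * f (down j (down i u)) := by rw [h1]; ring
          _ = _ := by rw [h2]; ring

theorem Op_pow (p : k) (α : Fin c → Fin c → ℕ) (i : Fin c) (n : ℕ) : ∀ (f : Box c b → k) (u : Box c b),
    (u i : ℕ) < n → (Op b p α i ^ n) f u = 0 := by
  induction n with
  | zero => intro f u h; omega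
  | succ n ih =>
    intro f u h
    rw [pow_succ', Module.End.mul_apply, Op_apply]
    split_ifs with h0
    · rfl
    · have := down_same i u h0
      rw [ih _ _ (by omega), mul_zero]

/-- left exponents -/
def lam (i l : Fin c) : ℕ := if l < i then 1 else 0
/-- right exponents -/
def rho (i l : Fin c) : ℕ := if i < l then 1 else 0

theorem unif_qm {q : k} (hq : q ≠ 0) : QM (unifQ k c q) where
  one i := by simp [unifQ]
  inv i j := by
    unfold unifQ
    rcases lt_trichotomy i j with h | h | h
    · simp [h, h.ne', not_lt_of_gt h, hq]
    · simp [h]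
    · simp [h, h.ne', not_lt_of_gt h, hq]

theorem L_rel {q : k} (hq : q ≠ 0) : OpRel b (unifQ k c q) (Op (c := c) b q⁻¹ lam) where
  pow i := by
    refine LinearMap.ext fun f => funext fun u => ?_
    exact Op_pow _ _ _ _ _ _ (u i).2
  comm i j := by
    refine LinearMap.ext fun f => ?_
    have h := Op_comm (b := b) q⁻¹ lam lam (by simp [lam]) (by simp [lam]) i j f
    simp only [Module.End.mul_apply, LinearMap.smul_apply]
    rcases lt_trichotomy i j with hij | hij | hij
    · simp [lam, hij, not_lt_of_gt hij] at h
      rw [← h, smul_smul]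
      simp [unifQ, hij, hq]
    · subst hij; simp [unifQ]
    · simp [lam, hij, not_lt_of_gt hij] at h
      rw [h]
      simp [unifQ, not_lt_of_gt hij, hij.ne']

theorem LR_comm (p : k) (i j : Fin c) (hp : p ≠ 0) (f : Box c b → k) :
    Op b p lam i (Op b p rho j f) = Op b p rho j (Op b p lam i f) := by
  have h := Op_comm (b := b) p lam rho (by simp [lam]) (by simp [rho]) i j f
  have : lam i j = rho j i := rfl
  rw [this] at h
  have h2 := congrArg (fun g => (p ^ rho j i)⁻¹ • g) h
  simpa [smul_smul, hp] using h2

/-- The unit vector -/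
def e0 (k : Type) [Field k] (c b : ℕ) : Box c b → k := Pi.single 0 1

theorem Op_single (p : k) (α : Fin c → Fin c → ℕ) (i : Fin c) (u : Box c b) (hu : u i ≠ 0) :
    Op b p α i (Pi.single (down i u) 1) = p ^ ee α i u • Pi.single u 1 := by
  funext v
  rw [Op_apply, Pi.smul_apply]
  by_cases hv : v = u
  · subst hv; simp [hu]
  · rw [Pi.single_eq_of_ne hv, smul_zero]
    split_ifs with h
    · rfl
    · rw [Pi.single_eq_of_ne, mul_zero]
      intro e
      apply hv
      funext l
      by_cases hl : l = i
      · subst hl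
        have h1 := down_same l v h
        have h2 := down_same l u hu
        rw [e] at h1
        exact Fin.ext (by omega)
      · rw [← down_ne hl v, e, down_ne hl]

theorem Op_e0 (p : k) (α : Fin c → Fin c → ℕ) (hα : ∀ i, α i i = 0) (i : Fin c) (u : Box c b) :
    Op b p α i (e0 k c b) u = if u i ≠ 0 ∧ down i u = 0 then 1 else 0 := by
  rw [Op_apply]
  by_cases hi : u i = 0
  · simp [hi]
  · by_cases hd : down i u = 0
    · have : ee α i u = 0 := by
        rw [ee_down α i i u hi, hα, hd]; simp [ee]
      simp [hi, hd, e0, this]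
    · simp [hi, hd, e0]

/-- The top exponent -/
def topv (c b : ℕ) : Box c b := fun _ => Fin.last b

theorem Op_top {p : k} (hp : p ^ b = 1) (α : Fin c → Fin c → ℕ) (i : Fin c) (f : Box c b → k) :
    Op b p α i f (topv c b) = if topv c b i = 0 then 0 else f (down i (topv c b)) := by
  have : p ^ ee α i (topv c b) = 1 := by
    have : ee α i (topv c b) = b * ∑ l, α i l := by
      rw [ee, Finset.mul_sum]
      refine Finset.sum_congr rfl fun l _ => ?_
      simp [topv, mul_comm]
    rw [this, pow_mul, hp, one_pow]
  rw [Op_apply, this, one_mul]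

theorem dim_bound {Q : Fin c → Fin c → k} (hQ : QM Q) :
    Module.Finite k (Al k c b Q) ∧ Module.finrank k (Al k c b Q) ≤ (b + 1) ^ c := by
  have h0 : OpRel (V := k) b Q (fun _ => 0) := ⟨fun i => by simp, fun i j => by simp⟩
  obtain ⟨F, _, _, _, _, π, -, -, hf, hr⟩ := cover (b := b) hQ Finset.univ (OpMod _ h0)
  obtain ⟨hf1, hf2⟩ := hf inferInstance
  obtain ⟨Ψ, hΨ, hΨr⟩ := hr (Al k c b Q)
    ((LinearMap.toSpanSingleton k (Al k c b Q) 1) ∘ₗ (opE h0).symm.toLinearMap)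
  have h1 : (1 : Al k c b Q) ∈ LinearMap.range Ψ := hΨr ⟨opE h0 1, by simp⟩
  let G : F →ₗ[Al k c b Q] Al k c b Q := mkLin (k := k) (c := c) (b := b) (Q := Q) Ψ (semi_one_lin hΨ)
  have hG : Function.Surjective Ψ := by
    intro y
    obtain ⟨x, hx⟩ := h1
    refine ⟨y • x, ?_⟩
    have : G (y • x) = y • G x := map_smul _ _ _
    change G (y • x) = y
    rw [this]
    change y • Ψ x = y
    rw [hx, smul_eq_mul, mul_one]
  have hfin := Module.Finite.of_surjective Ψ hG
  refine ⟨hfin, ?_⟩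
  have h2 := LinearMap.finrank_le_finrank_of_surjective hG
  have h3 : Module.finrank k (OpMod _ h0) = 1 := by
    rw [← (opE h0).finrank_eq]; simp
  rw [hf2, h3] at h2
  simpa using h2

section Form
variable {q : k} (hq : q ≠ 0)

/-- The regular representation on the box. -/
abbrev BM (b : ℕ) (c : ℕ) {q : k} (hq : q ≠ 0) : Type :=
  OpMod (b := b) (Q := unifQ k c q) (Op (c := c) b q⁻¹ lam) (L_rel hq)

/-- evaluation -/
def ev (u : Box c b) : BM b c hq →ₗ[k] k := LinearMap.proj u ∘ₗ (opE (L_rel hq)).symm.toLinearMap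

/-- base vector -/
def base_s14 (b c : ℕ) {q : k} (hq : q ≠ 0) : BM b c hq := opE (L_rel hq) (e0 k c b)

/-- orbit map -/
def orb (b c : ℕ) {q : k} (hq : q ≠ 0) : Al k c b (unifQ k c q) →ₗ[Al k c b (unifQ k c q)] BM b c hq :=
  LinearMap.toSpanSingleton _ _ (base_s14 b c hq)

theorem orb_apply (y : Al k c b (unifQ k c q)) : orb b c hq y = y • base_s14 b c hq := rfl

theorem ev_X (u : Box c b) (i : Fin c) (f : BM b c hq) : ev hq u (X k c b (unifQ k c q) i • f) =
    if u i = 0 then 0 else q⁻¹ ^ ee lam i u * ev hq (down i u) f := by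
  obtain ⟨f, rfl⟩ := (opE (L_rel hq)).surjective f
  rw [X_opE]; rfl

theorem orb_surj : Function.Surjective (orb b c hq) := by
  have key : ∀ n (u : Box c b), ∑ l, (u l : ℕ) = n →
      opE (L_rel hq) (Pi.single u 1) ∈ LinearMap.range (orb b c hq) := by
    intro n
    induction n with
    | zero =>
      intro u hu
      have : u = 0 := by
        funext l
        apply Fin.ext
        exact (Finset.sum_eq_zero_iff.1 hu) l (Finset.mem_univ l)
      subst this
      exact ⟨1, by rw [orb_apply, one_smul]; rfl⟩
    | succ n ih =>
      intro u hu
      obtain ⟨i, hi⟩ : ∃ i, u i ≠ 0 := by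
        by_contra! h
        simp [h] at hu
      have hd : ∑ l, (down i u l : ℕ) = n := by
        rw [← Finset.add_sum_erase _ _ (Finset.mem_univ i)] at hu ⊢
        have h1 := down_same i u hi
        have h2 : ∑ x ∈ Finset.univ.erase i, (u x : ℕ) =
          ∑ x ∈ Finset.univ.erase i, (down i u x : ℕ) := by
          refine Finset.sum_congr rfl fun l hl => ?_
          rw [down_ne (Finset.ne_of_mem_erase hl)]
        omega
      have h3 := Submodule.smul_mem _ (X k c b (unifQ k c q) i) (ih _ hd)
      rw [X_opE, Op_single _ _ _ _ hi, map_smul] at h3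
      have h4 := Submodule.smul_of_tower_mem _ ((q⁻¹ ^ ee lam i u)⁻¹) h3
      rwa [smul_smul, inv_mul_cancel₀ (pow_ne_zero _ (inv_ne_zero hq)), one_smul] at h4
  intro f
  obtain ⟨f, rfl⟩ := (opE (L_rel hq)).surjective f
  change _ ∈ LinearMap.range (orb b c hq)
  have : f = ∑ u, f u • Pi.single u (1 : k) := by
    conv_lhs => rw [← Finset.univ_sum_single f]
    refine Finset.sum_congr rfl fun u _ => ?_
    rw [← Pi.single_smul, smul_eq_mul, mul_one]
  rw [this, map_sum]
  refine Submodule.sum_mem _ fun u _ => ?_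
  rw [map_smul]
  exact Submodule.smul_of_tower_mem _ _ (key _ u rfl)

theorem orb_inj : Function.Injective (orb b c hq) := by
  obtain ⟨hfin, hd⟩ := dim_bound (b := b) (unif_qm (c := c) hq)
  let φ : Al k c b (unifQ k c q) →ₗ[k] BM b c hq := (orb b c hq).restrictScalars k
  have hs : Function.Surjective φ := orb_surj hq
  have h1 : Module.finrank k (BM b c hq) = (b + 1) ^ c := by
    rw [← (opE (L_rel hq)).finrank_eq]; simp
  have h2 := LinearMap.finrank_le_finrank_of_surjective hs
  have h3 : Module.finrank k (Al k c b (unifQ k c q)) = Module.finrank k (BM b c hq) := by omega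
  exact (LinearMap.injective_iff_surjective_of_finrank_eq_finrank h3).2 hs

/-- The form. -/
def form (b c : ℕ) {q : k} (hq : q ≠ 0) : Al k c b (unifQ k c q) →ₗ[k] k :=
  ev hq (topv c b) ∘ₗ (orb b c hq).restrictScalars k

theorem form_apply (y : Al k c b (unifQ k c q)) :
    form b c hq y = ev hq (topv c b) (y • base_s14 b c hq) := rfl

/-- Right multiplication. -/
def RR (b c : ℕ) {q : k} (hq : q ≠ 0) (i : Fin c) : BM b c hq →ₗ[Al k c b (unifQ k c q)] BM b c hq :=
  mkLin (k := k) (c := c) (b := b) (Q := unifQ k c q)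
    ((opE (L_rel hq)).toLinearMap ∘ₗ Op b q⁻¹ rho i ∘ₗ (opE (L_rel hq)).symm.toLinearMap) (by
    intro j f
    obtain ⟨f, rfl⟩ := (opE (L_rel hq)).surjective f
    rw [X_opE]
    simp only [LinearMap.comp_apply, LinearEquiv.coe_coe, LinearEquiv.symm_apply_apply]
    rw [X_opE, LR_comm _ _ _ (inv_ne_zero hq)])

theorem RR_opE (i : Fin c) (f : Box c b → k) :
    RR b c hq i (opE (L_rel hq) f) = opE (L_rel hq) (Op b q⁻¹ rho i f) := rfl

theorem RR_base (i : Fin c) : RR b c hq i (base_s14 b c hq) = X k c b (unifQ k c q) i • base_s14 b c hq := by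
  rw [base_s14, RR_opE, X_opE]
  congr 1
  funext u
  rw [Op_e0 _ _ (by simp [rho]), Op_e0 _ _ (by simp [lam])]

theorem RR_top (hb : q ^ b = 1) (i : Fin c) (f : BM b c hq) :
    ev hq (topv c b) (RR b c hq i f) = ev hq (topv c b) (X k c b (unifQ k c q) i • f) := by
  obtain ⟨f, rfl⟩ := (opE (L_rel hq)).surjective f
  rw [RR_opE, X_opE]
  have hp : q⁻¹ ^ b = 1 := by rw [inv_pow, hb, inv_one]
  exact (Op_top hp rho i f).trans (Op_top hp lam i f).symm

theorem form_symm (hb : q ^ b = 1) (x y : Al k c b (unifQ k c q)) :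
    form b c hq (x * y) = form b c hq (y * x) := by
  refine Al_induction (P := fun x => ∀ y, form b c hq (x * y) = form b c hq (y * x)) ?_ ?_ ?_ ?_ x y
  · intro r y; rw [Algebra.commutes]
  · intro i y
    rw [form_apply, form_apply, mul_smul, mul_smul, ← RR_top hq hb, map_smul, RR_base]
  · intro x x' hx hx' y
    rw [add_mul, mul_add, map_add, map_add, hx, hx']
  · intro x x' hx hx' y
    rw [mul_assoc, hx, mul_assoc, hx', mul_assoc]

theorem form_nondeg (y : Al k c b (unifQ k c q)) (h : ∀ z, form b c hq (z * y) = 0) : y = 0 := by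
  apply orb_inj hq
  rw [map_zero]
  set f := orb b c hq y with hf
  have h' : ∀ z : Al k c b (unifQ k c q), ev hq (topv c b) (z • f) = 0 := by
    intro z
    have := h z
    rw [form_apply, mul_smul] at this
    exact this
  have key : ∀ n (u : Box c b), ∑ l, (b - (u l : ℕ)) = n →
      ∀ z : Al k c b (unifQ k c q), ev hq u (z • f) = 0 := by
    intro n
    induction n with
    | zero =>
      intro u hu
      have : u = topv c b := by
        funext l
        apply Fin.ext
        have h1 := (Finset.sum_eq_zero_iff.1 hu) l (Finset.mem_univ l)
        have h2 := (u l).2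
        simp only [topv, Fin.val_last]
        omega
      rw [this]; exact h'
    | succ n ih =>
      intro u hu z
      obtain ⟨i, hi⟩ : ∃ i, (u i : ℕ) < b := by
        by_contra! hh
        have : ∑ l, (b - (u l : ℕ)) = 0 := Finset.sum_eq_zero fun l _ => by have := hh l; omega
        omega
      let v : Box c b := Function.update u i ⟨u i + 1, by omega⟩
      have hvi : v i ≠ 0 := by
        simp only [v, Function.update_self]
        intro e; simpa using congrArg Fin.val e
      have hvi' : (v i : ℕ) = u i + 1 := by simp [v]
      have hvl : ∀ l, l ≠ i → v l = u l := fun l hl => by simp [v, hl]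
      have hdv : down i v = u := by
        funext l
        by_cases hl : l = i
        · subst hl
          have := down_same l v hvi
          exact Fin.ext (by omega)
        · rw [down_ne hl, hvl l hl]
      have hsum : ∑ l, (b - (v l : ℕ)) = n := by
        rw [← Finset.add_sum_erase _ _ (Finset.mem_univ i)] at hu ⊢
        have h2 : ∑ x ∈ Finset.univ.erase i, (b - (v x : ℕ)) =
          ∑ x ∈ Finset.univ.erase i, (b - (u x : ℕ)) := by
          refine Finset.sum_congr rfl fun l hl => ?_
          rw [hvl l (Finset.ne_of_mem_erase hl)]
        omega
      have h3 := ih v hsum (X k c b (unifQ k c q) i * z)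
      rw [mul_smul, ev_X, if_neg hvi, hdv] at h3
      exact (mul_eq_zero.1 h3).resolve_left (pow_ne_zero _ (inv_ne_zero hq))
  apply (opE (L_rel hq)).symm.injective
  funext u
  have := key _ u rfl 1
  rw [one_smul] at this
  rw [map_zero]
  exact this

end Form
end Box
end ExtSym


namespace ExtSym

set_option linter.unusedSectionVars false

section Duality
variable {k : Type} [Field k] {A : Type} [Ring A] [Algebra k A]

/-- A symmetrizing form. -/
structure SymForm (t : A →ₗ[k] k) : Prop where
  fin : Module.Finite k A
  symm : ∀ x y, t (x * y) = t (y * x)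
  nondeg : ∀ y, (∀ z, t (z * y) = 0) → y = 0

variable {t : A →ₗ[k] k}

theorem SymForm.ext (ht : SymForm t) {x y : A} (h : ∀ z, t (z * x) = t (z * y)) : x = y := by
  rw [← sub_eq_zero]
  apply ht.nondeg
  intro z
  rw [mul_sub, map_sub, h, sub_self]

variable {N : Type} [AddCommGroup N] [Module k N] [Module A N] [IsScalarTower k A N]

theorem SymForm.repr (ht : SymForm t) (φ : A →ₗ[k] k) : ∃ y, ∀ z, t (z * y) = φ z := by
  have := ht.fin
  let T : A →ₗ[k] Module.Dual k A := (LinearMap.mul k A).flip.compr₂ t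
  have hT : ∀ y z, T y z = t (z * y) := fun y z => rfl
  have hinj : Function.Injective T := by
    intro x y hxy
    apply ht.ext
    intro z
    rw [← hT, ← hT, hxy]
  have hsurj : Function.Surjective T :=
    (LinearMap.injective_iff_surjective_of_finrank_eq_finrank (Subspace.dual_finrank_eq).symm).1 hinj
  obtain ⟨y, hy⟩ := hsurj φ
  exact ⟨y, fun z => by rw [← hT, hy]⟩

theorem SymForm.lift (ht : SymForm t) (φ : N →ₗ[k] k) :
    ∃ Φ : N →ₗ[A] A, ∀ n, t (Φ n) = φ n := by
  have h : ∀ n : N, ∃ y, ∀ z : A, t (z * y) = φ (z • n) := fun n =>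
    ht.repr (φ ∘ₗ (LinearMap.toSpanSingleton A N n).restrictScalars k)
  choose F hF using h
  refine ⟨{ toFun := F, map_add' := ?_, map_smul' := ?_ }, ?_⟩
  · intro x y
    apply ht.ext
    intro z
    rw [hF, mul_add, map_add, hF, hF, smul_add, map_add]
  · intro a x
    apply ht.ext
    intro z
    rw [hF, RingHom.id_apply, smul_eq_mul, ← mul_assoc, hF, mul_smul]
  · intro n
    have := hF n 1
    rw [one_mul, one_smul] at this
    exact this

theorem SymForm.injective_self (ht : SymForm t) : Module.Injective A A where
  out := by
    intro X Y _ _ _ _ f hf g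
    letI : Module k X := Module.compHom X (algebraMap k A)
    letI : Module k Y := Module.compHom Y (algebraMap k A)
    haveI : IsScalarTower k A X := ⟨fun r a x => by
      rw [Algebra.smul_def, mul_smul]; rfl⟩
    haveI : IsScalarTower k A Y := ⟨fun r a x => by
      rw [Algebra.smul_def, mul_smul]; rfl⟩
    obtain ⟨s, hs⟩ := (f.restrictScalars k).exists_leftInverse_of_injective
      (LinearMap.ker_eq_bot.2 hf)
    have hs' : ∀ x, s (f x) = x := fun x => LinearMap.congr_fun hs x
    obtain ⟨Φ, hΦ⟩ := ht.lift (t ∘ₗ g.restrictScalars k ∘ₗ s)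
    refine ⟨Φ, fun x => ht.ext fun z => ?_⟩
    have h1 := hΦ (f (z • x))
    rw [map_smul, map_smul, smul_eq_mul] at h1
    rw [h1, ← map_smul f]
    simp only [LinearMap.comp_apply]
    rw [hs', LinearMap.restrictScalars_apply, map_smul, smul_eq_mul]

theorem SymForm.injective_free (ht : SymForm t) (n : ℕ) :
    CategoryTheory.Injective (ModuleCat.of A (Fin n → A)) := by
  have : Module.Injective A (Fin n → A) := by
    refine ⟨?_⟩
    intro X Y _ _ _ _ f hf g
    have := ht.injective_self.out
    choose h hh using fun i => ht.injective_self.out f hf (LinearMap.proj i ∘ₗ g)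
    refine ⟨LinearMap.pi h, fun x => ?_⟩
    funext i
    exact hh i x
  exact Module.injective_object_of_injective_module A _

theorem SymForm.embed (ht : SymForm t) [Module.Finite k N] :
    ∃ (n : ℕ) (f : N →ₗ[A] (Fin n → A)), Function.Injective f := by
  let B := Module.finBasis k N
  choose Φ hΦ using fun i => ht.lift (N := N) (B.coord i)
  refine ⟨_, LinearMap.pi Φ, ?_⟩
  rw [injective_iff_map_eq_zero]
  intro x hx
  rw [← B.forall_coord_eq_zero_iff]
  intro i
  have : Φ i x = 0 := congrFun hx i
  rw [← hΦ, this, map_zero]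

theorem coker_ses {P : Type} [AddCommGroup P] [Module k P] [Module A P] [IsScalarTower k A P]
    [Module.Finite k P] (f : N →ₗ[A] P) (hf : Function.Injective f) :
    ∃ (L : Type) (_ : AddCommGroup L) (_ : Module k L) (_ : Module A L)
      (_ : IsScalarTower k A L) (_ : Module.Finite k L) (g : P →ₗ[A] L), SES f g := by
  have h1 : IsScalarTower k A (P ⧸ LinearMap.range f) := by
    refine ⟨fun r a x => ?_⟩
    obtain ⟨y, rfl⟩ := Submodule.mkQ_surjective (LinearMap.range f) x
    exact congrArg (LinearMap.range f).mkQ (smul_assoc r a y)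
  have h2 : Module.Finite k (P ⧸ LinearMap.range f) :=
    Module.Finite.of_surjective ((LinearMap.range f).mkQ.restrictScalars k)
      (fun x => Submodule.mkQ_surjective (LinearMap.range f) x)
  have h3 : SES f (LinearMap.range f).mkQ :=
    ⟨hf, LinearMap.exact_map_mkQ_range f, Submodule.mkQ_surjective (LinearMap.range f)⟩
  exact ⟨P ⧸ LinearMap.range f, inferInstance, inferInstance, inferInstance, h1, h2, _, h3⟩

theorem SymForm.cosyz (ht : SymForm t) [Module.Finite k N] :
    ∃ (n : ℕ) (L : Type) (_ : AddCommGroup L) (_ : Module k L) (_ : Module A L)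
      (_ : IsScalarTower k A L) (_ : Module.Finite k L) (f : N →ₗ[A] (Fin n → A))
      (g : (Fin n → A) →ₗ[A] L), SES f g := by
  obtain ⟨n, f, hf⟩ := ht.embed (N := N)
  have := ht.fin
  obtain ⟨L, i1, i2, i3, i4, i5, g, h⟩ := coker_ses (k := k) f hf
  exact ⟨n, L, i1, i2, i3, i4, i5, f, g, h⟩

/-- trace -/
def tr (t : A →ₗ[k] k) {n : ℕ} (α : (Fin n → A) →ₗ[A] (Fin n → A)) : k :=
  ∑ i, t (α (Pi.single i 1) i)

theorem comp_expand {m n : ℕ} (α : (Fin m → A) →ₗ[A] (Fin n → A))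
    (x : Fin m → A) (i : Fin n) : α x i = ∑ j, x j * α (Pi.single j 1) i := by
  have : x = ∑ j, x j • Pi.single j (1 : A) := by
    conv_lhs => rw [← Finset.univ_sum_single x]
    refine Finset.sum_congr rfl fun u _ => ?_
    rw [← Pi.single_smul, smul_eq_mul, mul_one]
  conv_lhs => rw [this, map_sum, Finset.sum_apply]
  simp

theorem SymForm.tr_comm (ht : SymForm t) {m n : ℕ} (α : (Fin m → A) →ₗ[A] (Fin n → A))
    (β : (Fin n → A) →ₗ[A] (Fin m → A)) : tr t (α ∘ₗ β) = tr t (β ∘ₗ α) := by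
  unfold tr
  simp only [LinearMap.comp_apply]
  have h1 : ∀ i, t (α (β (Pi.single i 1)) i) =
      ∑ j, t (β (Pi.single i 1) j * α (Pi.single j 1) i) := by
    intro i; rw [comp_expand, map_sum]
  have h2 : ∀ i, t (β (α (Pi.single i 1)) i) =
      ∑ j, t (α (Pi.single i 1) j * β (Pi.single j 1) i) := by
    intro i; rw [comp_expand, map_sum]
  simp only [h1, h2]
  rw [Finset.sum_comm]
  refine Finset.sum_congr rfl fun i _ => Finset.sum_congr rfl fun j _ => ht.symm _ _

theorem SymForm.exactness (ht : SymForm t) [Module.Finite k N] {n₀ n₁ n₂ : ℕ}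
    (f : (Fin n₀ → A) →ₗ[A] (Fin n₁ → A)) (g : (Fin n₁ → A) →ₗ[A] (Fin n₂ → A))
    (h : ∀ ψ : (Fin n₁ → A) →ₗ[A] N, ψ ∘ₗ f = 0 → ∃ χ : (Fin n₂ → A) →ₗ[A] N, χ ∘ₗ g = ψ)
    (φ : N →ₗ[A] (Fin n₁ → A)) (hφ : g ∘ₗ φ = 0) : ∃ θ : N →ₗ[A] (Fin n₀ → A), f ∘ₗ θ = φ := by
  -- transport to coordinates in the dual space
  let co : (N →ₗ[A] (Fin n₁ → A)) → (Fin n₁ → Module.Dual k N) := fun φ i =>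
    t ∘ₗ (LinearMap.proj i ∘ₗ φ).restrictScalars k
  have co_apply : ∀ φ i n, co φ i n = t (φ n i) := fun _ _ _ => rfl
  have co_inj : Function.Injective co := by
    intro φ φ' e
    ext n i
    apply ht.ext
    intro z
    have := LinearMap.congr_fun (congrFun e i) (z • n)
    rw [co_apply, co_apply, map_smul, map_smul] at this
    exact this
  let W : Submodule k (Fin n₁ → Module.Dual k N) :=
    { carrier := Set.range fun θ : N →ₗ[A] (Fin n₀ → A) => co (f ∘ₗ θ)
      add_mem' := by
        rintro _ _ ⟨θ, rfl⟩ ⟨θ', rfl⟩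
        refine ⟨θ + θ', ?_⟩
        funext i
        ext n
        simp [co_apply]
      zero_mem' := ⟨0, by funext i; ext n; simp [co_apply]⟩
      smul_mem' := by
        rintro r _ ⟨θ, rfl⟩
        obtain ⟨θ', hθ'⟩ : ∃ θ' : N →ₗ[A] (Fin n₀ → A), ∀ n, θ' n = r • θ n :=
          ⟨{ toFun := fun n => r • θ n
             map_add' := fun x y => by simp
             map_smul' := fun a x => by
              rw [map_smul, RingHom.id_apply, smul_comm] }, fun n => rfl⟩
        refine ⟨θ', ?_⟩
        funext i
        ext n
        have : f (r • θ n) = r • f (θ n) := LinearMap.map_smul_of_tower f r _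
        simp [co_apply, hθ', this] }
  by_contra hcon
  have hW : co φ ∉ W := by
    rintro ⟨θ, hθ⟩
    exact hcon ⟨θ, co_inj hθ⟩
  obtain ⟨F, hF, hFW⟩ := Submodule.exists_dual_map_eq_bot_of_notMem hW inferInstance
  let v : Fin n₁ → N := fun i => (Module.evalEquiv k N).symm
    (F ∘ₗ LinearMap.single k (fun _ => Module.Dual k N) i)
  have hv : ∀ ξ : Fin n₁ → Module.Dual k N, F ξ = ∑ i, ξ i (v i) := by
    intro ξ
    conv_lhs => rw [← Finset.univ_sum_single ξ, map_sum]
    refine Finset.sum_congr rfl fun i _ => ?_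
    rw [Module.apply_evalEquiv_symm_apply]; rfl
  let ψ : (Fin n₁ → A) →ₗ[A] N := ∑ i, LinearMap.toSpanSingleton A N (v i) ∘ₗ LinearMap.proj i
  have hψ : ∀ i, ψ (Pi.single i 1) = v i := by
    intro i
    simp only [ψ, LinearMap.sum_apply, LinearMap.comp_apply, LinearMap.proj_apply,
      LinearMap.toSpanSingleton_apply]
    rw [Finset.sum_eq_single i]
    · simp
    · intro j _ hj; simp [hj]
    · simp
  have hpair : ∀ φ, F (co φ) = tr t (φ ∘ₗ ψ) := by
    intro φ
    rw [hv, tr]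
    refine Finset.sum_congr rfl fun i _ => ?_
    rw [co_apply, LinearMap.comp_apply, hψ]
  have hz : ∀ θ : N →ₗ[A] (Fin n₀ → A), tr t (θ ∘ₗ ψ ∘ₗ f) = 0 := by
    intro θ
    have h1 : F (co (f ∘ₗ θ)) = 0 := by
      have : F (co (f ∘ₗ θ)) ∈ W.map F := ⟨_, ⟨θ, rfl⟩, rfl⟩
      rw [hFW] at this
      exact this
    rw [hpair, LinearMap.comp_assoc, ht.tr_comm, LinearMap.comp_assoc] at h1
    exact h1
  have hψf : ψ ∘ₗ f = 0 := by
    have hz' : ∀ j, ψ (f (Pi.single j 1)) = 0 := by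
      intro j
      rw [← Module.forall_dual_apply_eq_zero_iff k]
      intro ξ
      obtain ⟨Θ, hΘ⟩ := ht.lift ξ
      have h1 := hz (LinearMap.single A (fun _ => A) j ∘ₗ Θ)
      rw [tr, Finset.sum_eq_single j] at h1
      · rw [← hΘ]
        simpa using h1
      · intro i _ hi
        simp [hi]
      · simp
    refine LinearMap.pi_ext' fun j => LinearMap.ext_ring ?_
    simpa using hz' j
  obtain ⟨χ, hχ⟩ := h ψ hψf
  apply hF
  rw [hpair, ← hχ, ← LinearMap.comp_assoc, ht.tr_comm, ← LinearMap.comp_assoc, hφ, LinearMap.zero_comp]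
  simp [tr]

theorem SymForm.vanish (ht : SymForm t) [Module.Finite k N]
    (hV : ∀ (M : Type) [AddCommGroup M] [Module k M] [Module A M] [IsScalarTower k A M],
      (∃ n, ∀ i ≥ n, EZ A M N i) → ∀ i, EZ A M N (i + 1)) (i : ℕ) :
    ∀ (M : Type) [AddCommGroup M] [Module k M] [Module A M] [IsScalarTower k A M]
      [Module.Finite k M], (∃ n, ∀ i ≥ n, EZ A M N i) → EZ A N M (i + 1) := by
  have shift_s14 : ∀ {M L : Type} {n : ℕ} [AddCommGroup M] [Module A M] [AddCommGroup L] [Module A L]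
      {f : M →ₗ[A] (Fin n → A)} {g : (Fin n → A) →ₗ[A] L}, SES f g →
      (∃ n, ∀ i ≥ n, EZ A M N i) → (∃ n, ∀ i ≥ n, EZ A L N i) := by
    intro M L n _ _ _ _ f g hs ⟨n₀, h⟩
    refine ⟨n₀ + 1, fun i hi => ?_⟩
    obtain ⟨i, rfl⟩ : ∃ j, i = j + 1 := ⟨i - 1, by omega⟩
    exact hs.right (h i (by omega)) (ez_projective i)
  induction i with
  | zero =>
    intro M _ _ _ _ _ hM
    obtain ⟨n₀, M₁, _, _, _, _, _, f₀, g₀, h₀⟩ := ht.cosyz (N := M)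
    obtain ⟨n₁, M₂, _, _, _, _, _, f₁, g₁, h₁⟩ := ht.cosyz (N := M₁)
    obtain ⟨n₂, M₃, _, _, _, _, _, f₂, g₂, h₂⟩ := ht.cosyz (N := M₂)
    have hE := hV M₃ (shift_s14 h₂ (shift_s14 h₁ (shift_s14 h₀ hM))) 0
    refine h₀.cov_left_one ?_ (ez_injective (ht.injective_free n₀) 0)
    intro φ
    obtain ⟨θ, hθ⟩ := ht.exactness (N := N) (f₁ ∘ₗ g₀) (f₂ ∘ₗ g₁) (by
      intro ψ hψ
      have hψ' : ∀ x, ψ (f₁ x) = 0 := by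
        intro x
        obtain ⟨y, rfl⟩ := h₀.surj x
        exact LinearMap.congr_fun hψ y
      have hker : LinearMap.ker g₁ ≤ LinearMap.ker ψ := by
        intro x hx
        obtain ⟨y, rfl⟩ := (h₁.exact x).1 hx
        exact hψ' y
      let e := g₁.quotKerEquivOfSurjective h₁.surj
      let ψ' : M₂ →ₗ[A] N := (LinearMap.ker g₁).liftQ ψ hker ∘ₗ e.symm.toLinearMap
      have he : ∀ x, ψ' (g₁ x) = ψ x := by
        intro x
        have : e ((LinearMap.ker g₁).mkQ x) = g₁ x := rfl
        rw [← this]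
        simp [ψ']
      obtain ⟨χ, hχ⟩ := h₂.extend hE ψ'
      refine ⟨χ, ?_⟩
      refine LinearMap.ext fun x => ?_
      have := LinearMap.congr_fun hχ (g₁ x)
      rw [he] at this
      exact this) (f₁ ∘ₗ φ) (by
      refine LinearMap.ext fun x => ?_
      change f₂ (g₁ (f₁ (φ x))) = 0
      rw [h₁.exact.apply_apply_eq_zero, map_zero])
    refine ⟨θ, LinearMap.ext fun x => h₁.inj ?_⟩
    exact LinearMap.congr_fun hθ x
  | succ i ih =>
    intro M _ _ _ _ _ hM
    obtain ⟨n₀, M₁, _, _, _, _, _, f₀, g₀, h₀⟩ := ht.cosyz (N := M)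
    exact h₀.cov_left (ih M₁ (shift_s14 h₀ hM)) (ez_injective (ht.injective_free n₀) _)

end Duality
end ExtSym


namespace ExtSym

theorem key {k : Type} [Field k] {c b : ℕ} (hb0 : b ≠ 0) {q : k} (hq : q ^ b = 1)
    (M N : Type) [AddCommGroup M] [Module (Al k c b (unifQ k c q)) M]
    [Module.Finite (Al k c b (unifQ k c q)) M]
    [AddCommGroup N] [Module (Al k c b (unifQ k c q)) N]
    [Module.Finite (Al k c b (unifQ k c q)) N]
    (h : ∃ n₀ : ℕ, ∀ i ≥ n₀, extVanish (Al k c b (unifQ k c q)) M N i) :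
    ∀ i > 0, extVanish (Al k c b (unifQ k c q)) N M i := by
  have hq0 : q ≠ 0 := by
    rintro rfl
    rw [zero_pow hb0] at hq
    exact zero_ne_one hq
  have hQ := unif_qm (c := c) hq0
  have hr : ∃ r > 0, ∀ i j, unifQ k c q i j ^ r = 1 := by
    refine ⟨b, Nat.pos_of_ne_zero hb0, fun i j => ?_⟩
    unfold unifQ
    split_ifs
    · exact hq
    · exact one_pow _
    · rw [inv_pow, hq, inv_one]
  have ht : SymForm (form b c hq0) :=
    ⟨(dim_bound hQ).1, form_symm hq0 hq, form_nondeg hq0⟩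
  have hfin := ht.fin
  letI : Module k M := Module.compHom M (algebraMap k (Al k c b (unifQ k c q)))
  letI : Module k N := Module.compHom N (algebraMap k (Al k c b (unifQ k c q)))
  haveI : IsScalarTower k (Al k c b (unifQ k c q)) M := ⟨fun r a x => by
    rw [Algebra.smul_def, mul_smul]; rfl⟩
  haveI : IsScalarTower k (Al k c b (unifQ k c q)) N := ⟨fun r a x => by
    rw [Algebra.smul_def, mul_smul]; rfl⟩
  haveI : Module.Finite k M := Module.Finite.trans (Al k c b (unifQ k c q)) M
  haveI : Module.Finite k N := Module.Finite.trans (Al k c b (unifQ k c q)) N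
  have h' : ∃ n, ∀ i ≥ n, EZ (Al k c b (unifQ k c q)) M N i := by
    obtain ⟨n, hn⟩ := h
    refine ⟨n + 1, fun i hi => ?_⟩
    obtain ⟨j, rfl⟩ : ∃ j, i = j + 1 := ⟨i - 1, by omega⟩
    exact (extVanish_iff_s14 M N j).1 (hn _ (by omega))
  intro i hi
  obtain ⟨j, rfl⟩ : ∃ j, i = j + 1 := ⟨i - 1, by omega⟩
  refine (extVanish_iff_s14 N M j).2 (ht.vanish ?_ j M h')
  intro X _ _ _ _ hX
  exact main_vanish_s14 hQ hr ∅ X good_empty hX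

end ExtSym

theorem ext_symmetry_uniform_qci
    (k : Type) [Field k] (c a : ℕ) (hc : 2 ≤ c) (ha : 2 ≤ a)
    (q : k) (hq : q ^ (a - 1) = 1)
    (M N : Type)
    [AddCommGroup M] [Module (QCI k c (unifQ k c q) (fun _ => a)) M]
    [Module.Finite (QCI k c (unifQ k c q) (fun _ => a)) M]
    [AddCommGroup N] [Module (QCI k c (unifQ k c q) (fun _ => a)) N]
    [Module.Finite (QCI k c (unifQ k c q) (fun _ => a)) N] :
    List.TFAE
      [∃ n₀ : ℕ, ∀ i ≥ n₀, extVanish (QCI k c (unifQ k c q) (fun _ => a)) M N i,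
       ∀ i > 0, extVanish (QCI k c (unifQ k c q) (fun _ => a)) M N i,
       ∃ n₀ : ℕ, ∀ i ≥ n₀, extVanish (QCI k c (unifQ k c q) (fun _ => a)) N M i,
       ∀ i > 0, extVanish (QCI k c (unifQ k c q) (fun _ => a)) N M i] := by
  obtain ⟨b, rfl⟩ : ∃ b, a = b + 1 := ⟨a - 1, by omega⟩
  rw [Nat.add_sub_cancel] at hq
  have hb0 : b ≠ 0 := by omega
  tfae_have 1 → 4 := ExtSym.key hb0 hq M N
  tfae_have 4 → 3 := fun h => ⟨1, fun i hi => h i hi⟩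
  tfae_have 3 → 2 := ExtSym.key hb0 hq N M
  tfae_have 2 → 1 := fun h => ⟨1, fun i hi => h i hi⟩
  tfae_finish
end
end
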